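/- Let M be a subcomplex of I^n of dimension d whose geometric realization |M| is a compact topological d-manifold without boundary (in particular a ℤ/2-homology d-manifold, the paper's hypothesis), let k ≥ 2, and let S ⊆ M be a subcomplex isomorphic to ∂I^{k+1}. If S is not the boundary of any face of M (there is no (k+1)-dimensional face F ∈ M with S = ∂F̂), then: H_j(|M ∖ S|; ℤ/2) ≅ H_j(|M|; ℤ/2) for all j ≤ d − 2 with j ∉ {d − k, d − k − 1}; and there exists j ∈ {d − k, d − k − 1} with H_j(|M ∖ S|; ℤ/2) not isomorphic to H_j(|M|; ℤ/2). -/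

import Mathlib

/-- A face of the cube `I^n`: `none` marks a free coordinate. -/
def CubeFace (n : ℕ) : Type := Fin n → Option Bool

namespace CubeFace

/-- The order on faces of the cube: `F ≤ G` iff every coordinate of `G` is free
or agrees with the corresponding coordinate of `F`. -/
instance (n : ℕ) : PartialOrder (CubeFace n) where
  le F G := ∀ i, G i = none ∨ F i = G i
  le_refl F i := Or.inr rfl
  le_trans F G H h1 h2 i := by
    rcases h2 i with h | h
    · exact Or.inl h
    · rcases h1 i with h' | h'
      · exact Or.inl (h ▸ h')
      · exact Or.inr (h' ▸ h)
  le_antisymm F G h1 h2 := by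
    funext i
    rcases h1 i with h | h
    · rcases h2 i with h' | h'
      · rw [h, h']
      · rw [← h', h]
    · exact h

/-- The face of `I^n` corresponding to a vertex. -/
def toFace {n : ℕ} (v : Fin n → Bool) : CubeFace n := fun i => some (v i)

/-- The vertex set of a face. -/
def verts {n : ℕ} (F : CubeFace n) : Set (Fin n → Bool) := {v | toFace v ≤ F}

/-- The dimension of a face: its number of free coordinates. -/
def dim {n : ℕ} (F : CubeFace n) : ℕ :=
  letI : DecidablePred (fun i => F i = none) :=
    fun i => (inferInstance : DecidableEq (Option Bool)) (F i) none
  (Finset.univ.filter (fun i => F i = none)).card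

/-- A subcomplex of `I^n`: a nonempty, downward closed set of faces. -/
def IsSubcomplex {n : ℕ} (K : Set (CubeFace n)) : Prop :=
  K.Nonempty ∧ ∀ F ∈ K, ∀ G : CubeFace n, G ≤ F → G ∈ K

/-- The vertex set of a subcomplex. -/
def cvert {n : ℕ} (K : Set (CubeFace n)) : Set (Fin n → Bool) := {v | toFace v ∈ K}

/-- A subcomplex `Γ ⊆ K` is face-like if, for every face `F` of `K`, the set of vertices
of `F` belonging to `Γ` is empty or the vertex set of a face of `Γ`. -/
def FaceLike {n : ℕ} (K Γ : Set (CubeFace n)) : Prop :=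
  ∀ F ∈ K, verts F ∩ cvert Γ = ∅ ∨ ∃ G ∈ Γ, verts F ∩ cvert Γ = verts G

/-- The deletion `K ∖ Γ`: the faces of `K` with no vertex in `Γ`. -/
def delete {n : ℕ} (K Γ : Set (CubeFace n)) : Set (CubeFace n) :=
  {F | F ∈ K ∧ verts F ∩ cvert Γ = ∅}

/-- The geometric realization of a subcomplex of `I^n`, as a subset of `ℝ^n`. -/
def real {n : ℕ} (K : Set (CubeFace n)) : Set (Fin n → ℝ) :=
  ⋃ F ∈ K, {x | (∀ i, 0 ≤ x i ∧ x i ≤ 1) ∧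
    ∀ i, (F i = some false → x i = 0) ∧ (F i = some true → x i = 1)}

/-- The boundary `∂F̂` of a face `F`: all faces strictly below `F`. -/
def bdryHat {n : ℕ} (F : CubeFace n) : Set (CubeFace n) := {G | G ≤ F ∧ G ≠ F}

/-- The boundary of the cube `I^k`: all faces except the top one. -/
def boundaryCube (k : ℕ) : Set (CubeFace k) := {F | F ≠ fun _ => none}

/-- The `k`-skeleton of a subcomplex. -/
def skel {n : ℕ} (k : ℕ) (K : Set (CubeFace n)) : Set (CubeFace n) :=
  {F | F ∈ K ∧ dim F ≤ k}

/-- Isomorphism of cubical subcomplexes: a bijection between the vertex sets under which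
vertex sets of faces correspond to vertex sets of faces. -/
def Iso {m n : ℕ} (K : Set (CubeFace m)) (L : Set (CubeFace n)) : Prop :=
  ∃ f : (Fin m → Bool) → (Fin n → Bool),
    Set.BijOn f (cvert K) (cvert L) ∧
    ∀ W : Set (Fin m → Bool), W ⊆ cvert K →
      ((∃ F ∈ K, verts F = W) ↔ (∃ G ∈ L, verts G = f '' W))

/-- `K` has dimension `d`. -/
def HasDim {n : ℕ} (K : Set (CubeFace n)) (d : ℕ) : Prop :=
  (∀ F ∈ K, dim F ≤ d) ∧ ∃ F ∈ K, dim F = d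

end CubeFace

open CategoryTheory in
/-- The `j`-th singular homology of a topological space with coefficients in `R`. -/
noncomputable def sHomology (R : Type) [CommRing R] (X : Type) [TopologicalSpace X]
    (j : ℕ) : ModuleCat R :=
  ((AlgebraicTopology.alternatingFaceMapComplex (ModuleCat R)).obj
    (((SimplicialObject.whiskering _ _).obj (ModuleCat.free R)).obj
      (TopCat.toSSet.obj (TopCat.of X)))).homology j

/-- `X` is a compact topological `d`-manifold without boundary. -/
def IsCompactManifold (X : Type) [TopologicalSpace X] (d : ℕ) : Prop :=
  CompactSpace X ∧ Nonempty (ChartedSpace (EuclideanSpace ℝ (Fin d)) X)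


namespace DH

abbrev F2 := ZMod 2

/-- A graded differential module over `ZMod 2`. -/
structure GD (V : Type) [AddCommGroup V] [Module F2 V] where
  d : V →ₗ[F2] V
  gr : ℕ → Submodule F2 V
  dd : ∀ v, d (d v) = 0
  d_gr : ∀ m, ∀ v ∈ gr (m + 1), d v ∈ gr m
  d_zero : ∀ v ∈ gr 0, d v = 0

section alg
variable {V : Type} [AddCommGroup V] [Module F2 V] (C : GD V)

/-- relative cycles -/
def GD.Z (P Q : Submodule F2 V) (m : ℕ) : Submodule F2 V := P ⊓ C.gr m ⊓ Q.comap C.d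

/-- relative boundaries -/
def GD.B (P Q : Submodule F2 V) (m : ℕ) : Submodule F2 V :=
  (Q ⊓ C.gr m) ⊔ (P ⊓ C.gr (m + 1)).map C.d

/-- relative homology -/
abbrev GD.H (P Q : Submodule F2 V) (m : ℕ) : Type :=
  (C.Z P Q m) ⧸ (C.B P Q m).comap (C.Z P Q m).subtype

/-- vanishing of relative homology in degree `m` -/
def GD.Van (P Q : Submodule F2 V) (m : ℕ) : Prop := ∀ z ∈ C.Z P Q m, z ∈ C.B P Q m

/-- subcomplex -/
def GD.Sub (P : Submodule F2 V) : Prop := ∀ v ∈ P, C.d v ∈ P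

variable {C} {P Q R : Submodule F2 V} {m : ℕ}

lemma GD.mem_Z {z : V} : z ∈ C.Z P Q m ↔ z ∈ P ∧ z ∈ C.gr m ∧ C.d z ∈ Q := by
  simp [GD.Z, and_assoc]

lemma GD.mem_B {z : V} : z ∈ C.B P Q m ↔
    ∃ q ∈ Q, q ∈ C.gr m ∧ ∃ p ∈ P, p ∈ C.gr (m+1) ∧ z = q + C.d p := by
  simp only [GD.B, Submodule.mem_sup, Submodule.mem_inf, Submodule.mem_map]
  constructor
  · rintro ⟨q, ⟨hq, hq'⟩, _, ⟨p, ⟨hp, hp'⟩, rfl⟩, rfl⟩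
    exact ⟨q, hq, hq', p, hp, hp', rfl⟩
  · rintro ⟨q, hq, hq', p, hp, hp', rfl⟩
    exact ⟨q, ⟨hq, hq'⟩, _, ⟨p, ⟨hp, hp'⟩, rfl⟩, rfl⟩

lemma GD.subsingleton_iff : Subsingleton (C.H P Q m) ↔ C.Van P Q m := by
  rw [Submodule.Quotient.subsingleton_iff, Submodule.eq_top_iff']
  constructor
  · intro h z hz
    exact h ⟨z, hz⟩
  · intro h z
    exact h z.1 z.2

lemma GD.mem_gr_d {z : V} (hz : z ∈ C.gr (m+1)) : C.d z ∈ C.gr m := C.d_gr m z hz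

/-- class of a relative cycle -/
def GD.cls (C : GD V) {P Q : Submodule F2 V} {m : ℕ} (z : V) (hz : z ∈ C.Z P Q m) : C.H P Q m :=
  Submodule.Quotient.mk ⟨z, hz⟩

lemma GD.cls_surj (x : C.H P Q m) : ∃ z, ∃ hz : z ∈ C.Z P Q m, C.cls z hz = x := by
  obtain ⟨z, rfl⟩ := Submodule.Quotient.mk_surjective _ x
  exact ⟨z.1, z.2, rfl⟩

lemma GD.cls_eq_iff {z z' : V} (hz : z ∈ C.Z P Q m) (hz' : z' ∈ C.Z P Q m) :
    C.cls z hz = C.cls z' hz' ↔ z - z' ∈ C.B P Q m :=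
  Submodule.Quotient.eq ((C.B P Q m).comap (C.Z P Q m).subtype)

lemma GD.cls_eq_zero_iff {z : V} (hz : z ∈ C.Z P Q m) :
    C.cls z hz = 0 ↔ z ∈ C.B P Q m :=
  Submodule.Quotient.mk_eq_zero ((C.B P Q m).comap (C.Z P Q m).subtype)

/-- the map on homology induced by a linear map -/
noncomputable def hmap {V' : Type} [AddCommGroup V'] [Module F2 V'] {C : GD V} {C' : GD V'}
    {P Q : Submodule F2 V} {P' Q' : Submodule F2 V'} {m m' : ℕ} (f : V →ₗ[F2] V')
    (hZ : ∀ z ∈ C.Z P Q m, f z ∈ C'.Z P' Q' m')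
    (hB : ∀ z ∈ C.Z P Q m, z ∈ C.B P Q m → f z ∈ C'.B P' Q' m') :
    C.H P Q m →ₗ[F2] C'.H P' Q' m' :=
  Submodule.mapQ _ _ (f.restrict hZ) (fun z hz => hB z.1 z.2 hz)

section
variable {V' : Type} [AddCommGroup V'] [Module F2 V'] {C' : GD V'}
    {P' Q' : Submodule F2 V'} {m' : ℕ} (f : V →ₗ[F2] V')
    (hZ : ∀ z ∈ C.Z P Q m, f z ∈ C'.Z P' Q' m')
    (hB : ∀ z ∈ C.Z P Q m, z ∈ C.B P Q m → f z ∈ C'.B P' Q' m')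

lemma hmap_cls {z : V} (hz : z ∈ C.Z P Q m) :
    hmap f hZ hB (C.cls z hz) = C'.cls (f z) (hZ z hz) := rfl

lemma hmap_inj_iff : Function.Injective (hmap f hZ hB) ↔
    ∀ z ∈ C.Z P Q m, f z ∈ C'.B P' Q' m' → z ∈ C.B P Q m := by
  rw [← LinearMap.ker_eq_bot, Submodule.eq_bot_iff]
  constructor
  · intro h z hz hf
    have := h (C.cls z hz) (by
      rw [LinearMap.mem_ker, hmap_cls, GD.cls_eq_zero_iff]
      exact hf)
    exact (GD.cls_eq_zero_iff _).1 this
  · intro h x hx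
    obtain ⟨z, hz, rfl⟩ := GD.cls_surj x
    rw [LinearMap.mem_ker, hmap_cls, GD.cls_eq_zero_iff] at hx
    exact (GD.cls_eq_zero_iff _).2 (h z hz hx)

lemma hmap_surj_iff : Function.Surjective (hmap f hZ hB) ↔
    ∀ z' ∈ C'.Z P' Q' m', ∃ z ∈ C.Z P Q m, z' - f z ∈ C'.B P' Q' m' := by
  constructor
  · intro h z' hz'
    obtain ⟨x, hx⟩ := h (C'.cls z' hz')
    obtain ⟨z, hz, rfl⟩ := GD.cls_surj x
    refine ⟨z, hz, ?_⟩
    rw [hmap_cls] at hx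
    exact (GD.cls_eq_iff _ _).1 hx.symm
  · intro h x
    obtain ⟨z', hz', rfl⟩ := GD.cls_surj x
    obtain ⟨z, hz, hb⟩ := h z' hz'
    refine ⟨C.cls z hz, ?_⟩
    rw [hmap_cls]
    exact ((GD.cls_eq_iff _ _).2 hb).symm

include hZ hB in
lemma equiv_of (h1 : ∀ z ∈ C.Z P Q m, f z ∈ C'.B P' Q' m' → z ∈ C.B P Q m)
    (h2 : ∀ z' ∈ C'.Z P' Q' m', ∃ z ∈ C.Z P Q m, z' - f z ∈ C'.B P' Q' m') :
    Nonempty (C.H P Q m ≃ₗ[F2] C'.H P' Q' m') :=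
  ⟨LinearEquiv.ofBijective (hmap f hZ hB)
    ⟨(hmap_inj_iff f hZ hB).2 h1, (hmap_surj_iff f hZ hB).2 h2⟩⟩

lemma van_congr (e : Nonempty (C.H P Q m ≃ₗ[F2] C'.H P' Q' m')) (h : C'.Van P' Q' m') :
    C.Van P Q m := by
  obtain ⟨e⟩ := e
  rw [← GD.subsingleton_iff] at h ⊢
  exact e.toEquiv.subsingleton

end

/-! ### triples `Q ≤ R ≤ P` -/

lemma Z_mono {P P' Q Q' : Submodule F2 V} (h : P ≤ P') (h' : Q ≤ Q') : C.Z P Q m ≤ C.Z P' Q' m := by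
  intro z hz
  rw [GD.mem_Z] at *
  exact ⟨h hz.1, hz.2.1, h' hz.2.2⟩

lemma B_mono {P P' Q Q' : Submodule F2 V} (h : P ≤ P') (h' : Q ≤ Q') : C.B P Q m ≤ C.B P' Q' m := by
  intro z hz
  rw [GD.mem_B] at *
  obtain ⟨q, hq, hq', p, hp, hp', rfl⟩ := hz
  exact ⟨q, h' hq, hq', p, h hp, hp', rfl⟩

section triple
variable (hQR : Q ≤ R) (hRP : R ≤ P)

/-- the map `H(R,Q) → H(P,Q)` -/
noncomputable def incl (C : GD V) (Q : Submodule F2 V) {R P : Submodule F2 V} (hRP : R ≤ P) (m : ℕ) :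
    C.H R Q m →ₗ[F2] C.H P Q m :=
  hmap LinearMap.id (fun _ hz => Z_mono hRP le_rfl hz) (fun _ _ hz => B_mono hRP le_rfl hz)

include hQR in
lemma incl_surj (h : C.Van P R m) : Function.Surjective (incl C Q hRP m) := by
  refine (hmap_surj_iff _ _ _).2 fun z hz => ?_
  obtain ⟨q, hq, hq', p, hp, hp', e⟩ := GD.mem_B.1 (h z (Z_mono le_rfl hQR hz))
  rw [GD.mem_Z] at hz
  refine ⟨q, GD.mem_Z.2 ⟨hq, hq', ?_⟩, ?_⟩
  · have := hz.2.2
    rw [e, map_add, C.dd, add_zero] at this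
    exact this
  · refine GD.mem_B.2 ⟨0, Q.zero_mem, Submodule.zero_mem _, p, hp, hp', ?_⟩
    simp [e]

include hQR in
lemma incl_inj (h : C.Van P R (m+1)) : Function.Injective (incl C Q hRP m) := by
  refine (hmap_inj_iff _ _ _).2 fun z hz hb => ?_
  obtain ⟨q, hq, hq', p, hp, hp', e⟩ := GD.mem_B.1 hb
  rw [GD.mem_Z] at hz
  simp only [LinearMap.id_apply] at e
  have hdp : C.d p ∈ R := by
    have : C.d p = z - q := by rw [e]; abel
    rw [this]
    exact R.sub_mem hz.1 (hQR hq)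
  obtain ⟨r, hr, hr', p', hp1, hp1', e'⟩ := GD.mem_B.1 (h p (GD.mem_Z.2 ⟨hp, hp', hdp⟩))
  refine GD.mem_B.2 ⟨q, hq, hq', r, hr, hr', ?_⟩
  rw [e, e', map_add, C.dd, add_zero]

include hQR hRP in
lemma iso_RQ_PQ (h : C.Van P R m) (h' : C.Van P R (m+1)) :
    Nonempty (C.H R Q m ≃ₗ[F2] C.H P Q m) :=
  ⟨LinearEquiv.ofBijective (incl C Q hRP m) ⟨incl_inj hQR hRP h', incl_surj hQR hRP h⟩⟩

include hRP in
lemma van_PQ (h : C.Van P R m) (h' : C.Van R Q m) (hQR : Q ≤ R) : C.Van P Q m := by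
  intro z hz
  obtain ⟨q, hq, hq', p, hp, hp', e⟩ := GD.mem_B.1 (h z (Z_mono le_rfl hQR hz))
  rw [GD.mem_Z] at hz
  have hz2 := hz.2.2
  rw [e, map_add, C.dd, add_zero] at hz2
  have := B_mono hRP le_rfl (h' q (GD.mem_Z.2 ⟨hq, hq', hz2⟩))
  rw [e]
  refine Submodule.add_mem _ this ?_
  exact GD.mem_B.2 ⟨0, Q.zero_mem, Submodule.zero_mem _, p, hp, hp', by simp⟩

/-- criterion: surjectivity of `H_m(R,Q) → H_m(P,Q)` and injectivity in degree `m-1`. -/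
lemma van_PR_of (hQR : Q ≤ R) (hR : C.Sub R)
    (h1 : Function.Surjective (incl C Q hRP m))
    (h2 : ∀ l, m = l + 1 → Function.Injective (incl C Q hRP l)) : C.Van P R m := by
  have key : ∀ z ∈ C.Z P R m, C.d z ∈ Q → z ∈ C.B P R m := by
    intro z hz hd
    rw [GD.mem_Z] at hz
    obtain ⟨z', hz', hb⟩ := (hmap_surj_iff _ _ _).1 h1 z (GD.mem_Z.2 ⟨hz.1, hz.2.1, hd⟩)
    rw [GD.mem_Z] at hz'
    have h3 : z' ∈ C.B P R m :=
      GD.mem_B.2 ⟨z', hz'.1, hz'.2.1, 0, P.zero_mem, Submodule.zero_mem _, by simp⟩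
    have := Submodule.add_mem _ (B_mono le_rfl hQR hb) h3
    simpa using this
  intro z hz
  rcases m with _ | l
  · refine key z hz ?_
    rw [GD.mem_Z] at hz
    rw [C.d_zero z hz.2.1]
    exact Q.zero_mem
  · have hz' := GD.mem_Z.1 hz
    have h3 := (hmap_inj_iff _ _ _).1 (h2 l rfl) (C.d z)
      (GD.mem_Z.2 ⟨hz'.2.2, C.d_gr _ _ hz'.2.1, by rw [C.dd]; exact Q.zero_mem⟩)
      (GD.mem_B.2 ⟨0, Q.zero_mem, Submodule.zero_mem _, z, hz'.1, hz'.2.1, by simp⟩)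
    obtain ⟨q, hq, hq', r, hr, hr', e⟩ := GD.mem_B.1 h3
    have h4 : z - r ∈ C.B P R (l+1) := by
      refine key _ (GD.mem_Z.2 ⟨P.sub_mem hz'.1 (hRP hr), Submodule.sub_mem _ hz'.2.1 hr', ?_⟩) ?_
      · rw [map_sub]; exact R.sub_mem hz'.2.2 (hR r hr)
      · rw [map_sub, e]; simpa using hq
    have h5 : r ∈ C.B P R (l+1) :=
      GD.mem_B.2 ⟨r, hr, hr', 0, P.zero_mem, Submodule.zero_mem _, by simp⟩
    simpa using Submodule.add_mem _ h4 h5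

include hQR hRP in
lemma iso_PQ_PR (hR : C.Sub R) (h : ∀ m, C.Van R Q m) :
    Nonempty (C.H P Q m ≃ₗ[F2] C.H P R m) := by
  refine equiv_of LinearMap.id (fun _ hz => Z_mono le_rfl hQR hz)
    (fun _ _ hz => B_mono le_rfl hQR hz) ?_ ?_
  · intro z hz hb
    obtain ⟨q, hq, hq', p, hp, hp', e⟩ := GD.mem_B.1 hb
    simp only [LinearMap.id_apply] at e
    rw [GD.mem_Z] at hz
    have hz2 := hz.2.2
    rw [e, map_add, C.dd, add_zero] at hz2
    rw [e]
    refine Submodule.add_mem _ (B_mono hRP le_rfl (h m q (GD.mem_Z.2 ⟨hq, hq', hz2⟩))) ?_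
    exact GD.mem_B.2 ⟨0, Q.zero_mem, Submodule.zero_mem _, p, hp, hp', by simp⟩
  · intro z hz
    have hz' := GD.mem_Z.1 hz
    rcases m with _ | l
    · refine ⟨z, GD.mem_Z.2 ⟨hz'.1, hz'.2.1, ?_⟩, by simp⟩
      rw [C.d_zero z hz'.2.1]; exact Q.zero_mem
    · obtain ⟨q, hq, hq', r, hr, hr', e⟩ := GD.mem_B.1 (h l (C.d z)
        (GD.mem_Z.2 ⟨hz'.2.2, C.d_gr _ _ hz'.2.1, by rw [C.dd]; exact Q.zero_mem⟩))
      refine ⟨z - r, GD.mem_Z.2 ⟨P.sub_mem hz'.1 (hRP hr), Submodule.sub_mem _ hz'.2.1 hr', ?_⟩, ?_⟩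
      · rw [map_sub, e]; simpa using hq
      · exact GD.mem_B.2 ⟨r, hr, hr', 0, P.zero_mem, Submodule.zero_mem _, by simp⟩

include hQR hRP in
lemma iso_PR_RQ (hR : C.Sub R) (h : ∀ m, C.Van P Q m) :
    Nonempty (C.H P R (m+1) ≃ₗ[F2] C.H R Q m) := by
  refine equiv_of C.d ?_ ?_ ?_ ?_
  · intro z hz
    rw [GD.mem_Z] at *
    exact ⟨hz.2.2, C.d_gr _ _ hz.2.1, by rw [C.dd]; exact Q.zero_mem⟩
  · intro z _ hz
    obtain ⟨q, hq, hq', p, hp, hp', rfl⟩ := GD.mem_B.1 hz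
    exact GD.mem_B.2 ⟨0, Q.zero_mem, Submodule.zero_mem _, q, hq, hq', by simp [C.dd]⟩
  · intro z hz hb
    have hz' := GD.mem_Z.1 hz
    obtain ⟨q, hq, hq', r, hr, hr', e⟩ := GD.mem_B.1 hb
    have h4 := B_mono le_rfl hQR (h (m+1) (z - r) (GD.mem_Z.2
      ⟨P.sub_mem hz'.1 (hRP hr), Submodule.sub_mem _ hz'.2.1 hr', by rw [map_sub, e]; simpa using hq⟩))
    have h5 : r ∈ C.B P R (m+1) :=
      GD.mem_B.2 ⟨r, hr, hr', 0, P.zero_mem, Submodule.zero_mem _, by simp⟩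
    simpa using Submodule.add_mem _ h4 h5
  · intro z hz
    obtain ⟨q, hq, hq', p, hp, hp', e⟩ := GD.mem_B.1 (h m z (Z_mono hRP le_rfl hz))
    have hz' := GD.mem_Z.1 hz
    have hdp : C.d p ∈ R := by
      have : C.d p = z - q := by rw [e]; abel
      rw [this]
      exact R.sub_mem hz'.1 (hQR hq)
    refine ⟨p, GD.mem_Z.2 ⟨hp, hp', hdp⟩, GD.mem_B.2
      ⟨q, hq, hq', 0, R.zero_mem, Submodule.zero_mem _, by simp [e]⟩⟩

include hRP in
lemma van_PR (hQR : Q ≤ R) (hR : C.Sub R) (h : ∀ m, C.Van P Q m) (h' : ∀ m, C.Van R Q m) :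
    C.Van P R m := by
  obtain ⟨e⟩ := iso_PQ_PR (m := m) hQR hRP hR h'
  exact van_congr ⟨e.symm⟩ (h m)

include hRP in
lemma van_RQ (hQR : Q ≤ R) (h : ∀ m, C.Van P Q m) (h' : ∀ m, C.Van P R m) :
    C.Van R Q m :=
  van_congr (iso_RQ_PQ hQR hRP (h' m) (h' (m+1))) (h m)

include hRP in
lemma van_zero_PR (hQR : Q ≤ R) (h : C.Van P Q 0) : C.Van P R 0 := by
  intro z hz
  rw [GD.mem_Z] at hz
  refine B_mono le_rfl hQR (h z (GD.mem_Z.2 ⟨hz.1, hz.2.1, ?_⟩))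
  rw [C.d_zero z hz.2.1]; exact Q.zero_mem

include hRP in
lemma finite_PQ (hQR : Q ≤ R) (h1 : Module.Finite F2 (C.H R Q m)) (h2 : Module.Finite F2 (C.H P R m)) :
    Module.Finite F2 (C.H P Q m) := by
  let p : C.H P Q m →ₗ[F2] C.H P R m :=
    hmap LinearMap.id (fun _ hz => Z_mono le_rfl hQR hz) (fun _ _ hz => B_mono le_rfl hQR hz)
  have hk : LinearMap.ker p ≤ LinearMap.range (incl C Q hRP m) := by
    intro x hx
    obtain ⟨z, hz, rfl⟩ := GD.cls_surj x
    rw [LinearMap.mem_ker, hmap_cls, GD.cls_eq_zero_iff] at hx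
    obtain ⟨q, hq, hq', p, hp, hp', e⟩ := GD.mem_B.1 hx
    simp only [LinearMap.id_apply] at e
    have hz' := GD.mem_Z.1 hz
    have hz2 := hz'.2.2
    rw [e, map_add, C.dd, add_zero] at hz2
    refine ⟨C.cls q (GD.mem_Z.2 ⟨hq, hq', hz2⟩), ?_⟩
    unfold incl
    rw [hmap_cls]
    refine ((GD.cls_eq_iff _ _).2 ?_).symm
    refine GD.mem_B.2 ⟨0, Q.zero_mem, Submodule.zero_mem _, p, hp, hp', ?_⟩
    simp [e]
  have : Module.Finite F2 (LinearMap.ker p) :=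
    Submodule.finiteDimensional_of_le hk
  have h3 : Module.Finite F2 (LinearMap.range p) := inferInstance
  have e := p.quotKerEquivRange
  have : Module.Finite F2 (C.H P Q m ⧸ LinearMap.ker p) := Module.Finite.equiv e.symm
  exact Module.Finite.of_submodule_quotient (LinearMap.ker p)

end triple

/-- algebraic excision -/
lemma iso_exc {A T : Submodule F2 V} (hA : A ≤ T) (hQ : Q ≤ T) (hR : R = A ⊓ Q) (hAs : C.Sub A)
    (hs : ∀ m, ∀ c ∈ T, c ∈ C.gr m → ∃ a ∈ A, a ∈ C.gr m ∧ ∃ q ∈ Q, q ∈ C.gr m ∧ c = a + q)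
    (hQs : C.Sub Q) :
    Nonempty (C.H A R m ≃ₗ[F2] C.H T Q m) := by
  subst hR
  refine equiv_of LinearMap.id (fun _ hz => Z_mono hA inf_le_right hz)
    (fun _ _ hz => B_mono hA inf_le_right hz) ?_ ?_
  · intro z hz hb
    obtain ⟨q, hq, hq', p, hp, hp', e⟩ := GD.mem_B.1 hb
    simp only [LinearMap.id_apply] at e
    obtain ⟨a, ha, ha', q1, hq1, hq1', rfl⟩ := hs _ p hp hp'
    have hz' := GD.mem_Z.1 hz
    have e2 : z - C.d a = q + C.d q1 := by rw [e, map_add]; abel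
    refine GD.mem_B.2 ⟨z - C.d a, ⟨A.sub_mem hz'.1 (hAs a ha), ?_⟩, ?_, a, ha, ha', by abel⟩
    · rw [e2]; exact Q.add_mem hq (hQs _ hq1)
    · exact Submodule.sub_mem _ hz'.2.1 (C.d_gr _ _ ha')
  · intro z hz
    have hz' := GD.mem_Z.1 hz
    obtain ⟨a, ha, ha', q1, hq1, hq1', rfl⟩ := hs _ z hz'.1 hz'.2.1
    refine ⟨a, GD.mem_Z.2 ⟨ha, ha', hAs _ ha, ?_⟩, GD.mem_B.2
      ⟨q1, hq1, hq1', 0, T.zero_mem, Submodule.zero_mem _, by simp⟩⟩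
    have h1 : C.d a = C.d (a + q1) - C.d q1 := by rw [map_add]; abel
    show C.d a ∈ Q
    rw [h1]
    exact Q.sub_mem hz'.2.2 (hQs _ hq1)

/-- transport along an injective chain map -/
lemma iso_transport {V' : Type} [AddCommGroup V'] [Module F2 V'] {C' : GD V'} (f : V →ₗ[F2] V')
    (hf : Function.Injective f) (hd : ∀ v, f (C.d v) = C'.d (f v))
    (hg : ∀ m v, f v ∈ C'.gr m ↔ v ∈ C.gr m) :
    Nonempty (C.H P Q m ≃ₗ[F2] C'.H (P.map f) (Q.map f) m) := by
  refine equiv_of f ?_ ?_ ?_ ?_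
  · intro z hz
    rw [GD.mem_Z] at *
    exact ⟨Submodule.mem_map_of_mem hz.1, (hg _ _).2 hz.2.1, by
      rw [← hd]; exact Submodule.mem_map_of_mem hz.2.2⟩
  · intro z _ hz
    obtain ⟨q, hq, hq', p, hp, hp', rfl⟩ := GD.mem_B.1 hz
    exact GD.mem_B.2 ⟨f q, Submodule.mem_map_of_mem hq, (hg _ _).2 hq', f p,
      Submodule.mem_map_of_mem hp, (hg _ _).2 hp', by rw [map_add, hd]⟩
  · intro z hz hb
    obtain ⟨_, ⟨q, hq, rfl⟩, hq', _, ⟨p, hp, rfl⟩, hp', e⟩ := GD.mem_B.1 hb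
    refine GD.mem_B.2 ⟨q, hq, (hg _ _).1 hq', p, hp, (hg _ _).1 hp', hf ?_⟩
    rw [e, map_add, hd]
  · intro z' hz'
    obtain ⟨⟨z, hz, rfl⟩, h1, h2⟩ := GD.mem_Z.1 hz'
    refine ⟨z, GD.mem_Z.2 ⟨hz, (hg _ _).1 h1, ?_⟩, by simp⟩
    rw [← hd] at h2
    obtain ⟨w, hw, e⟩ := h2
    rwa [← hf e]

/-- locally nilpotent homotopy lemma -/
lemma van_of_nil (D Φ : V →ₗ[F2] V) (hPs : C.Sub P)
    (hΦ : ∀ v ∈ P, v = Φ v + C.d (D v) + D (C.d v))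
    (hDP : ∀ m, ∀ v ∈ P, v ∈ C.gr m → D v ∈ P ∧ D v ∈ C.gr (m+1))
    (hDQ : ∀ v ∈ Q, D v ∈ Q)
    (hQP : Q ≤ P) (hQs : C.Sub Q)
    (hN : ∀ v ∈ P, ∃ N : ℕ, (Φ ^ N) v ∈ Q) : C.Van P Q m := by
  suffices h : ∀ N : ℕ, ∀ z ∈ C.Z P Q m, (Φ ^ N) z ∈ Q → z ∈ C.B P Q m by
    intro z hz
    obtain ⟨N, h'⟩ := hN z (GD.mem_Z.1 hz).1
    exact h N z hz h'
  intro N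
  induction N with
  | zero =>
    intro z hz hq
    have hz' := GD.mem_Z.1 hz
    exact GD.mem_B.2 ⟨z, by simpa using hq, hz'.2.1, 0, P.zero_mem, Submodule.zero_mem _, by simp⟩
  | succ N ih =>
    intro z hz hq
    have hz' := GD.mem_Z.1 hz
    have h1 : D (C.d z) ∈ Q ∧ D (C.d z) ∈ C.gr m := by
      rcases m with _ | l
      · rw [C.d_zero z hz'.2.1, map_zero]
        exact ⟨Q.zero_mem, Submodule.zero_mem _⟩
      · exact ⟨hDQ _ hz'.2.2, (hDP l _ (hQP hz'.2.2) (C.d_gr _ _ hz'.2.1)).2⟩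
    have h2 := hDP m z hz'.1 hz'.2.1
    have e := hΦ z hz'.1
    have e' : Φ z = z - C.d (D z) - D (C.d z) := by
      conv_rhs => rw [e]
      rw [← e]
      nth_rewrite 2 [e]
      abel
    have h3 : Φ z ∈ C.B P Q m := by
      apply ih
      · rw [e']
        refine GD.mem_Z.2 ⟨?_, ?_, ?_⟩
        · exact P.sub_mem (P.sub_mem hz'.1 (hPs _ h2.1)) (hQP h1.1)
        · exact Submodule.sub_mem _ (Submodule.sub_mem _ hz'.2.1 (C.d_gr _ _ h2.2)) h1.2
        · rw [map_sub, map_sub, C.dd, sub_zero]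
          exact Q.sub_mem hz'.2.2 (hQs _ h1.1)
      · rw [pow_succ] at hq
        exact hq
    rw [e, add_assoc]
    refine Submodule.add_mem _ h3 ?_
    exact GD.mem_B.2 ⟨_, h1.1, h1.2, _, h2.1, h2.2, add_comm _ _⟩

end alg
end DH

set_option linter.unusedSectionVars false
set_option linter.unusedVariables false
set_option linter.unusedSimpArgs false
set_option linter.style.longLine false
namespace DH

lemma F2_add_self {V : Type*} [AddCommGroup V] [Module F2 V] (v : V) : v + v = 0 := by
  rw [← two_smul F2 v, show (2 : F2) = 0 from rfl, zero_smul]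

lemma F2_eq_of_add {V : Type*} [AddCommGroup V] [Module F2 V] {v w : V} (h : v + w = 0) : v = w := by
  have := congrArg (· + w) h
  simpa [add_assoc, F2_add_self] using this

lemma sum_succAbove_cancel {V : Type*} [AddCommGroup V] [Module F2 V] {p : ℕ}
    (f : (Fin p → Fin (p+2)) → V) :
    ∑ i : Fin (p+2), ∑ j : Fin (p+1), f (i.succAbove ∘ j.succAbove) = 0 := by
  rw [← Finset.sum_product']
  refine Finset.sum_involution (fun ij _ => (ij.1.succAbove ij.2, ij.2.predAbove ij.1)) ?_ ?_ ?_ ?_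
  · rintro ⟨i, j⟩ _
    have : (i.succAbove j).succAbove ∘ (j.predAbove i).succAbove = i.succAbove ∘ j.succAbove := by
      funext k
      exact Fin.succAbove_succAbove_succAbove_predAbove i j k
    simp only [this]
    exact F2_add_self _
  · rintro ⟨i, j⟩ _ _ h
    exact Fin.succAbove_ne i j (congrArg Prod.fst h)
  · simp
  · rintro ⟨i, j⟩ _
    simp [Fin.succAbove_succAbove_predAbove, Fin.predAbove_predAbove_succAbove]

/-- the standard simplex -/
abbrev Sx (m : ℕ) : Type := ↥(stdSimplex ℝ (Fin (m+1)))

/-- face inclusion -/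
noncomputable def fc {m : ℕ} (i : Fin (m+2)) : C(Sx m, Sx (m+1)) :=
  ⟨stdSimplex.map i.succAbove, stdSimplex.continuous_map _⟩

/-- convexity class -/
class Cv {W : Type} [NormedAddCommGroup W] [NormedSpace ℝ W] (s : Set W) : Prop where
  cv : Convex ℝ s

instance (m : ℕ) : Cv (stdSimplex ℝ (Fin m)) := ⟨convex_stdSimplex ℝ _⟩

section
variable {W : Type} [NormedAddCommGroup W] [NormedSpace ℝ W] {s : Set W} [Cv s]
variable {W' : Type} [NormedAddCommGroup W'] [NormedSpace ℝ W'] {s' : Set W'} [Cv s']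

instance : Cv (s ×ˢ Set.Icc (0:ℝ) 1) := ⟨Cv.cv.prod (convex_Icc 0 1)⟩

/-- affine simplex -/
noncomputable def comb {p : ℕ} (x : Fin (p+1) → s) : C(Sx p, s) where
  toFun t := ⟨∑ i, t.1 i • (x i).1,
    Cv.cv.sum_mem (fun i _ => t.2.1 i) t.2.2 (fun i _ => (x i).2)⟩
  continuous_toFun := by
    refine Continuous.subtype_mk ?_ _
    refine continuous_finsetSum _ fun i _ => Continuous.smul ?_ continuous_const
    exact (continuous_apply i).comp continuous_subtype_val

lemma comb_val {p : ℕ} (x : Fin (p+1) → s) (t : Sx p) : (comb x t).1 = ∑ i, t.1 i • (x i).1 := rfl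

lemma comb_fc {p : ℕ} (x : Fin (p+2) → s) (i : Fin (p+2)) (t : Sx p) :
    comb x (fc i t) = comb (x ∘ i.succAbove) t := by
  apply Subtype.ext
  rw [comb_val, comb_val]
  rw [Fin.sum_univ_succAbove _ i]
  have h : ∀ j, (fc i t).1 j = ∑ k with i.succAbove k = j, t.1 k := by
    intro j
    exact FunOnFinite.linearMap_apply_apply ℝ ℝ i.succAbove t.1 j
  have h1 : (fc i t).1 i = 0 := by
    rw [h, Finset.sum_eq_zero]
    intro k hk
    exact absurd (Finset.mem_filter.1 hk).2 (Fin.succAbove_ne i k)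
  have h2 : ∀ j, (fc i t).1 (i.succAbove j) = t.1 j := by
    intro j
    rw [h, Finset.sum_eq_single j]
    · intro k hk hkj
      exact absurd (Fin.succAbove_right_injective (Finset.mem_filter.1 hk).2) hkj
    · simp
  simp [h1, h2]

/-- vertices of the standard simplex -/
noncomputable def io (m : ℕ) : Fin (m+1) → Sx m := fun i => ⟨Pi.single i 1, single_mem_stdSimplex ℝ i⟩

lemma comb_io {m : ℕ} (t : Sx m) : comb (io m) t = t := by
  apply Subtype.ext
  rw [comb_val]
  funext j
  simp [io, Finset.sum_apply, Pi.single_apply]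

lemma comb_vertex {m : ℕ} (x : Fin (m+1) → s) (i : Fin (m+1)) : comb x (io m i) = x i := by
  apply Subtype.ext
  rw [comb_val]
  simp [io, Pi.single_apply]

/-- affine maps -/
def Aff (a : s → s') : Prop := ∀ (p : ℕ) (x : Fin (p+1) → s) (t : Sx p), a (comb x t) = comb (a ∘ x) t

lemma aff_comb {p : ℕ} (x : Fin (p+1) → s) : Aff (comb x) := by
  intro q y t
  apply Subtype.ext
  simp only [comb_val, Function.comp, Finset.sum_smul, Finset.smul_sum, Finset.sum_apply, Pi.smul_apply,
    smul_eq_mul, mul_smul]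
  rw [Finset.sum_comm]

lemma fc_eq_comb {m : ℕ} (i : Fin (m+2)) : fc i = comb (io (m+1) ∘ i.succAbove) := by
  ext1 t
  rw [← comb_fc, comb_io]

lemma aff_fc {m : ℕ} (i : Fin (m+2)) : Aff (fc i) := by
  rw [fc_eq_comb]; exact aff_comb _

/-- barycenter -/
noncomputable def bary {p : ℕ} (x : Fin (p+1) → s) : s := comb x stdSimplex.barycenter

lemma bary_aff {a : s → s'} (ha : Aff a) {p : ℕ} (x : Fin (p+1) → s) : a (bary x) = bary (a ∘ x) :=
  ha _ _ _

/-- augmented affine chains -/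
abbrev L (p : ℕ) (s : Set W) : Type := (Fin p → s) →₀ F2

/-- single generator -/
noncomputable abbrev sg {α : Type} (x : α) : α →₀ F2 := Finsupp.single x 1

lemma lhom_ext {α : Type} {V : Type*} [AddCommGroup V] [Module F2 V] {f g : (α →₀ F2) →ₗ[F2] V}
    (h : ∀ x, f (sg x) = g (sg x)) : f = g := by
  apply Finsupp.lhom_ext
  intro x b
  have : Finsupp.single x b = b • sg x := by simp
  rw [this, map_smul, map_smul, h]

/-- linear extension -/
noncomputable def lx {α : Type} {V : Type*} [AddCommGroup V] [Module F2 V] (f : α → V) :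
    (α →₀ F2) →ₗ[F2] V := Finsupp.linearCombination F2 f

@[simp] lemma lx_sg {α : Type} {V : Type*} [AddCommGroup V] [Module F2 V] (f : α → V) (x : α) :
    lx f (sg x) = f x := by simp [lx]

/-- pushforward -/
noncomputable def pf {α β : Type} (f : α → β) : (α →₀ F2) →ₗ[F2] (β →₀ F2) := lx (fun x => sg (f x))

@[simp] lemma pf_sg {α β : Type} (f : α → β) (x : α) : pf f (sg x) = sg (f x) := by simp [pf]

lemma pf_pf {α β γ : Type} (f : α → β) (g : β → γ) (c) : pf g (pf f c) = pf (g ∘ f) c := by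
  have : (pf g).comp (pf f) = pf (g ∘ f) := lhom_ext (by simp)
  exact LinearMap.congr_fun this c

/-- boundary of affine chains -/
noncomputable def bd (s : Set W) (p : ℕ) : L (p+1) s →ₗ[F2] L p s :=
  lx (fun x => ∑ i : Fin (p+1), sg (x ∘ i.succAbove))

lemma bd_sg {p : ℕ} (x : Fin (p+1) → s) : bd s p (sg x) = ∑ i : Fin (p+1), sg (x ∘ i.succAbove) := by
  simp [bd]

lemma bd_bd {p : ℕ} (c : L (p+2) s) : bd s p (bd s (p+1) c) = 0 := by
  have : (bd s p).comp (bd s (p+1)) = 0 := by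
    apply lhom_ext
    intro x
    simp only [LinearMap.comp_apply, bd_sg, map_sum, LinearMap.zero_apply]
    exact sum_succAbove_cancel (fun f => sg (x ∘ f))
  exact LinearMap.congr_fun this c

/-- cone -/
noncomputable def cone (b : s) (p : ℕ) : L p s →ₗ[F2] L (p+1) s := pf (fun x => (Fin.cons b x : Fin (p+1) → s))

lemma bd_cone {p : ℕ} (b : s) (c : L (p+1) s) :
    bd s (p+1) (cone b (p+1) c) = c + cone b p (bd s p c) := by
  have : (bd s (p+1)).comp (cone b (p+1)) = LinearMap.id + (cone b p).comp (bd s p) := by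
    apply lhom_ext
    intro x
    simp only [LinearMap.comp_apply, cone, pf_sg, bd_sg, LinearMap.add_apply, LinearMap.id_apply, map_sum]
    rw [Fin.sum_univ_succ]
    congr 1
    refine Finset.sum_congr rfl fun i _ => ?_
    congr 1
    funext j
    refine Fin.cases ?_ (fun k => ?_) j
    · simp
    · simp
  exact LinearMap.congr_fun this c

lemma bd_cone_zero (b : s) (c : L 0 s) : bd s 0 (cone b 0 c) = c := by
  have : (bd s 0).comp (cone b 0) = LinearMap.id := by
    apply lhom_ext
    intro x
    simp only [LinearMap.comp_apply, cone, pf_sg, bd_sg, LinearMap.id_apply]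
    rw [Fin.sum_univ_one]
    congr 1
  exact LinearMap.congr_fun this c

/-- barycentric subdivision -/
noncomputable def sd (s : Set W) [Cv s] : (p : ℕ) → L p s →ₗ[F2] L p s
  | 0 => LinearMap.id
  | p+1 => lx (fun x => cone (bary x) p (sd s p (bd s p (sg x))))

lemma sd_sg {p : ℕ} (x : Fin (p+1) → s) :
    sd s (p+1) (sg x) = cone (bary x) p (sd s p (bd s p (sg x))) := by
  simp [sd]

lemma bd_sd (p : ℕ) (c : L (p+1) s) : bd s p (sd s (p+1) c) = sd s p (bd s p c) := by
  induction p with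
  | zero =>
    have : (bd s 0).comp (sd s 1) = (sd s 0).comp (bd s 0) := by
      apply lhom_ext
      intro x
      simp only [LinearMap.comp_apply, sd_sg, bd_cone_zero]
    exact LinearMap.congr_fun this c
  | succ p ih =>
    have : (bd s (p+1)).comp (sd s (p+2)) = (sd s (p+1)).comp (bd s (p+1)) := by
      apply lhom_ext
      intro x
      simp only [LinearMap.comp_apply]
      rw [sd_sg, bd_cone, ih, bd_bd, map_zero, map_zero, add_zero]
    exact LinearMap.congr_fun this c

/-- pushforward of affine chains -/
noncomputable def mp (a : s → s') (p : ℕ) : L p s →ₗ[F2] L p s' := pf (fun x => a ∘ x)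

lemma mp_sg (a : s → s') {p : ℕ} (x : Fin p → s) : mp a p (sg x) = sg (a ∘ x) := by simp [mp]

lemma mp_bd (a : s → s') {p : ℕ} (c : L (p+1) s) : mp a p (bd s p c) = bd s' p (mp a (p+1) c) := by
  have : (mp a p).comp (bd s p) = (bd s' p).comp (mp a (p+1)) := by
    apply lhom_ext
    intro x
    simp only [LinearMap.comp_apply, bd_sg, map_sum, mp_sg]
    rfl
  exact LinearMap.congr_fun this c

lemma mp_cone (a : s → s') (b : s) {p : ℕ} (c : L p s) :
    mp a (p+1) (cone b p c) = cone (a b) p (mp a p c) := by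
  have : (mp a (p+1)).comp (cone b p) = (cone (a b) p).comp (mp a p) := by
    apply lhom_ext
    intro x
    simp only [LinearMap.comp_apply, cone, pf_sg, mp_sg]
    congr 1
    funext j
    refine Fin.cases ?_ (fun k => ?_) j <;> simp
  exact LinearMap.congr_fun this c

lemma mp_sd {a : s → s'} (ha : Aff a) (p : ℕ) (c : L p s) : mp a p (sd s p c) = sd s' p (mp a p c) := by
  induction p with
  | zero => rfl
  | succ p ih =>
    have : (mp a (p+1)).comp (sd s (p+1)) = (sd s' (p+1)).comp (mp a (p+1)) := by
      apply lhom_ext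
      intro x
      simp only [LinearMap.comp_apply, sd_sg, mp_sg]
      rw [mp_cone, ih, mp_bd, mp_sg, bary_aff ha]
    exact LinearMap.congr_fun this c

/-- inclusion at time `t` -/
def jt (t : Set.Icc (0:ℝ) 1) (y : s) : ↥(s ×ˢ Set.Icc (0:ℝ) 1) := ⟨(y.1, t.1), y.2, t.2⟩

lemma aff_jt (t : Set.Icc (0:ℝ) 1) : Aff (jt (s := s) t) := by
  intro p x u
  apply Subtype.ext
  simp only [jt, comb_val, Function.comp]
  rw [Prod.ext_iff]
  simp only [Prod.fst_sum, Prod.snd_sum, Prod.smul_fst, Prod.smul_snd, true_and]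
  rw [← Finset.sum_smul, u.2.2, one_smul]

/-- prism operator -/
noncomputable def T (s : Set W) [Cv s] : (p : ℕ) → L p s →ₗ[F2] L (p+1) (s ×ˢ Set.Icc (0:ℝ) 1)
  | 0 => 0
  | p+1 => lx (fun x => cone (jt 1 (bary x)) (p+1)
      (mp (jt 0) (p+1) (sg x) + mp (jt 1) (p+1) (sd s (p+1) (sg x)) + T s p (bd s p (sg x))))

lemma T_sg {p : ℕ} (x : Fin (p+1) → s) : T s (p+1) (sg x) = cone (jt 1 (bary x)) (p+1)
      (mp (jt 0) (p+1) (sg x) + mp (jt 1) (p+1) (sd s (p+1) (sg x)) + T s p (bd s p (sg x))) := by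
  simp [T]

lemma T_zero (c : L 0 s) : T s 0 c = 0 := rfl

lemma bd_T_aux (p : ℕ) (c : L (p+1) s) (h : bd _ p (T s p (bd s p c)) =
    mp (jt 0) p (bd s p c) + mp (jt 1) p (sd s p (bd s p c))) :
    bd (s ×ˢ Set.Icc (0:ℝ) 1) p (mp (jt 0) (p+1) c + mp (jt 1) (p+1) (sd s (p+1) c) + T s p (bd s p c)) = 0 := by
  rw [map_add, map_add, ← mp_bd, ← mp_bd, bd_sd, h, F2_add_self]

lemma bd_T (p : ℕ) (c : L (p+1) s) : bd _ (p+1) (T s (p+1) c) =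
    mp (jt 0) (p+1) c + mp (jt 1) (p+1) (sd s (p+1) c) + T s p (bd s p c) := by
  induction p with
  | zero =>
    have : (bd _ 1).comp (T s 1) = mp (jt 0) 1 + (mp (jt 1) 1).comp (sd s 1) + (T s 0).comp (bd s 0) := by
      apply lhom_ext
      intro x
      simp only [LinearMap.comp_apply, LinearMap.add_apply]
      rw [T_sg, bd_cone, bd_T_aux, map_zero, add_zero]
      rw [T_zero, map_zero]
      have : ∀ c : L 0 s, mp (jt 0) 0 c = mp (jt 1) 0 c := by
        intro c
        have : (mp (jt 0) 0 : L 0 s →ₗ[F2] _) = mp (jt 1) 0 := by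
          apply lhom_ext
          intro x
          simp only [mp_sg]
          congr 1
          exact Subsingleton.elim _ _
        rw [this]
      rw [this]
      exact (F2_add_self _).symm
    exact LinearMap.congr_fun this c
  | succ p ih =>
    have : (bd _ (p+2)).comp (T s (p+2)) = mp (jt 0) (p+2) + (mp (jt 1) (p+2)).comp (sd s (p+2)) +
        (T s (p+1)).comp (bd s (p+1)) := by
      apply lhom_ext
      intro x
      simp only [LinearMap.comp_apply, LinearMap.add_apply]
      rw [T_sg, bd_cone, bd_T_aux, map_zero, add_zero]
      rw [ih, bd_bd, map_zero, add_zero]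
    exact LinearMap.congr_fun this c

/-- product with the interval -/
def axi (a : s → s') (y : ↥(s ×ˢ Set.Icc (0:ℝ) 1)) : ↥(s' ×ˢ Set.Icc (0:ℝ) 1) :=
  ⟨((a ⟨y.1.1, y.2.1⟩).1, y.1.2), (a ⟨y.1.1, y.2.1⟩).2, y.2.2⟩

lemma mp_T {a : s → s'} (ha : Aff a) (p : ℕ) (c : L p s) :
    mp (axi a) (p+1) (T s p c) = T s' p (mp a p c) := by
  induction p with
  | zero => simp [T_zero]
  | succ p ih =>
    have : (mp (axi a) (p+2)).comp (T s (p+1)) = (T s' (p+1)).comp (mp a (p+1)) := by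
      apply lhom_ext
      intro x
      simp only [LinearMap.comp_apply, mp_sg]
      have hj : ∀ (t : Set.Icc (0:ℝ) 1) (q : ℕ) (c : L q s), mp (axi a) q (mp (jt t) q c) =
          mp (jt t) q (mp a q c) := by
        intro t q c
        simp only [mp, pf_pf]
        rfl
      have hb : axi a (jt 1 (bary x)) = jt 1 (bary (a ∘ x)) := by
        rw [← bary_aff ha]; rfl
      rw [T_sg, T_sg, mp_cone, map_add (mp (axi a) (p+1)), map_add (mp (axi a) (p+1)), hj, hj, ih, mp_sd ha, mp_bd, mp_sg, hb]
    exact LinearMap.congr_fun this c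

end

end DH

set_option linter.unusedSectionVars false
set_option linter.unusedVariables false
set_option linter.unusedSimpArgs false
namespace DH

/-! ### mesh -/
section
variable {W : Type} [NormedAddCommGroup W] [NormedSpace ℝ W] {s : Set W} [Cv s]

lemma supp_map {α β : Type} (f : (α →₀ F2) →ₗ[F2] (β →₀ F2)) {A : Set α} {B : Set β}
    (h : ∀ x ∈ A, f (sg x) ∈ Finsupp.supported F2 F2 B) {c : α →₀ F2}
    (hc : c ∈ Finsupp.supported F2 F2 A) : f c ∈ Finsupp.supported F2 F2 B := by
  have : Finsupp.supported F2 F2 A ≤ (Finsupp.supported F2 F2 B).comap f := by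
    rw [Finsupp.supported_eq_span_single, Submodule.span_le]
    rintro _ ⟨x, hx, rfl⟩
    exact h x hx
  exact this hc

lemma sg_mem {α : Type} {A : Set α} {x : α} (hx : x ∈ A) : sg x ∈ Finsupp.supported F2 F2 A :=
  Finsupp.single_mem_supported F2 1 hx

/-- tuples with entries in `K` and mesh at most `r` -/
def msh (p : ℕ) (K : Set W) (r : ℝ) : Set (Fin p → s) :=
  {y | (∀ i, (y i).1 ∈ K) ∧ ∀ i j, dist (y i).1 (y j).1 ≤ r}

lemma bary_val {p : ℕ} (x : Fin (p+1) → s) : (bary x).1 = ∑ i, ((p:ℝ)+1)⁻¹ • (x i).1 := by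
  simp [bary, comb_val, stdSimplex.barycenter]

lemma comb_mem_hull {p : ℕ} (x : Fin (p+1) → s) (t : Sx p) {K : Set W} (hK : Convex ℝ K)
    (h : ∀ i, (x i).1 ∈ K) : (comb x t).1 ∈ K :=
  hK.sum_mem (fun i _ => t.2.1 i) t.2.2 (fun i _ => h i)

lemma dist_bary {p : ℕ} (x : Fin (p+1) → s) {r : ℝ} (h : ∀ i j, dist (x i).1 (x j).1 ≤ r) (i) :
    dist (bary x).1 (x i).1 ≤ (p / (p+1) : ℝ) * r := by
  have hp : (0:ℝ) < (p:ℝ)+1 := by positivity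
  have e : (bary x).1 - (x i).1 = ((p:ℝ)+1)⁻¹ • ∑ j, ((x j).1 - (x i).1) := by
    rw [bary_val, Finset.sum_sub_distrib, smul_sub, ← Finset.smul_sum]
    congr 1
    simp only [Finset.sum_const, Finset.card_univ, Fintype.card_fin]
    rw [← Nat.cast_smul_eq_nsmul ℝ, smul_smul]
    push_cast
    rw [inv_mul_cancel₀ hp.ne', one_smul]
  rw [dist_eq_norm, e, norm_smul, Fin.sum_univ_succAbove _ i, sub_self, zero_add]
  have h2 : ‖∑ j : Fin p, ((x (i.succAbove j)).1 - (x i).1)‖ ≤ p * r := by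
    refine (norm_sum_le _ _).trans ?_
    refine (Finset.sum_le_card_nsmul _ _ r fun j _ => ?_).trans ?_
    · rw [← dist_eq_norm]; exact h _ _
    · simp
  rw [Real.norm_of_nonneg (by positivity)]
  calc _ ≤ ((p:ℝ)+1)⁻¹ * (p * r) := by gcongr
    _ = _ := by field_simp

lemma sd_mesh (p : ℕ) (x : Fin (p+1) → s) {r : ℝ} (h : ∀ i j, dist (x i).1 (x j).1 ≤ r)
    {K : Set W} (hK : Convex ℝ K) (hx : ∀ i, (x i).1 ∈ K) (m : ℕ) (hpm : p ≤ m) :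
    sd s (p+1) (sg x) ∈ Finsupp.supported F2 F2 (msh (s := s) (p+1) K ((m/(m+1) : ℝ) * r)) := by
  have hr : 0 ≤ r := dist_nonneg.trans (h 0 0)
  have hpm' : (p / (p+1) : ℝ) ≤ m/(m+1) := by
    rw [div_le_div_iff₀ (by positivity) (by positivity)]
    have : (p:ℝ) ≤ m := by exact_mod_cast hpm
    nlinarith
  have hrr : 0 ≤ (m/(m+1) : ℝ) * r := by positivity
  induction p generalizing K with
  | zero =>
    rw [sd_sg]
    refine supp_map _ (A := Set.univ) ?_ (by simp)
    intro y _
    rw [cone, pf_sg]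
    refine sg_mem ⟨?_, ?_⟩
    · intro i
      fin_cases i
      exact comb_mem_hull _ _ hK hx
    · intro i j
      fin_cases i; fin_cases j
      simpa using hrr
  | succ p ih =>
    rw [sd_sg]
    have h1 : sd s (p+1) (bd s (p+1) (sg x)) ∈ Finsupp.supported F2 F2
        (msh (s := s) (p+1) (K ∩ convexHull ℝ (Set.range fun i => (x i).1)) ((m/(m+1) : ℝ) * r)) := by
      rw [bd_sg, map_sum]
      refine Submodule.sum_mem _ fun i _ => ?_
      refine ih (x ∘ i.succAbove) (fun _ _ => h _ _) (hK.inter (convex_convexHull ℝ _)) ?_ (by omega) ?_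
      · intro j
        exact ⟨hx _, subset_convexHull _ _ ⟨_, rfl⟩⟩
      · have : (p:ℝ)+1 ≤ m := by exact_mod_cast hpm
        rw [div_le_div_iff₀ (by positivity) (by positivity)]
        nlinarith
    refine supp_map _ ?_ h1
    rintro y ⟨hy1, hy2⟩
    rw [cone, pf_sg]
    have hb : ∀ i, dist (bary x).1 (y i).1 ≤ (m/(m+1) : ℝ) * r := by
      intro i
      have hc : convexHull ℝ (Set.range fun i => (x i).1) ⊆ Metric.closedBall (bary x).1 ((m/(m+1) : ℝ) * r) := by
        refine convexHull_min ?_ (convex_closedBall _ _)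
        rintro _ ⟨j, rfl⟩
        rw [Metric.mem_closedBall, dist_comm]
        exact (dist_bary x h j).trans (by gcongr)
      have := hc (hy1 i).2
      rwa [Metric.mem_closedBall, dist_comm] at this
    refine sg_mem ⟨?_, ?_⟩
    · intro i
      refine Fin.cases ?_ (fun k => ?_) i
      · exact comb_mem_hull _ _ hK hx
      · exact (hy1 k).1
    · intro i j
      refine Fin.cases ?_ (fun k => ?_) i <;> refine Fin.cases ?_ (fun l => ?_) j
      · simpa using hrr
      · simpa using hb l
      · simpa [dist_comm] using hb k
      · exact hy2 k l

lemma sd_pow_mesh (m : ℕ) (x : Fin (m+1) → s) {r : ℝ} (h : ∀ i j, dist (x i).1 (x j).1 ≤ r) (N : ℕ) :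
    ((sd s (m+1))^N) (sg x) ∈ Finsupp.supported F2 F2 (msh (s := s) (m+1) Set.univ ((m/(m+1) : ℝ)^N * r)) := by
  induction N with
  | zero => exact sg_mem ⟨by simp, by simpa using h⟩
  | succ N ih =>
    have e : ((sd s (m+1))^(N+1)) (sg x) = sd s (m+1) (((sd s (m+1))^N) (sg x)) := by
      rw [pow_succ']; rfl
    rw [e]
    refine supp_map (sd s (m+1)) ?_ ih
    intro y hy
    have := sd_mesh m y hy.2 convex_univ (by simp) m le_rfl
    rwa [← mul_assoc, ← pow_succ'] at this

end

/-! ### singular chains -/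

/-- singular simplices -/
abbrev SS (X : Type) [TopologicalSpace X] : Type := Σ m : ℕ, C(Sx m, X)

/-- singular chains -/
abbrev Ch (X : Type) [TopologicalSpace X] : Type := SS X →₀ F2

section
variable {X : Type} [TopologicalSpace X] {Y : Type} [TopologicalSpace Y]

/-- boundary of a simplex -/
noncomputable def sbd : SS X → Ch X
  | ⟨0, _⟩ => 0
  | ⟨m+1, σ⟩ => ∑ i : Fin (m+2), sg ⟨m, σ.comp (fc i)⟩

lemma fc_fc {m : ℕ} (i : Fin (m+3)) (j : Fin (m+2)) :
    (fc i).comp (fc j) = comb (io (m+2) ∘ (i.succAbove ∘ j.succAbove)) := by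
  ext1 t
  show fc i (fc j t) = _
  rw [fc_eq_comb i, comb_fc]
  rfl

/-- the singular complex -/
noncomputable def Sg (X : Type) [TopologicalSpace X] : GD (Ch X) where
  d := lx sbd
  gr m := Finsupp.supported F2 F2 {σ | σ.1 = m}
  dd := by
    intro v
    have : (lx sbd).comp (lx sbd) = (0 : Ch X →ₗ[F2] Ch X) := by
      apply lhom_ext
      rintro ⟨m, σ⟩
      simp only [LinearMap.comp_apply, lx_sg, LinearMap.zero_apply]
      rcases m with _ | _ | m
      · simp [sbd]
      · simp [sbd]
      · simp only [sbd, map_sum, lx_sg]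
        simp only [ContinuousMap.comp_assoc, fc_fc]
        exact sum_succAbove_cancel (fun f => sg (⟨m, σ.comp (comb (io (m+2) ∘ f))⟩ : SS X))
    exact LinearMap.congr_fun this v
  d_gr := by
    intro m v hv
    refine supp_map _ ?_ hv
    rintro ⟨l, σ⟩ rfl
    simp only [lx_sg, sbd]
    exact Submodule.sum_mem _ fun i _ => sg_mem rfl
  d_zero := by
    intro v hv
    have : Finsupp.supported F2 F2 {σ : SS X | σ.1 = 0} ≤ LinearMap.ker (lx sbd) := by
      rw [Finsupp.supported_eq_span_single, Submodule.span_le]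
      rintro _ ⟨⟨l, σ⟩, h, rfl⟩
      subst h
      show lx sbd (sg _) = 0
      simp [sbd]
    exact this hv

/-- chains small of a family -/
noncomputable def Sm (Q : Set (Set X)) : Submodule F2 (Ch X) :=
  Finsupp.supported F2 F2 {σ | ∃ Z ∈ Q, Set.range σ.2 ⊆ Z}

lemma Sm_sub (Q : Set (Set X)) : (Sg X).Sub (Sm Q) := by
  intro v hv
  refine supp_map _ ?_ hv
  rintro ⟨l, σ⟩ ⟨Z, hZ, h⟩
  show lx sbd _ ∈ _
  rw [lx_sg]
  rcases l with _ | l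
  · exact Submodule.zero_mem _
  · refine Submodule.sum_mem _ fun i _ => sg_mem ⟨Z, hZ, ?_⟩
    exact (Set.range_comp_subset_range (fc i) σ).trans h

section push
variable {W : Type} [NormedAddCommGroup W] [NormedSpace ℝ W] {s : Set W} [Cv s]
variable {W' : Type} [NormedAddCommGroup W'] [NormedSpace ℝ W'] {s' : Set W'} [Cv s']

/-- realise affine chains as singular chains -/
noncomputable def push (g : C(s, X)) (p : ℕ) : L (p+1) s →ₗ[F2] Ch X :=
  pf (fun x => ⟨p, g.comp (comb x)⟩)

lemma push_sg (g : C(s, X)) {p : ℕ} (x : Fin (p+1) → s) : push g p (sg x) = sg ⟨p, g.comp (comb x)⟩ := by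
  simp [push]

lemma d_push (g : C(s, X)) {p : ℕ} (c : L (p+2) s) :
    (Sg X).d (push g (p+1) c) = push g p (bd s (p+1) c) := by
  have : (Sg X).d.comp (push g (p+1)) = (push g p).comp (bd s (p+1)) := by
    apply lhom_ext
    intro x
    simp only [LinearMap.comp_apply, push_sg, bd_sg, map_sum]
    show lx sbd _ = _
    simp only [lx_sg, sbd]
    refine Finset.sum_congr rfl fun i _ => ?_
    congr 2
    ext1 t
    simp [comb_fc]
  exact LinearMap.congr_fun this c

lemma push_mp (g : C(s', X)) (a : C(s, s')) (ha : Aff a) {p : ℕ} (c : L (p+1) s) :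
    push g p (mp a (p+1) c) = push (g.comp a) p c := by
  have : (push g p).comp (mp a (p+1)) = push (g.comp a) p := by
    apply lhom_ext
    intro x
    simp only [LinearMap.comp_apply, push_sg, mp_sg]
    congr 2
    ext1 t
    simp [ha p x t]
  exact LinearMap.congr_fun this c

lemma push_gr (g : C(s, X)) {p : ℕ} (c : L (p+1) s) : push g p c ∈ (Sg X).gr p := by
  refine supp_map _ (A := Set.univ) ?_ (by simp)
  intro x _
  rw [push_sg]
  exact sg_mem rfl

lemma push_Sm (g : C(s, X)) {Q : Set (Set X)} {Z : Set X} (hZ : Z ∈ Q) (h : Set.range g ⊆ Z)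
    {p : ℕ} (c : L (p+1) s) : push g p c ∈ Sm Q := by
  refine supp_map _ (A := Set.univ) ?_ (by simp)
  intro x _
  rw [push_sg]
  exact sg_mem ⟨Z, hZ, (Set.range_comp_subset_range (comb x) g).trans h⟩

end push

end
end DH

set_option linter.unusedSectionVars false
set_option linter.unusedVariables false
set_option linter.unusedSimpArgs false
namespace DH
section
variable {X : Type} [TopologicalSpace X]

/-- a self-homotopy -/
structure Hty (X : Type) [TopologicalSpace X] where
  h : C(X × Set.Icc (0:ℝ) 1, X)
  h0 : ∀ x, h (x, 0) = x

namespace Hty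
variable (H : Hty X)

/-- time one -/
def h1 : C(X, X) := ⟨fun x => H.h (x, 1), by fun_prop⟩

/-- homotopy on a simplex -/
def hs {m : ℕ} (σ : C(Sx m, X)) : C(↥((stdSimplex ℝ (Fin (m+1))) ×ˢ Set.Icc (0:ℝ) 1), X) where
  toFun y := H.h (σ ⟨y.1.1, y.2.1⟩, ⟨y.1.2, y.2.2⟩)
  continuous_toFun := by
    refine H.h.continuous.comp (Continuous.prodMk (σ.continuous.comp ?_) ?_)
    · exact Continuous.subtype_mk (continuous_fst.comp continuous_subtype_val) _
    · exact Continuous.subtype_mk (continuous_snd.comp continuous_subtype_val) _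

/-- subdivision followed by time one map -/
noncomputable def Phi : Ch X →ₗ[F2] Ch X :=
  lx (fun σ => push (H.h1.comp σ.2) σ.1 (sd _ _ (sg (io σ.1))))

/-- chain homotopy -/
noncomputable def D : Ch X →ₗ[F2] Ch X :=
  lx (fun σ => push (H.hs σ.2) (σ.1+1) (T _ _ (sg (io σ.1))))

lemma D_face {m : ℕ} (σ : C(Sx (m+1), X)) :
    H.D ((Sg X).d (sg ⟨m+1, σ⟩)) = push (H.hs σ) (m+1) (T _ (m+1) (bd _ (m+1) (sg (io (m+1))))) := by
  show H.D (lx sbd _) = _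
  rw [lx_sg, bd_sg]
  simp only [sbd, map_sum]
  refine Finset.sum_congr rfl fun i _ => ?_
  rw [D, lx_sg]
  have e : sg (io (m+1) ∘ i.succAbove) = mp (fc i) (m+1) (sg (io m)) := by
    rw [mp_sg]
    congr 1
    funext j
    rw [fc_eq_comb]
    exact (comb_vertex _ _).symm
  rw [e, ← mp_T (aff_fc i)]
  let a : C(↥((stdSimplex ℝ (Fin (m+1))) ×ˢ Set.Icc (0:ℝ) 1), ↥((stdSimplex ℝ (Fin (m+2))) ×ˢ Set.Icc (0:ℝ) 1)) :=
    ⟨axi (fc i), by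
      refine Continuous.subtype_mk (Continuous.prodMk ?_ ?_) _
      · refine continuous_subtype_val.comp ((fc i).continuous.comp ?_)
        exact Continuous.subtype_mk (continuous_fst.comp continuous_subtype_val) _
      · exact continuous_snd.comp continuous_subtype_val⟩
  have ha : Aff a := by
    intro p x t
    apply Subtype.ext
    apply Prod.ext
    · show (fc i ⟨(comb x t).1.1, (comb x t).2.1⟩).1 = (comb (a ∘ x) t).1.1
      have h1 := aff_fc i p (fun j => ⟨(x j).1.1, (x j).2.1⟩) t
      have h2 : (⟨(comb x t).1.1, (comb x t).2.1⟩ : Sx m) = comb (fun j => ⟨(x j).1.1, (x j).2.1⟩) t := by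
        apply Subtype.ext
        simp only [comb_val, Prod.fst_sum, Prod.smul_fst]
      rw [h2, h1]
      simp only [comb_val, Prod.fst_sum, Prod.smul_fst]
      rfl
    · show (comb x t).1.2 = (comb (a ∘ x) t).1.2
      simp only [comb_val, Prod.snd_sum, Prod.smul_snd]
      rfl
  have := push_mp (H.hs σ) a ha (T _ (m+1) (sg (io m)))
  exact this.symm

lemma push_jt (σ : SS X) (t : Set.Icc (0:ℝ) 1) (c) : push (H.hs σ.2) σ.1 (mp (jt t) (σ.1+1) c) =
    push ((⟨fun x => H.h (x, t), by fun_prop⟩ : C(X,X)).comp σ.2) σ.1 c := by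
  have := push_mp (H.hs σ.2) ⟨jt t, by
    refine Continuous.subtype_mk (Continuous.prodMk continuous_subtype_val continuous_const) _⟩ (aff_jt t) c
  exact this

lemma formula (v : Ch X) : v = H.Phi v + (Sg X).d (H.D v) + H.D ((Sg X).d v) := by
  have : LinearMap.id = H.Phi + (Sg X).d.comp H.D + H.D.comp (Sg X).d := by
    apply lhom_ext
    intro σ
    simp only [LinearMap.id_apply, LinearMap.add_apply, LinearMap.comp_apply]
    have h1 : (Sg X).d (H.D (sg σ)) = sg σ + H.Phi (sg σ) + push (H.hs σ.2) σ.1 (T _ σ.1 (bd _ σ.1 (sg (io σ.1)))) := by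
      rw [D, lx_sg, d_push, bd_T, map_add, map_add, push_jt, push_jt]
      rw [Phi, lx_sg, push_sg]
      congr 3
      refine Sigma.ext rfl (heq_of_eq ?_)
      ext1 t
      simp [comb_io, H.h0]
    have h2 : H.D ((Sg X).d (sg σ)) = push (H.hs σ.2) σ.1 (T _ σ.1 (bd _ σ.1 (sg (io σ.1)))) := by
      obtain ⟨m, σ⟩ := σ
      rcases m with _ | m
      · have : (Sg X).d (sg ⟨0, σ⟩) = 0 := by
          show lx sbd _ = 0
          simp [sbd]
        rw [this, map_zero, T_zero, map_zero]
      · exact D_face H σ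
    rw [h1, h2]
    have h3 := F2_add_self (H.Phi (sg σ))
    have h4 := F2_add_self (push (H.hs σ.2) σ.1 (T _ σ.1 (bd _ σ.1 (sg (io σ.1)))))
    generalize H.Phi (sg σ) = a at *
    generalize push (H.hs σ.2) σ.1 (T _ σ.1 (bd _ σ.1 (sg (io σ.1)))) = b at *
    calc sg σ = sg σ + (a + a) + (b + b) := by rw [h3, h4]; simp
      _ = _ := by abel
  exact LinearMap.congr_fun this v

lemma D_gr {m : ℕ} {v : Ch X} (hv : v ∈ (Sg X).gr m) : H.D v ∈ (Sg X).gr (m+1) := by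
  refine supp_map _ ?_ hv
  rintro ⟨l, σ⟩ rfl
  rw [D, lx_sg]
  exact push_gr _ _

lemma Phi_push {W : Type} [NormedAddCommGroup W] [NormedSpace ℝ W] {s : Set W} [Cv s] (g : C(s, X)) {p : ℕ}
    (c : L (p+1) s) : H.Phi (push g p c) = push (H.h1.comp g) p (sd s (p+1) c) := by
  have : H.Phi.comp (push g p) = (push (H.h1.comp g) p).comp (sd s (p+1)) := by
    apply lhom_ext
    intro x
    simp only [LinearMap.comp_apply]
    rw [push_sg, Phi, lx_sg]
    have e : sg x = mp (comb x) (p+1) (sg (io p)) := by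
      rw [mp_sg]; congr 1; funext j; exact (comb_vertex _ _).symm
    rw [e, ← mp_sd (aff_comb x), push_mp _ _ (aff_comb x)]
    rfl
  exact LinearMap.congr_fun this c

variable {Q : Set (Set X)}

/-- the homotopy preserves the family -/
def Pres (Q : Set (Set X)) : Prop := ∀ Z ∈ Q, ∃ Z' ∈ Q, ∀ x ∈ Z, ∀ t, H.h (x, t) ∈ Z'

variable {H}

lemma D_Sm (hQ : H.Pres Q) {v : Ch X} (hv : v ∈ Sm Q) : H.D v ∈ Sm Q := by
  refine supp_map _ ?_ hv
  rintro ⟨l, σ⟩ ⟨Z, hZ, h⟩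
  rw [D, lx_sg]
  obtain ⟨Z', hZ', h'⟩ := hQ Z hZ
  refine push_Sm _ hZ' ?_ _
  rintro _ ⟨y, rfl⟩
  exact h' _ (h ⟨_, rfl⟩) _

lemma Phi_Sm (hQ : H.Pres Q) {v : Ch X} (hv : v ∈ Sm Q) : H.Phi v ∈ Sm Q := by
  have e := H.formula v
  have : H.Phi v = v - (Sg X).d (H.D v) - H.D ((Sg X).d v) := by
    conv_rhs => rw [e]
    rw [← e]
    nth_rewrite 2 [e]
    abel
  rw [this]
  exact Submodule.sub_mem _ (Submodule.sub_mem _ hv (Sm_sub Q _ (D_Sm hQ hv))) (D_Sm hQ (Sm_sub Q _ hv))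

lemma Phi_pow_Sm (hQ : H.Pres Q) {v : Ch X} (hv : v ∈ Sm Q) (N : ℕ) : (H.Phi ^ N) v ∈ Sm Q := by
  induction N with
  | zero => exact hv
  | succ N ih =>
    rw [pow_succ']
    exact Phi_Sm hQ ih

lemma Phi_pow_sg (H : Hty X) (σ : SS X) (N : ℕ) : ∃ g : C(X, X), (H.Phi ^ (N+1)) (sg σ) =
    push (g.comp (H.h1.comp σ.2)) σ.1 (((sd _ (σ.1+1))^(N+1)) (sg (io σ.1))) ∧
    ∀ Q : Set (Set X), H.Pres Q → ∀ Z ∈ Q, ∃ Z' ∈ Q, Set.MapsTo g Z Z' := by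
  induction N with
  | zero =>
    refine ⟨ContinuousMap.id X, ?_, fun Q hQ Z hZ => ⟨Z, hZ, fun x hx => hx⟩⟩
    simp only [zero_add, pow_one]
    rw [Phi, lx_sg]
    rfl
  | succ N ih =>
    obtain ⟨g, hg, h2⟩ := ih
    refine ⟨H.h1.comp g, ?_, ?_⟩
    · have e : (H.Phi ^ (N+1+1)) (sg σ) = H.Phi ((H.Phi ^ (N+1)) (sg σ)) := by
        rw [pow_succ']; rfl
      rw [e, hg, Phi_push]
      rw [pow_succ' _ (N+1)]
      rfl
    · intro Q hQ Z hZ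
      obtain ⟨Z', hZ', h'⟩ := h2 Q hQ Z hZ
      obtain ⟨Z'', hZ'', h''⟩ := hQ Z' hZ'
      exact ⟨Z'', hZ'', fun x hx => h'' _ (h' hx) 1⟩

/-- the topological nil lemma -/
theorem van (hQ : H.Pres Q) (hloc : ∀ x : X, ∃ U : Set X, IsOpen U ∧ x ∈ U ∧ ∃ Z ∈ Q, Set.MapsTo H.h1 U Z) (m : ℕ) :
    (Sg X).Van ⊤ (Sm Q) m := by
  refine van_of_nil H.D H.Phi (fun _ _ => trivial) (fun v _ => H.formula v)
    (fun m v _ hv => ⟨trivial, H.D_gr hv⟩) (fun v hv => D_Sm hQ hv) le_top (Sm_sub Q) ?_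
  intro v _
  have key : ∀ σ : SS X, ∃ N, (H.Phi ^ N) (sg σ) ∈ Sm Q := by
    intro σ
    choose U hUo hUx Z hZ hUZ using hloc
    have hc : IsCompact (Set.univ : Set (Sx σ.1)) := isCompact_univ
    obtain ⟨δ, hδ, hb⟩ := lebesgue_number_lemma_of_metric hc (c := fun x => σ.2 ⁻¹' U x)
      (fun x => (hUo x).preimage σ.2.continuous) (by
        intro y _
        exact Set.mem_iUnion.2 ⟨σ.2 y, hUx _⟩)
    have hlt : ((σ.1:ℝ) / ((σ.1:ℝ)+1)) < 1 := by
      rw [div_lt_one (by positivity)]; linarith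
    obtain ⟨r, hr⟩ : ∃ r : ℝ, ∀ i j, dist (io σ.1 i).1 (io σ.1 j).1 ≤ r := by
      refine ⟨Metric.diam (stdSimplex ℝ (Fin (σ.1+1))), fun i j => ?_⟩
      exact Metric.dist_le_diam_of_mem (bounded_stdSimplex _) (io σ.1 i).2 (io σ.1 j).2
    have ht : Filter.Tendsto (fun N : ℕ => ((σ.1:ℝ) / ((σ.1:ℝ)+1))^(N+1) * r) Filter.atTop (nhds 0) := by
      have := (tendsto_pow_atTop_nhds_zero_of_lt_one (r := ((σ.1:ℝ) / ((σ.1:ℝ)+1))) (by positivity) hlt)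
      have := (Filter.tendsto_add_atTop_iff_nat 1).2 this
      simpa using this.mul_const r
    obtain ⟨N, hN⟩ := (ht.eventually (gt_mem_nhds hδ)).exists
    refine ⟨N+1, ?_⟩
    obtain ⟨g, hg, hg2⟩ := Phi_pow_sg H σ N
    rw [hg]
    refine supp_map _ ?_ (sd_pow_mesh σ.1 (io σ.1) hr (N+1))
    intro y hy
    rw [push_sg]
    obtain ⟨x, hx⟩ := hb (y 0) trivial
    obtain ⟨Z', hZ', h'⟩ := hg2 Q hQ (Z x) (hZ x)
    refine sg_mem ⟨Z', hZ', ?_⟩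
    rintro _ ⟨t, rfl⟩
    refine h' (hUZ x (hx ?_))
    show dist (comb y t).1 (y 0).1 < δ
    refine lt_of_le_of_lt ?_ hN
    have := comb_mem_hull y t (convex_closedBall (y 0).1 (((σ.1:ℝ) / ((σ.1:ℝ)+1))^(N+1) * r)) (by
      intro i
      exact hy.2 i 0)
    exact this
  induction v using Finsupp.induction_linear with
  | zero => exact ⟨0, Submodule.zero_mem _⟩
  | add a b ha hb =>
    obtain ⟨N, hN⟩ := ha trivial
    obtain ⟨N', hN'⟩ := hb trivial
    refine ⟨N + N', ?_⟩
    rw [map_add]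
    refine Submodule.add_mem _ ?_ ?_
    · rw [add_comm, pow_add]; exact Phi_pow_Sm hQ hN _
    · rw [pow_add]; exact Phi_pow_Sm hQ hN' _
  | single σ b =>
    obtain ⟨N, hN⟩ := key σ
    refine ⟨N, ?_⟩
    have : Finsupp.single σ b = b • sg σ := by simp
    rw [this, map_smul]
    exact Submodule.smul_mem _ _ hN

end Hty
end
end DH

set_option linter.unusedSectionVars false
set_option linter.unusedVariables false
set_option linter.unusedSimpArgs false
namespace DH
section
variable {X : Type} [TopologicalSpace X] {Y : Type} [TopologicalSpace Y]

lemma pf_eq {α β : Type} (f : α → β) : pf f = Finsupp.lmapDomain F2 F2 f :=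
  lhom_ext (by simp [Finsupp.mapDomain_single])

/-- induced chain map -/
noncomputable def cm (e : C(Y, X)) : Ch Y →ₗ[F2] Ch X := pf (fun σ => ⟨σ.1, e.comp σ.2⟩)

lemma cm_inj_aux (e : C(Y, X)) (he : Function.Injective e) :
    Function.Injective (fun σ : SS Y => (⟨σ.1, e.comp σ.2⟩ : SS X)) := by
  rintro ⟨m, σ⟩ ⟨m', σ'⟩ h
  simp only [Sigma.mk.injEq] at h
  obtain ⟨rfl, h⟩ := h
  congr 1
  ext1 t
  exact he (DFunLike.congr_fun (eq_of_heq h) t)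

lemma cm_inj (e : C(Y, X)) (he : Function.Injective e) : Function.Injective (cm e) := by
  rw [cm, pf_eq]
  exact Finsupp.mapDomain_injective (cm_inj_aux e he)

lemma cm_d (e : C(Y, X)) (v : Ch Y) : cm e ((Sg Y).d v) = (Sg X).d (cm e v) := by
  have : (cm e).comp (Sg Y).d = (Sg X).d.comp (cm e) := by
    apply lhom_ext
    rintro ⟨m, σ⟩
    simp only [LinearMap.comp_apply]
    show cm e (lx sbd _) = lx sbd (cm e _)
    rw [cm, pf_sg, lx_sg, lx_sg]
    rcases m with _ | m
    · simp [sbd]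
    · simp only [sbd, map_sum, pf_sg]
      rfl
  exact LinearMap.congr_fun this v

lemma cm_gr (e : C(Y, X)) (he : Function.Injective e) (m : ℕ) (v : Ch Y) :
    cm e v ∈ (Sg X).gr m ↔ v ∈ (Sg Y).gr m := by
  constructor
  · intro h
    rw [cm, pf_eq] at h
    intro σ hσ
    have : (⟨σ.1, e.comp σ.2⟩ : SS X) ∈ (Finsupp.mapDomain (fun σ : SS Y => (⟨σ.1, e.comp σ.2⟩ : SS X)) v).support := by
      rw [Finsupp.mem_support_iff, Finsupp.mapDomain_apply (cm_inj_aux e he)]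
      exact Finsupp.mem_support_iff.1 hσ
    exact h this
  · intro h
    refine supp_map _ ?_ h
    rintro ⟨l, σ⟩ rfl
    rw [cm, pf_sg]
    exact sg_mem rfl

lemma Sm_map (e : C(Y, X)) (he : Topology.IsEmbedding e) (Q : Set (Set Y)) :
    (Sm Q).map (cm e) = Sm ((fun Z => e '' Z) '' Q) := by
  rw [cm, pf_eq, Sm, Sm, Finsupp.lmapDomain_supported]
  congr 1
  ext ⟨m, σ⟩
  constructor
  · rintro ⟨⟨l, τ⟩, ⟨Z, hZ, h⟩, h'⟩
    simp only [Sigma.mk.injEq] at h'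
    obtain ⟨rfl, h'⟩ := h'
    obtain rfl := eq_of_heq h'
    refine ⟨_, ⟨Z, hZ, rfl⟩, ?_⟩
    rintro _ ⟨t, rfl⟩
    exact ⟨_, h ⟨t, rfl⟩, rfl⟩
  · rintro ⟨_, ⟨Z, hZ, rfl⟩, h⟩
    have hr : ∀ t, ∃ y ∈ Z, e y = σ t := fun t => h ⟨t, rfl⟩
    choose τ hτ hτ' using hr
    have hc : Continuous τ := by
      rw [he.continuous_iff]
      have : e ∘ τ = σ := funext hτ'
      rw [this]
      exact σ.continuous
    refine ⟨⟨m, ⟨τ, hc⟩⟩, ⟨Z, hZ, ?_⟩, ?_⟩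
    · rintro _ ⟨t, rfl⟩
      exact hτ t
    · simp only [Sigma.mk.injEq, heq_eq_eq, true_and]
      ext1 t
      exact hτ' t

lemma emb_iso (e : C(Y, X)) (he : Topology.IsEmbedding e) (P Q : Set (Set Y)) (m : ℕ) :
    Nonempty ((Sg Y).H (Sm P) (Sm Q) m ≃ₗ[F2]
      (Sg X).H (Sm ((fun Z => e '' Z) '' P)) (Sm ((fun Z => e '' Z) '' Q)) m) := by
  rw [← Sm_map e he, ← Sm_map e he]
  exact iso_transport (cm e) (cm_inj e he.injective) (cm_d e) (cm_gr e he.injective)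

lemma emb_iso_set (e : C(Y, X)) (he : Topology.IsEmbedding e) (P Q : Set Y) (m : ℕ) :
    Nonempty ((Sg Y).H (Sm {P}) (Sm {Q}) m ≃ₗ[F2] (Sg X).H (Sm {e '' P}) (Sm {e '' Q}) m) := by
  have := emb_iso e he {P} {Q} m
  rw [Set.image_singleton, Set.image_singleton] at this
  exact this

lemma Sm_univ : Sm {(Set.univ : Set X)} = ⊤ := by
  simp [Sm, Finsupp.supported_univ]

lemma Sm_empty : Sm (∅ : Set (Set X)) = ⊥ := by
  simp [Sm]

lemma Sm_singleton_empty : Sm ({∅} : Set (Set X)) = ⊥ := by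
  have : {σ : SS X | ∃ Z ∈ ({∅} : Set (Set X)), Set.range σ.2 ⊆ Z} = ∅ := by
    ext σ
    simp only [Set.mem_singleton_iff, exists_eq_left, Set.subset_empty_iff, Set.range_eq_empty_iff,
      Set.mem_setOf_eq, Set.mem_empty_iff_false, iff_false, not_isEmpty_iff]
    infer_instance
  rw [Sm, this, Finsupp.supported_empty]

lemma Sm_mono {P Q : Set (Set X)} (h : ∀ Z ∈ P, ∃ Z' ∈ Q, Z ⊆ Z') : Sm P ≤ Sm Q := by
  refine Finsupp.supported_mono ?_
  rintro σ ⟨Z, hZ, hσ⟩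
  obtain ⟨Z', hZ', h'⟩ := h Z hZ
  exact ⟨Z', hZ', hσ.trans h'⟩

lemma Sm_mono_set {P Q : Set X} (h : P ⊆ Q) : Sm {P} ≤ Sm {Q} := Sm_mono (by simpa using h)

/-- ambient nil lemma -/
theorem van_amb (P : Set X) (h : X → ℝ → X)
    (hc : ContinuousOn (fun z : X × ℝ => h z.1 z.2) (P ×ˢ Set.Icc 0 1))
    (hP : ∀ x ∈ P, ∀ t ∈ Set.Icc (0:ℝ) 1, h x t ∈ P) (h0 : ∀ x ∈ P, h x 0 = x)
    (Q : Set (Set X)) (hQP : ∀ Z ∈ Q, Z ⊆ P)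
    (hQ : ∀ Z ∈ Q, ∃ Z' ∈ Q, ∀ x ∈ Z, ∀ t ∈ Set.Icc (0:ℝ) 1, h x t ∈ Z')
    (hloc : ∀ x ∈ P, ∃ U, IsOpen U ∧ x ∈ U ∧ ∃ Z ∈ Q, ∀ y ∈ U ∩ P, h y 1 ∈ Z) (m : ℕ) :
    (Sg X).Van (Sm {P}) (Sm Q) m := by
  let H : Hty P :=
    { h := ⟨fun z => ⟨h z.1.1 z.2.1, hP _ z.1.2 _ z.2.2⟩, by
        refine Continuous.subtype_mk ?_ _
        have := hc.comp_continuous (f := fun z : P × Set.Icc (0:ℝ) 1 => (z.1.1, z.2.1)) (by fun_prop)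
          (fun z => ⟨z.1.2, z.2.2⟩)
        exact this⟩
      h0 := fun x => Subtype.ext (h0 x.1 x.2) }
  let Q' : Set (Set P) := (fun Z => Subtype.val ⁻¹' Z) '' Q
  have h1 : (Sg P).Van ⊤ (Sm Q') m := by
    refine Hty.van (H := H) ?_ ?_ m
    · rintro _ ⟨Z, hZ, rfl⟩
      obtain ⟨Z', hZ', h'⟩ := hQ Z hZ
      exact ⟨_, ⟨Z', hZ', rfl⟩, fun x hx t => h' x.1 hx t.1 t.2⟩
    · intro x
      obtain ⟨U, hU, hxU, Z, hZ, h'⟩ := hloc x.1 x.2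
      exact ⟨_, hU.preimage continuous_subtype_val, hxU, _, ⟨Z, hZ, rfl⟩, fun y hy => h' y.1 ⟨hy, y.2⟩⟩
  rw [← Sm_univ] at h1
  obtain ⟨e⟩ := emb_iso ⟨Subtype.val, continuous_subtype_val⟩ Topology.IsEmbedding.subtypeVal
    {(Set.univ : Set P)} Q' m
  have e1 : (fun Z : Set P => (⟨Subtype.val, continuous_subtype_val⟩ : C(P, X)) '' Z) '' {Set.univ} = {P} := by
    simp
  have e2 : (fun Z : Set P => (⟨Subtype.val, continuous_subtype_val⟩ : C(P, X)) '' Z) '' Q' = Q := by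
    rw [Set.image_image]
    have : ∀ Z ∈ Q, (⟨Subtype.val, continuous_subtype_val⟩ : C(P, X)) '' (Subtype.val ⁻¹' Z : Set P) = Z := by
      intro Z hZ
      simp only [ContinuousMap.coe_mk, Subtype.image_preimage_coe]
      exact Set.inter_eq_right.2 (hQP Z hZ)
    rw [Set.image_congr this]
    simp
  rw [e1, e2] at e
  exact van_congr ⟨e.symm⟩ h1

/-- excision for families -/
lemma exc_fam {Q1 Q2 Q12 : Set (Set X)}
    (h : ∀ Z1 ∈ Q1, ∀ Z2 ∈ Q2, ∀ x ∈ Z1 ∩ Z2, ∃ Z ∈ Q12, Z1 ∩ Z2 ⊆ Z)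
    (h1 : ∀ Z ∈ Q12, ∃ Z1 ∈ Q1, Z ⊆ Z1) (h2 : ∀ Z ∈ Q12, ∃ Z2 ∈ Q2, Z ⊆ Z2) (m : ℕ) :
    Nonempty ((Sg X).H (Sm Q1) (Sm Q12) m ≃ₗ[F2] (Sg X).H (Sm (Q1 ∪ Q2)) (Sm Q2) m) := by
  refine iso_exc (Sm_mono fun Z hZ => ⟨Z, Or.inl hZ, le_rfl⟩) (Sm_mono fun Z hZ => ⟨Z, Or.inr hZ, le_rfl⟩)
    ?_ (Sm_sub _) ?_ (Sm_sub _)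
  · apply le_antisymm
    · exact le_inf (Sm_mono h1) (Sm_mono h2)
    · rw [Sm, Sm, Sm, ← Finsupp.supported_inter]
      refine Finsupp.supported_mono ?_
      rintro σ ⟨⟨Z1, hZ1, hs1⟩, ⟨Z2, hZ2, hs2⟩⟩
      have hs := Set.subset_inter hs1 hs2
      obtain ⟨x, hx⟩ := Set.range_nonempty σ.2
      obtain ⟨Z, hZ, h'⟩ := h Z1 hZ1 Z2 hZ2 x (hs hx)
      exact ⟨Z, hZ, hs.trans h'⟩
  · intro m c hc hm
    have e : {σ : SS X | ∃ Z ∈ Q1 ∪ Q2, Set.range σ.2 ⊆ Z} ⊆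
        {σ : SS X | ∃ Z ∈ Q1, Set.range σ.2 ⊆ Z} ∪ {σ : SS X | ∃ Z ∈ Q2, Set.range σ.2 ⊆ Z} := by
      rintro σ ⟨Z, hZ | hZ, h⟩
      · exact Or.inl ⟨Z, hZ, h⟩
      · exact Or.inr ⟨Z, hZ, h⟩
    have hc' : c ∈ Finsupp.supported F2 F2 (({σ : SS X | ∃ Z ∈ Q1, Set.range σ.2 ⊆ Z} ∩ {σ | σ.1 = m}) ∪
        ({σ : SS X | ∃ Z ∈ Q2, Set.range σ.2 ⊆ Z} ∩ {σ | σ.1 = m})) := by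
      intro σ hσ
      rcases e (hc hσ) with h | h
      · exact Or.inl ⟨h, hm hσ⟩
      · exact Or.inr ⟨h, hm hσ⟩
    rw [Finsupp.supported_union, Submodule.mem_sup] at hc'
    obtain ⟨a, ha, q, hq, rfl⟩ := hc'
    rw [Finsupp.supported_inter] at ha hq
    exact ⟨a, ha.1, ha.2, q, hq.1, hq.2, rfl⟩

/-- excision -/
lemma exc_set {P A B : Set X} (hA : A ⊆ P) (hB : B ⊆ P)
    (h : ∀ x ∈ P, ∃ U, IsOpen U ∧ x ∈ U ∧ (U ∩ P ⊆ A ∨ U ∩ P ⊆ B)) (m : ℕ) :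
    Nonempty ((Sg X).H (Sm {A}) (Sm {A ∩ B}) m ≃ₗ[F2] (Sg X).H (Sm {P}) (Sm {B}) m) := by
  obtain ⟨e1⟩ := exc_fam (Q1 := {A}) (Q2 := {B}) (Q12 := {A ∩ B}) (by simp) (by simp) (by simp) m
  have hv : ∀ m, (Sg X).Van (Sm {P}) (Sm ({A} ∪ {B})) m := by
    intro m
    refine van_amb P (fun x _ => x) ?_ (fun x hx _ _ => hx) (fun x _ => rfl) _ ?_ ?_ ?_ m
    · exact continuousOn_fst
    · rintro Z (rfl | rfl)
      · exact hA
      · exact hB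
    · exact fun Z hZ => ⟨Z, hZ, fun x hx _ _ => hx⟩
    · intro x hx
      obtain ⟨U, hU, hxU, h' | h'⟩ := h x hx
      · exact ⟨U, hU, hxU, A, Or.inl rfl, fun y hy => h' hy⟩
      · exact ⟨U, hU, hxU, B, Or.inr rfl, fun y hy => h' hy⟩
  obtain ⟨e2⟩ := iso_RQ_PQ (C := Sg X) (Q := Sm {B}) (R := Sm ({A} ∪ {B})) (P := Sm {P}) (m := m)
    (Sm_mono (by simp)) (Sm_mono (by simp [hA, hB])) (hv _) (hv _)
  exact ⟨e1.trans e2⟩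

/-- homology concentrated in degree `d` -/
def HD {V : Type} [AddCommGroup V] [Module F2 V] (C : GD V) (P Q : Submodule F2 V) (d : ℕ) : Prop :=
  ∀ m, (C.Van P Q m ↔ m ≠ d) ∧ Module.Finite F2 (C.H P Q m)

lemma HD_congr {V V' : Type} [AddCommGroup V] [Module F2 V] [AddCommGroup V'] [Module F2 V'] {C : GD V} {C' : GD V'}
    {P Q : Submodule F2 V} {P' Q' : Submodule F2 V'} {d : ℕ}
    (e : ∀ m, Nonempty (C.H P Q m ≃ₗ[F2] C'.H P' Q' m)) (h : HD C' P' Q' d) : HD C P Q d := by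
  intro m
  obtain ⟨e⟩ := e m
  obtain ⟨h1, h2⟩ := h m
  refine ⟨⟨fun hv => h1.1 (van_congr ⟨e.symm⟩ hv), fun hm => van_congr ⟨e⟩ (h1.2 hm)⟩, Module.Finite.equiv e.symm⟩

lemma finite_of_van {V : Type} [AddCommGroup V] [Module F2 V] {C : GD V} {P Q : Submodule F2 V} {m : ℕ}
    (h : C.Van P Q m) : Module.Finite F2 (C.H P Q m) := by
  rw [← GD.subsingleton_iff] at h
  infer_instance

lemma HD_succ {V V' : Type} [AddCommGroup V] [Module F2 V] [AddCommGroup V'] [Module F2 V'] {C : GD V} {C' : GD V'}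
    {P Q : Submodule F2 V} {P' Q' : Submodule F2 V'} {d : ℕ}
    (e : ∀ m, Nonempty (C.H P Q (m+1) ≃ₗ[F2] C'.H P' Q' m)) (h0 : C.Van P Q 0)
    (h : HD C' P' Q' d) : HD C P Q (d+1) := by
  intro m
  rcases m with _ | m
  · exact ⟨⟨fun _ => by omega, fun _ => h0⟩, finite_of_van h0⟩
  · obtain ⟨e⟩ := e m
    obtain ⟨h1, h2⟩ := h m
    refine ⟨⟨fun hv => ?_, fun hm => van_congr ⟨e⟩ (h1.2 (by omega))⟩, Module.Finite.equiv e.symm⟩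
    have := h1.1 (van_congr ⟨e.symm⟩ hv)
    omega

/-- converse shift -/
lemma HD_pred {V V' : Type} [AddCommGroup V] [Module F2 V] [AddCommGroup V'] [Module F2 V'] {C : GD V} {C' : GD V'}
    {P Q : Submodule F2 V} {P' Q' : Submodule F2 V'} {d : ℕ}
    (e : ∀ m, Nonempty (C.H P Q (m+1) ≃ₗ[F2] C'.H P' Q' m))
    (h : HD C P Q (d+1)) : HD C' P' Q' d := by
  intro m
  obtain ⟨e⟩ := e m
  obtain ⟨h1, h2⟩ := h (m+1)
  refine ⟨⟨fun hv => ?_, fun hm => van_congr ⟨e.symm⟩ (h1.2 (by omega))⟩, Module.Finite.equiv e⟩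
  have := h1.1 (van_congr ⟨e⟩ hv)
  omega

/-- homology of a point -/
lemma HD_point (x : X) : HD (Sg X) (Sm {{x}}) ⊥ 0 := by
  let κ : ∀ m, SS X := fun m => ⟨m, ContinuousMap.const _ x⟩
  have hmem : ∀ m v, v ∈ Sm {{x}} → v ∈ (Sg X).gr m → ∃ b : F2, v = b • sg (κ m) := by
    intro m v hv hm
    have : v ∈ Finsupp.supported F2 F2 {κ m} := by
      intro σ hσ
      obtain ⟨Z, rfl, hZ⟩ := hv hσ
      have hm' := hm hσ
      obtain ⟨l, σ⟩ := σ
      obtain rfl : l = m := hm'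
      refine Sigma.ext rfl (heq_of_eq ?_)
      ext1 t
      exact hZ ⟨t, rfl⟩
    rw [Finsupp.supported_eq_span_single, Set.image_singleton, Submodule.mem_span_singleton] at this
    obtain ⟨b, hb⟩ := this
    exact ⟨b, hb.symm⟩
  have hκ : ∀ m, sg (κ m) ∈ Sm {{x}} ∧ sg (κ m) ∈ (Sg X).gr m := by
    intro m
    refine ⟨sg_mem ⟨_, rfl, ?_⟩, sg_mem rfl⟩
    rintro _ ⟨t, rfl⟩
    rfl
  have hd : ∀ m, (Sg X).d (sg (κ (m+1))) = ((m:F2)+2) • sg (κ m) := by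
    intro m
    show lx sbd _ = _
    rw [lx_sg]
    show ∑ i : Fin (m+2), sg (κ m) = _
    simp only [Finset.sum_const, Finset.card_univ, Fintype.card_fin]
    rw [← Nat.cast_smul_eq_nsmul F2]
    push_cast
    rfl
  have h2 : (2 : F2) = 0 := rfl
  have hv : ∀ m, (Sg X).Van (Sm {{x}}) ⊥ (m+1) := by
    intro m z hz
    rw [GD.mem_Z] at hz
    obtain ⟨b, rfl⟩ := hmem _ z hz.1 hz.2.1
    have h3 := hz.2.2
    rw [map_smul, hd, Submodule.mem_bot, h2, add_zero] at h3
    have hm : (m : F2) = 0 ∨ (m : F2) = 1 := by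
      generalize (m : F2) = a
      revert a; decide
    rcases hm with hm | hm
    · refine GD.mem_B.2 ⟨0, Submodule.zero_mem _, Submodule.zero_mem _, b • sg (κ (m+2)),
        Submodule.smul_mem _ _ (hκ _).1, Submodule.smul_mem _ _ (hκ _).2, ?_⟩
      rw [map_smul, hd]
      push_cast
      rw [hm, h2]
      simp
    · rw [hm, one_smul] at h3
      have hb : b = 0 := by
        have := DFunLike.congr_fun h3 (κ m)
        simpa using this
      rw [hb, zero_smul]
      exact Submodule.zero_mem _
  have hB0 : ∀ z ∈ (Sg X).B (Sm {{x}}) ⊥ 0, z = 0 := by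
    intro z hz
    obtain ⟨q, hq, _, p, hp, hp', rfl⟩ := GD.mem_B.1 hz
    obtain ⟨b, rfl⟩ := hmem _ p hp hp'
    rw [Submodule.mem_bot] at hq
    rw [hq, map_smul, hd, h2]
    simp
  intro m
  rcases m with _ | m
  · refine ⟨⟨fun h => ?_, fun h => absurd rfl h⟩, ?_⟩
    · exfalso
      have := hB0 _ (h (sg (κ 0)) (GD.mem_Z.2 ⟨(hκ 0).1, (hκ 0).2, by
        rw [(Sg X).d_zero _ (hκ 0).2]; exact Submodule.zero_mem _⟩))
      have := DFunLike.congr_fun this (κ 0)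
      simp at this
    · have hle : (Sg X).Z (Sm {{x}}) ⊥ 0 ≤ Submodule.span F2 {sg (κ 0)} := by
        intro z hz
        rw [GD.mem_Z] at hz
        obtain ⟨b, rfl⟩ := hmem _ z hz.1 hz.2.1
        exact Submodule.smul_mem _ _ (Submodule.mem_span_singleton_self _)
      have : Module.Finite F2 ((Sg X).Z (Sm {{x}}) ⊥ 0) := Submodule.finiteDimensional_of_le hle
      infer_instance
  · exact ⟨⟨fun _ => by omega, fun _ => hv m⟩, finite_of_van (hv m)⟩

end
end DH

set_option linter.unusedSectionVars false
set_option linter.unusedVariables false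
set_option linter.unusedSimpArgs false
namespace DH
open CategoryTheory

lemma link_gen {V : Type} [AddCommGroup V] [Module F2 V] (C : GD V) (K : ChainComplex (ModuleCat F2) ℕ)
    (φ : ∀ m, K.X m →ₗ[F2] V) (hφ : ∀ m, Function.Injective (φ m))
    (hr : ∀ m v, v ∈ C.gr m ↔ ∃ x, φ m x = v)
    (hd : ∀ m x, φ m ((K.d (m+1) m).hom x) = C.d (φ (m+1) x)) (m : ℕ) :
    Nonempty (K.homology m ≃ₗ[F2] C.H ⊤ ⊥ m) := by
  have hprev : (ComplexShape.down ℕ).prev m = m + 1 := ChainComplex.prev ℕ m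
  let S := K.sc' (m+1) m ((ComplexShape.down ℕ).next m)
  let e1 : K.homology m ≅ S.homology := K.homologyIsoSc' (m+1) m _ hprev rfl
  let e2 : S.homology ≅ S.moduleCatLeftHomologyData.H := S.moduleCatHomologyIso
  have hker : ∀ x : K.X m, S.g.hom x = 0 ↔ C.d (φ m x) = 0 := by
    intro x
    show (K.d m ((ComplexShape.down ℕ).next m)).hom x = 0 ↔ _
    rcases m with _ | l
    · constructor
      · intro _
        exact C.d_zero _ ((hr 0 _).2 ⟨x, rfl⟩)
      · intro _
        rw [K.shape _ _ (by simp)]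
        rfl
    · rw [ChainComplex.next_nat_succ, ← hd]
      constructor
      · intro h; rw [h, map_zero]
      · intro h; exact hφ l (by rw [h, map_zero])
  let ψ : LinearMap.ker S.g.hom →ₗ[F2] C.Z ⊤ ⊥ m :=
    ((φ m).comp (LinearMap.ker S.g.hom).subtype).codRestrict _ (by
      intro x
      refine GD.mem_Z.2 ⟨trivial, (hr m _).2 ⟨x.1, rfl⟩, ?_⟩
      rw [Submodule.mem_bot]
      exact (hker x.1).1 x.2)
  let π : LinearMap.ker S.g.hom →ₗ[F2] C.H ⊤ ⊥ m := (Submodule.mkQ _).comp ψ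
  have hπ : Function.Surjective π := by
    intro y
    obtain ⟨z, hz, rfl⟩ := GD.cls_surj y
    have hz' := GD.mem_Z.1 hz
    obtain ⟨x, hx⟩ := (hr m z).1 hz'.2.1
    refine ⟨⟨x, (hker x).2 (by rw [hx]; simpa using hz'.2.2)⟩, ?_⟩
    show Submodule.Quotient.mk _ = Submodule.Quotient.mk _
    congr 1
    exact Subtype.ext hx
  have hk : LinearMap.ker π = LinearMap.range S.moduleCatToCycles := by
    ext x
    rw [LinearMap.mem_ker]
    show Submodule.Quotient.mk (ψ x) = _ ↔ _
    rw [Submodule.Quotient.mk_eq_zero, Submodule.mem_comap, LinearMap.mem_range]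
    show φ m x.1 ∈ _ ↔ _
    rw [GD.mem_B]
    constructor
    · rintro ⟨q, hq, _, p, _, hp, e⟩
      obtain ⟨y, rfl⟩ := (hr (m+1) p).1 hp
      refine ⟨y, Subtype.ext (hφ m ?_)⟩
      rw [e, (Submodule.mem_bot F2).1 hq, zero_add, ← hd]
      rfl
    · rintro ⟨y, rfl⟩
      refine ⟨0, Submodule.zero_mem _, Submodule.zero_mem _, φ (m+1) y, trivial, (hr _ _).2 ⟨y, rfl⟩, ?_⟩
      rw [zero_add]
      exact hd m y
  let e3 : (LinearMap.ker S.g.hom ⧸ LinearMap.range S.moduleCatToCycles) ≃ₗ[F2] C.H ⊤ ⊥ m :=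
    (Submodule.quotEquivOfEq _ _ hk.symm).trans (LinearMap.quotKerEquivOfSurjective π hπ)
  exact ⟨(e1 ≪≫ e2).toLinearEquiv.trans e3⟩

lemma neg_one_smul_F2 {V : Type*} [AddCommGroup V] [Module F2 V] (i : ℕ) (y : V) : ((-1 : ℤ)^i) • y = y := by
  have h : (-1 : F2) = 1 := rfl
  have : ((-1 : ℤ)^i) • y = (((-1 : ℤ)^i : ℤ) : F2) • y := (Int.cast_smul_eq_zsmul F2 _ y).symm
  rw [this]
  push_cast
  rw [h, one_pow, one_smul]

lemma alt_d (A : SimplicialObject (ModuleCat F2)) (m : ℕ) (y : A.obj (Opposite.op (SimplexCategory.mk (m+1)))) :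
    (((AlgebraicTopology.alternatingFaceMapComplex (ModuleCat F2)).obj A).d (m+1) m).hom y =
      ∑ i : Fin (m+2), (A.δ i).hom y := by
  rw [AlgebraicTopology.alternatingFaceMapComplex_obj_d]
  show (∑ i : Fin (m+2), ((-1 : ℤ)^(i:ℕ)) • A.δ i).hom y = _
  rw [ModuleCat.hom_sum, LinearMap.sum_apply]
  refine Finset.sum_congr rfl fun i _ => ?_
  rw [ModuleCat.hom_zsmul, LinearMap.smul_apply, neg_one_smul_F2]

lemma link (X : Type) [TopologicalSpace X] (m : ℕ) :
    Nonempty (sHomology F2 X m ≃ₗ[F2] (Sg X).H ⊤ ⊥ m) := by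
  let A := ((SimplicialObject.whiskering _ _).obj (ModuleCat.free F2)).obj
      (TopCat.toSSet.obj (TopCat.of X))
  let τ : ∀ m : ℕ, (TopCat.toSSet.obj (TopCat.of X)).obj (Opposite.op (SimplexCategory.mk m)) ≃ C(Sx m, X) :=
    fun m => TopCat.toSSetObjEquiv (TopCat.of X) (Opposite.op (SimplexCategory.mk m))
  have hτ : ∀ m (i : Fin (m+2)) x, τ m (((TopCat.toSSet.obj (TopCat.of X)).δ i) x) = (τ (m+1) x).comp (fc i) := by
    intro m i x
    rfl
  let φ : ∀ m, (((TopCat.toSSet.obj (TopCat.of X)).obj (Opposite.op (SimplexCategory.mk m))) →₀ F2) →ₗ[F2] Ch X :=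
    fun m => pf (fun x => (⟨m, τ m x⟩ : SS X))
  have hφ : ∀ m c, φ m c = Finsupp.mapDomain (fun x => (⟨m, τ m x⟩ : SS X)) c := by
    intro m c
    have : φ m = Finsupp.lmapDomain F2 F2 (fun x => (⟨m, τ m x⟩ : SS X)) := by
      apply lhom_ext
      intro x
      simp [φ, sg]
    rw [this]; rfl
  have hinj : ∀ m, Function.Injective (fun x => (⟨m, τ m x⟩ : SS X)) := by
    intro m x y h
    simp only [Sigma.mk.injEq, heq_eq_eq, true_and] at h
    exact (τ m).injective h
  refine link_gen (Sg X) ((AlgebraicTopology.alternatingFaceMapComplex (ModuleCat F2)).obj A)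
    φ ?_ ?_ ?_ m
  · intro m x y h
    exact Finsupp.mapDomain_injective (hinj m) ((hφ m x).symm.trans (h.trans (hφ m y)))
  · intro m v
    constructor
    · intro hv
      have hv' : v ∈ Finsupp.supported F2 F2 ((fun x => (⟨m, τ m x⟩ : SS X)) '' Set.univ) := by
        intro σ hσ
        obtain ⟨l, σ⟩ := σ
        obtain rfl : l = m := hv hσ
        exact ⟨(τ l).symm σ, trivial, by simp⟩
      rw [← Finsupp.lmapDomain_supported] at hv'
      obtain ⟨x, _, hx⟩ := hv'
      exact ⟨x, (hφ m x).trans hx⟩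
    · rintro ⟨x, rfl⟩
      refine supp_map (φ m) (A := Set.univ) (fun y _ => ?_) (by rw [Finsupp.supported_univ]; trivial)
      simp only [φ, pf_sg]
      exact sg_mem rfl
  · intro m
    let D : ∀ i : Fin (m+2), (((TopCat.toSSet.obj (TopCat.of X)).obj (Opposite.op (SimplexCategory.mk (m+1)))) →₀ F2) →ₗ[F2]
        (((TopCat.toSSet.obj (TopCat.of X)).obj (Opposite.op (SimplexCategory.mk m))) →₀ F2) := fun i => (A.δ i).hom
    have hD : ∀ i x, D i (sg x) = sg ((TopCat.toSSet.obj (TopCat.of X)).δ i x) := by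
      intro i x
      exact Finsupp.mapDomain_single
    have key : ∑ i, (φ m).comp (D i) = ((Sg X).d).comp (φ (m+1)) := by
      apply lhom_ext
      intro x
      have e2 : φ (m+1) (sg x) = sg ⟨m+1, τ (m+1) x⟩ := by simp [φ]
      rw [LinearMap.comp_apply, e2]
      show _ = lx sbd _
      rw [lx_sg]
      show _ = ∑ i : Fin (m+2), _
      rw [LinearMap.sum_apply]
      refine Finset.sum_congr rfl fun i _ => ?_
      rw [LinearMap.comp_apply, hD, ← hτ]
      simp [φ]
    intro x
    refine Eq.trans ?_ (LinearMap.congr_fun key x)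
    refine (congrArg (φ m) (alt_d A m x)).trans ?_
    exact (map_sum (φ m) (fun i => D i x) Finset.univ).trans
      (LinearMap.sum_apply Finset.univ (fun i => (φ m).comp (D i)) x).symm
end DH

set_option linter.unusedSectionVars false
set_option linter.unusedVariables false
set_option linter.unusedSimpArgs false
namespace DH
open CubeFace

/-- closed cell -/
def cell {n : ℕ} (F : CubeFace n) : Set (Fin n → ℝ) :=
  {x | (∀ i, 0 ≤ x i ∧ x i ≤ 1) ∧
    ∀ i, (F i = some false → x i = 0) ∧ (F i = some true → x i = 1)}

lemma real_eq {n : ℕ} (K : Set (CubeFace n)) : real K = ⋃ F ∈ K, cell F := rfl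

/-- the carrier of a point -/
noncomputable def car {n : ℕ} (x : Fin n → ℝ) : CubeFace n :=
  fun i => if x i = 0 then some false else if x i = 1 then some true else none

/-- unit cube -/
def cube (n : ℕ) : Set (Fin n → ℝ) := {x | ∀ i, 0 ≤ x i ∧ x i ≤ 1}

/-- downward closed -/
def Dn {n : ℕ} (K : Set (CubeFace n)) : Prop := ∀ F ∈ K, ∀ G : CubeFace n, G ≤ F → G ∈ K

lemma le_def {n : ℕ} {F G : CubeFace n} : F ≤ G ↔ ∀ i, G i = none ∨ F i = G i := Iff.rfl

lemma mem_cell {n : ℕ} {F : CubeFace n} {x : Fin n → ℝ} : x ∈ cell F ↔ x ∈ cube n ∧ car x ≤ F := by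
  unfold cell cube
  rw [le_def]
  simp only [Set.mem_ofPred_eq]
  refine and_congr_right fun _ => forall_congr' fun i => ?_
  unfold car
  rcases h : F i with _ | _ | _ <;> by_cases h0 : x i = 0 <;> by_cases h1 : x i = 1 <;> simp [h0, h1]

lemma mem_real {n : ℕ} {K : Set (CubeFace n)} (hK : Dn K) {x : Fin n → ℝ} :
    x ∈ real K ↔ x ∈ cube n ∧ car x ∈ K := by
  rw [real_eq]
  simp only [Set.mem_iUnion, mem_cell, exists_prop]
  constructor
  · rintro ⟨F, hF, h1, h2⟩
    exact ⟨h1, hK F hF _ h2⟩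
  · rintro ⟨h1, h2⟩
    exact ⟨_, h2, h1, le_rfl⟩

lemma cell_mono {n : ℕ} {F G : CubeFace n} (h : F ≤ G) : cell F ⊆ cell G := by
  intro x hx
  rw [mem_cell] at *
  exact ⟨hx.1, hx.2.trans h⟩

lemma cell_subset_real {n : ℕ} {K : Set (CubeFace n)} {F : CubeFace n} (h : F ∈ K) : cell F ⊆ real K :=
  Set.subset_biUnion_of_mem (u := fun F => cell F) h

lemma real_mono {n : ℕ} {K K' : Set (CubeFace n)} (h : K ⊆ K') : real K ⊆ real K' :=
  Set.biUnion_mono h fun _ _ => le_rfl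

/-- cellwise singular chains -/
noncomputable def A {n : ℕ} (K : Set (CubeFace n)) : Submodule F2 (Ch (Fin n → ℝ)) := Sm (cell '' K)

lemma A_mono {n : ℕ} {K K' : Set (CubeFace n)} (h : K ⊆ K') : A K ≤ A K' := by
  refine Sm_mono ?_
  rintro _ ⟨F, hF, rfl⟩
  exact ⟨_, ⟨F, h hF, rfl⟩, le_rfl⟩

lemma A_le {n : ℕ} (K : Set (CubeFace n)) : A K ≤ Sm {real K} := by
  refine Sm_mono ?_
  rintro _ ⟨F, hF, rfl⟩
  exact ⟨_, rfl, cell_subset_real hF⟩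

lemma A_sub {n : ℕ} (K : Set (CubeFace n)) : (Sg _).Sub (A K) := Sm_sub _

lemma A_empty {n : ℕ} : A (∅ : Set (CubeFace n)) = ⊥ := by
  rw [A, Set.image_empty, Sm_empty]

/-- the expansion map -/
noncomputable def ex {n : ℕ} (x : Fin n → ℝ) : Fin n → ℝ := fun i => max 0 (min 1 (2 * x i - 1/2))

lemma ex_cont {n : ℕ} : Continuous (ex : (Fin n → ℝ) → _) := by
  unfold ex; fun_prop

lemma cell_convex {n : ℕ} (F : CubeFace n) : Convex ℝ (cell F) := by
  intro x hx y hy a b ha hb hab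
  refine ⟨fun i => ?_, fun i => ⟨fun h => ?_, fun h => ?_⟩⟩
  · simp only [Pi.add_apply, Pi.smul_apply, smul_eq_mul]
    have h1 := hx.1 i; have h2 := hy.1 i
    constructor <;> nlinarith
  · simp [(hx.2 i).1 h, (hy.2 i).1 h]
  · simp [(hx.2 i).2 h, (hy.2 i).2 h, hab]

lemma ex_cell {n : ℕ} (F : CubeFace n) {x : Fin n → ℝ} (hx : x ∈ cell F) : ex x ∈ cell F := by
  refine ⟨fun i => by simp [ex], fun i => ⟨fun h => ?_, fun h => ?_⟩⟩
  · simp [ex, (hx.2 i).1 h]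
  · simp [ex, (hx.2 i).2 h]; norm_num

lemma van_real {n : ℕ} {K : Set (CubeFace n)} (hK : Dn K) (m : ℕ) : (Sg (Fin n → ℝ)).Van (Sm {real K}) (A K) m := by
  have hcell : ∀ F : CubeFace n, ∀ x ∈ cell F, ∀ t ∈ Set.Icc (0:ℝ) 1, (1-t) • x + t • ex x ∈ cell F :=
    fun F x hx t ht => cell_convex F hx (ex_cell F hx) (by linarith [ht.2]) ht.1 (by ring)
  refine van_amb (real K) (fun x t => (1-t) • x + t • ex x) ?_ ?_ ?_ _ ?_ ?_ ?_ m
  · have := ex_cont (n := n)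
    fun_prop
  · intro x hx t ht
    have := (mem_real hK).1 hx
    exact cell_subset_real this.2 (hcell _ x (mem_cell.2 ⟨this.1, le_rfl⟩) t ht)
  · intro x _; simp
  · rintro _ ⟨F, hF, rfl⟩
    exact cell_subset_real hF
  · rintro _ ⟨F, hF, rfl⟩
    exact ⟨_, ⟨F, hF, rfl⟩, hcell F⟩
  · intro x hx
    have hx' := (mem_real hK).1 hx
    refine ⟨⋂ i, {y | (x i = 0 → y i < 1/4) ∧ (x i = 1 → 3/4 < y i)}, ?_, ?_, cell (car x), ⟨_, hx'.2, rfl⟩, ?_⟩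
    · refine isOpen_iInter_of_finite fun i => ?_
      have h1 : IsOpen {y : Fin n → ℝ | y i < 1/4} := isOpen_lt (by fun_prop) (by fun_prop)
      have h2 : IsOpen {y : Fin n → ℝ | 3/4 < y i} := isOpen_lt (by fun_prop) (by fun_prop)
      by_cases h0 : x i = 0
      · simpa [h0] using h1
      · by_cases h1 : x i = 1
        · simpa [h1] using h2
        · simp [h0, h1]
    · rw [Set.mem_iInter]
      intro i
      constructor <;> intro h <;> rw [h] <;> norm_num
    · rintro y ⟨hy, _⟩
      rw [Set.mem_iInter] at hy
      simp only [sub_self, zero_smul, one_smul, zero_add]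
      refine ⟨fun i => by simp [ex], fun i => ?_⟩
      have hyi := hy i
      constructor
      · intro h
        have : x i = 0 := by
          by_contra h0
          unfold car at h
          rw [if_neg h0] at h
          split_ifs at h <;> simp at h
        have := hyi.1 this
        exact max_eq_left ((min_le_right _ _).trans (by linarith))
      · intro h
        have : x i = 1 := by
          by_contra h0
          unfold car at h
          rw [if_neg h0] at h
          split_ifs at h <;> simp at h
        have := hyi.2 this
        show max 0 (min 1 (2 * y i - 1/2)) = 1
        rw [min_eq_left (by linarith)]
        norm_num

lemma iso_real {n : ℕ} {K K' : Set (CubeFace n)} (hK : Dn K) (hK' : Dn K') (h : K' ⊆ K) (m : ℕ) :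
    Nonempty ((Sg (Fin n → ℝ)).H (A K) (A K') m ≃ₗ[F2] (Sg (Fin n → ℝ)).H (Sm {real K}) (Sm {real K'}) m) := by
  obtain ⟨e1⟩ := iso_RQ_PQ (m := m) (C := Sg (Fin n → ℝ)) (A_mono h) (A_le K) (van_real hK m) (van_real hK (m+1))
  obtain ⟨e2⟩ := iso_PQ_PR (m := m) (C := Sg (Fin n → ℝ)) (P := Sm {real K}) (A_le K')
    (Sm_mono_set (real_mono h)) (Sm_sub _) (van_real hK')
  exact ⟨e1.trans e2⟩

lemma A_exc {n : ℕ} {K1 K2 : Set (CubeFace n)} (h1 : Dn K1) (h2 : Dn K2) (m : ℕ) :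
    Nonempty ((Sg (Fin n → ℝ)).H (A K1) (A (K1 ∩ K2)) m ≃ₗ[F2] (Sg (Fin n → ℝ)).H (A (K1 ∪ K2)) (A K2) m) := by
  have := exc_fam (X := Fin n → ℝ) (Q1 := cell '' K1) (Q2 := cell '' K2) (Q12 := cell '' (K1 ∩ K2)) ?_ ?_ ?_ m
  · rw [← Set.image_union] at this
    exact this
  · rintro _ ⟨F, hF, rfl⟩ _ ⟨G, hG, rfl⟩ x ⟨hx1, hx2⟩
    let J : CubeFace n := fun i => if F i = none then G i else F i
    have hx1' := (mem_cell.1 hx1).2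
    have hx2' := (mem_cell.1 hx2).2
    refine ⟨cell J, ⟨J, ⟨h1 F hF J ?_, h2 G hG J ?_⟩, rfl⟩, ?_⟩
    · intro i
      by_cases h : F i = none <;> simp [J, h]
    · intro i
      by_cases h : F i = none
      · simp [J, h]
      · rcases hx2' i with h' | h'
        · exact Or.inl h'
        · right
          simp only [J, h, if_false]
          rw [← h']
          rcases hx1' i with h'' | h''
          · exact absurd h'' h
          · exact h''.symm
    · rintro y ⟨hy1, hy2⟩
      rw [mem_cell] at *
      refine ⟨hy1.1, fun i => ?_⟩
      by_cases h : F i = none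
      · simp only [J, h, if_true]; exact hy2.2 i
      · have e : J i = F i := by simp [J, h]
        rw [e]; exact hy1.2 i
  · rintro _ ⟨F, hF, rfl⟩
    exact ⟨_, ⟨F, hF.1, rfl⟩, le_rfl⟩
  · rintro _ ⟨F, hF, rfl⟩
    exact ⟨_, ⟨F, hF.2, rfl⟩, le_rfl⟩

end DH

set_option linter.unusedSectionVars false
set_option linter.unusedVariables false
set_option linter.unusedSimpArgs false
namespace DH
open CubeFace

/-- entries of the gauge -/
noncomputable def ent {n : ℕ} (p x : Fin n → ℝ) : Fin n → ℝ :=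
  fun i => max ((x i - p i) / (1 - p i)) ((p i - x i) / p i)

/-- gauge of the cube centred at p -/
noncomputable def rho {n : ℕ} (p x : Fin n → ℝ) : ℝ := ‖ent p x‖

lemma rho_cont {n : ℕ} (p : Fin n → ℝ) : Continuous (rho p) := by
  unfold rho ent
  refine Continuous.norm (continuous_pi fun i => ?_)
  refine Continuous.max ?_ ?_
  · exact Continuous.div_const (by fun_prop) _
  · exact Continuous.div_const (by fun_prop) _

lemma ent_nonneg {n : ℕ} {p : Fin n → ℝ} (hp : p ∈ cube n) (x : Fin n → ℝ) (i) : 0 ≤ ent p x i := by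
  have h := hp i
  unfold ent
  rcases le_total (p i) (x i) with h' | h'
  · exact le_max_of_le_left (div_nonneg (by linarith) (by linarith))
  · exact le_max_of_le_right (div_nonneg (by linarith) (by linarith))

lemma rho_lt_one {n : ℕ} {p : Fin n → ℝ} (hp : p ∈ cube n) (x : Fin n → ℝ) :
    rho p x < 1 ↔ ∀ i, ent p x i < 1 := by
  unfold rho
  rw [pi_norm_lt_iff one_pos]
  refine forall_congr' fun i => ?_
  rw [Real.norm_of_nonneg (ent_nonneg hp x i)]

lemma rho_le_one {n : ℕ} {p : Fin n → ℝ} (hp : p ∈ cube n) (x : Fin n → ℝ) :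
    rho p x ≤ 1 ↔ ∀ i, ent p x i ≤ 1 := by
  unfold rho
  rw [pi_norm_le_iff_of_nonneg zero_le_one]
  refine forall_congr' fun i => ?_
  rw [Real.norm_of_nonneg (ent_nonneg hp x i)]

lemma rho_smul {n : ℕ} (p x : Fin n → ℝ) {s : ℝ} (hs : 0 ≤ s) :
    rho p (p + s • (x - p)) = s * rho p x := by
  have : ent p (p + s • (x - p)) = s • ent p x := by
    funext i
    simp only [ent, Pi.add_apply, Pi.smul_apply, Pi.sub_apply, smul_eq_mul]
    rw [mul_max_of_nonneg _ _ hs]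
    congr 1 <;> ring
  rw [rho, this, norm_smul, Real.norm_of_nonneg hs, rho]

lemma rho_pos {n : ℕ} {p x : Fin n → ℝ} (hp : p ∈ cube n)
    (h : ∀ i, (p i < x i → p i < 1) ∧ (x i < p i → 0 < p i)) (hx : x ≠ p) : 0 < rho p x := by
  obtain ⟨i, hi⟩ := Function.ne_iff.1 hx
  have h1 : ent p x i ≤ rho p x := (le_abs_self _).trans (norm_le_pi_norm (ent p x) i)
  refine lt_of_lt_of_le ?_ h1
  unfold ent
  rcases lt_or_gt_of_ne hi with h' | h'
  · exact lt_max_of_lt_right (div_pos (by linarith) ((h i).2 h'))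
  · exact lt_max_of_lt_left (div_pos (by linarith) (by linarith [(h i).1 h']))

/-- the radial deformation -/
noncomputable def rad {n : ℕ} (p : Fin n → ℝ) (x : Fin n → ℝ) (t : ℝ) : Fin n → ℝ :=
  p + (1 - t + t / min 1 (rho p x)) • (x - p)

lemma rad_zero {n : ℕ} (p x : Fin n → ℝ) : rad p x 0 = x := by simp [rad]

lemma rad_fix {n : ℕ} {p x : Fin n → ℝ} (h : 1 ≤ rho p x) (t : ℝ) : rad p x t = x := by
  rw [rad, min_eq_left h]; simp

lemma rad_cont {n : ℕ} {p : Fin n → ℝ} {P : Set (Fin n → ℝ)} (h : ∀ x ∈ P, 0 < rho p x) (T : Set ℝ) :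
    ContinuousOn (fun z : (Fin n → ℝ) × ℝ => rad p z.1 z.2) (P ×ˢ T) := by
  unfold rad
  have hc := rho_cont p
  have h0 : ∀ z ∈ P ×ˢ T, min 1 (rho p z.1) ≠ 0 := by
    rintro ⟨x, t⟩ ⟨hx, _⟩
    exact (lt_min one_pos (h x hx)).ne'
  fun_prop (disch := assumption)

lemma scal {r t : ℝ} (hr : 0 < r) (hr1 : r ≤ 1) (ht : t ∈ Set.Icc (0:ℝ) 1) :
    1 ≤ 1 - t + t / r ∧ (1 - t + t / r) * r ≤ 1 := by
  have h1 : t ≤ t / r := by rw [le_div_iff₀ hr]; nlinarith [ht.1]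
  refine ⟨by linarith, ?_⟩
  rw [add_mul, div_mul_cancel₀ _ hr.ne']
  nlinarith [ht.1, ht.2]

/-- when rho ≤ 1, coordinates stay in the interval if they started in direction -/
lemma mem_cube_of_rho {n : ℕ} {p : Fin n → ℝ} (hp : p ∈ cube n) {x : Fin n → ℝ} (h : rho p x ≤ 1)
    (hd : ∀ i, (p i < x i → p i < 1) ∧ (x i < p i → 0 < p i)) : x ∈ cube n := by
  intro i
  have h1 := (rho_le_one hp x).1 h i
  unfold ent at h1
  rw [max_le_iff] at h1
  have hpi := hp i
  rcases lt_trichotomy (p i) (x i) with h' | h' | h'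
  · have := (hd i).1 h'
    have h2 := h1.1
    rw [div_le_one (by linarith)] at h2
    constructor <;> linarith
  · rw [← h']; exact hpi
  · have := (hd i).2 h'
    have h2 := h1.2
    rw [div_le_one (by linarith)] at h2
    constructor <;> linarith

lemma cube_rho_le {n : ℕ} {p : Fin n → ℝ} (hp : p ∈ cube n) {x : Fin n → ℝ} (hx : x ∈ cube n) : rho p x ≤ 1 := by
  rw [rho_le_one hp]
  intro i
  have h1 := hp i
  have h2 := hx i
  unfold ent
  refine max_le (div_le_one_of_le₀ (by linarith) (by linarith)) (div_le_one_of_le₀ (by linarith) (by linarith))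

lemma cube_dir {n : ℕ} {p : Fin n → ℝ} {x : Fin n → ℝ} (hx : x ∈ cube n) :
    ∀ i, (p i < x i → p i < 1) ∧ (x i < p i → 0 < p i) := by
  intro i
  have h2 := hx i
  constructor <;> intro h <;> linarith

lemma rho_lt_iff_car {n : ℕ} {p : Fin n → ℝ} (hp : p ∈ cube n) {x : Fin n → ℝ} (hx : x ∈ cube n) :
    rho p x < 1 ↔ car p ≤ car x := by
  rw [rho_lt_one hp, le_def]
  refine forall_congr' fun i => ?_
  have h1 := hp i
  have h2 := hx i
  unfold ent
  rw [max_lt_iff]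
  have e1 : (x i - p i) / (1 - p i) < 1 ↔ (x i = 1 → p i = 1) := by
    rcases eq_or_lt_of_le h1.2 with h | h
    · simp [h]
    · rw [div_lt_one (by linarith)]
      constructor
      · intro h3 h4; linarith
      · intro h3
        rcases eq_or_lt_of_le h2.2 with h4 | h4
        · linarith [h3 h4]
        · linarith
  have e2 : (p i - x i) / p i < 1 ↔ (x i = 0 → p i = 0) := by
    rcases eq_or_lt_of_le h1.1 with h | h
    · simp [← h]
    · rw [div_lt_one (by linarith)]
      constructor
      · intro h3 h4; linarith
      · intro h3
        rcases eq_or_lt_of_le h2.1 with h4 | h4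
        · linarith [h3 h4.symm]
        · linarith
  rw [e1, e2]
  unfold car
  by_cases a1 : x i = 0
  · by_cases b : p i = 0 <;> by_cases c : p i = 1 <;> simp [a1, b, c]
  · by_cases a2 : x i = 1
    · by_cases b : p i = 0 <;> by_cases c : p i = 1 <;> simp [a1, a2, b, c]
    · simp [a1, a2]

/-- radial retraction on a cubical complex -/
lemma van_rad {n : ℕ} {K : Set (CubeFace n)} (hK : Dn K) {p : Fin n → ℝ} (hp : p ∈ cube n) (m : ℕ) :
    (Sg (Fin n → ℝ)).Van (Sm {real K \ {p}}) (Sm {real (K \ {F | car p ≤ F})}) m := by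
  have hK' : Dn (K \ {F | car p ≤ F}) := fun F hF G hG => ⟨hK F hF.1 G hG, fun h => hF.2 (le_trans h hG)⟩
  have hpos : ∀ x ∈ real K \ {p}, 0 < rho p x := fun x hx =>
    rho_pos hp (cube_dir ((mem_real hK).1 hx.1).1) hx.2
  have hst : ∀ x, x ∈ real (K \ {F | car p ≤ F}) ↔ x ∈ real K ∧ 1 ≤ rho p x := by
    intro x
    rw [mem_real hK', mem_real hK]
    constructor
    · rintro ⟨h1, h2, h3⟩
      refine ⟨⟨h1, h2⟩, ?_⟩
      by_contra h
      exact h3 ((rho_lt_iff_car hp h1).1 (not_le.1 h))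
    · rintro ⟨⟨h1, h2⟩, h3⟩
      exact ⟨h1, h2, fun h => absurd ((rho_lt_iff_car hp h1).2 h) (not_lt.2 h3)⟩
  have hmem : ∀ x ∈ real K \ {p}, ∀ t ∈ Set.Icc (0:ℝ) 1, rad p x t ∈ real K := by
    intro x hx t ht
    have hx1 := (mem_real hK).1 hx.1
    have h0 := hpos x hx
    have h1 := cube_rho_le hp hx1.1
    rcases h1.lt_or_eq with h2 | h2
    · have hc := (rho_lt_iff_car hp hx1.1).1 h2
      have hs := scal h0 h1 ht
      have hcube : rad p x t ∈ cube n := by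
        apply mem_cube_of_rho hp
        · rw [rad, min_eq_right h1, rho_smul _ _ (by linarith [hs.1])]; exact hs.2
        · intro i
          have hd := cube_dir (p := p) hx1.1 i
          rw [rad, min_eq_right h1]
          simp only [Pi.add_apply, Pi.smul_apply, Pi.sub_apply, smul_eq_mul]
          constructor
          · intro h; apply hd.1; by_contra h'; nlinarith [hs.1]
          · intro h; apply hd.2; by_contra h'; nlinarith [hs.1]
      have hxc : x ∈ cell (car x) := mem_cell.2 ⟨hx1.1, le_rfl⟩
      have hpc : p ∈ cell (car x) := mem_cell.2 ⟨hp, hc⟩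
      refine cell_subset_real hx1.2 ⟨hcube, fun i => ⟨fun h => ?_, fun h => ?_⟩⟩
      · simp [rad, (hxc.2 i).1 h, (hpc.2 i).1 h]
      · simp [rad, (hxc.2 i).2 h, (hpc.2 i).2 h]
    · rw [rad_fix h2.ge]; exact hx.1
  refine van_amb _ (rad p) (rad_cont hpos _) ?_ (fun x _ => rad_zero p x) _ ?_ ?_ ?_ m
  · intro x hx t ht
    refine ⟨hmem x hx t ht, ?_⟩
    intro h
    have h0 := hpos x hx
    have h1 := cube_rho_le hp ((mem_real hK).1 hx.1).1
    have hs := scal h0 h1 ht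
    rw [Set.mem_singleton_iff] at h
    have h2 : (1 - t + t / rho p x) • (x - p) = 0 := by
      rw [rad, min_eq_right h1] at h
      simpa using h
    rcases smul_eq_zero.1 h2 with h3 | h3
    · linarith
    · exact hx.2 (sub_eq_zero.1 h3)
  · rintro Z rfl x hx
    rw [hst] at hx
    refine ⟨hx.1, fun h => ?_⟩
    rw [Set.mem_singleton_iff] at h
    have : rho p x = 0 := by
      have := rho_smul p p (s := 0) le_rfl
      simpa [h] using this
    linarith [hx.2]
  · rintro Z rfl
    refine ⟨_, rfl, fun x hx t ht => ?_⟩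
    rw [rad_fix ((hst x).1 hx).2]; exact hx
  · intro x hx
    refine ⟨Set.univ, isOpen_univ, trivial, _, rfl, ?_⟩
    rintro y ⟨_, hy⟩
    rw [hst]
    refine ⟨hmem y hy 1 (by simp), ?_⟩
    have h0 := hpos y hy
    have h1 := cube_rho_le hp ((mem_real hK).1 hy.1).1
    rw [rad, min_eq_right h1, rho_smul _ _ (by rw [sub_self, zero_add]; positivity)]
    rw [sub_self, zero_add, one_div, inv_mul_cancel₀ h0.ne']

/-- open unit cube -/
def ocube (n : ℕ) : Set (Fin n → ℝ) := {x | ∀ i, 0 < x i ∧ x i < 1}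

lemma ocube_sub {n : ℕ} : ocube n ⊆ cube n := fun x hx i => ⟨(hx i).1.le, (hx i).2.le⟩

/-- radial retraction in a chart -/
lemma van_chart {n : ℕ} {Ω : Set (Fin n → ℝ)} (hΩ : cube n ⊆ Ω) {p : Fin n → ℝ} (hp : p ∈ ocube n) (m : ℕ) :
    (Sg (Fin n → ℝ)).Van (Sm {Ω \ {p}}) (Sm {Ω \ ocube n}) m := by
  have hp' := ocube_sub hp
  have hdir : ∀ x : Fin n → ℝ, ∀ i, (p i < x i → p i < 1) ∧ (x i < p i → 0 < p i) :=
    fun x i => ⟨fun _ => (hp i).2, fun _ => (hp i).1⟩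
  have hpos : ∀ x ∈ Ω \ {p}, 0 < rho p x := fun x hx => rho_pos hp' (hdir x) hx.2
  have hlt : ∀ x, rho p x < 1 ↔ x ∈ ocube n := by
    intro x
    rw [rho_lt_one hp']
    refine forall_congr' fun i => ?_
    have := hp i
    unfold ent
    rw [max_lt_iff, div_lt_one (by linarith), div_lt_one (by linarith)]
    constructor <;> rintro ⟨h1, h2⟩ <;> constructor <;> linarith
  have hmem : ∀ x ∈ Ω \ {p}, ∀ t ∈ Set.Icc (0:ℝ) 1, rad p x t ∈ Ω := by
    intro x hx t ht
    have h0 := hpos x hx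
    rcases lt_or_ge (rho p x) 1 with h2 | h2
    · have hs := scal h0 h2.le ht
      apply hΩ
      apply mem_cube_of_rho hp' _ (hdir _)
      rw [rad, min_eq_right h2.le, rho_smul _ _ (by linarith [hs.1])]; exact hs.2
    · rw [rad_fix h2]; exact hx.1
  refine van_amb _ (rad p) (rad_cont hpos _) ?_ (fun x _ => rad_zero p x) _ ?_ ?_ ?_ m
  · intro x hx t ht
    refine ⟨hmem x hx t ht, ?_⟩
    intro h
    have h0 := hpos x hx
    have hs := scal (lt_min one_pos h0) (min_le_left _ _) ht
    rw [Set.mem_singleton_iff] at h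
    have h2 : (1 - t + t / min 1 (rho p x)) • (x - p) = 0 := by
      rw [rad] at h
      simpa using h
    rcases smul_eq_zero.1 h2 with h3 | h3
    · linarith
    · exact hx.2 (sub_eq_zero.1 h3)
  · rintro Z rfl x hx
    refine ⟨hx.1, fun h => ?_⟩
    rw [Set.mem_singleton_iff] at h
    exact hx.2 (h ▸ hp)
  · rintro Z rfl
    refine ⟨_, rfl, fun x hx t ht => ?_⟩
    rw [rad_fix (not_lt.1 fun h => hx.2 ((hlt x).1 h))]; exact hx
  · intro x hx
    refine ⟨Set.univ, isOpen_univ, trivial, _, rfl, ?_⟩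
    rintro y ⟨_, hy⟩
    refine ⟨hmem y hy 1 (by simp), ?_⟩
    rw [← hlt, not_lt]
    have h0 := hpos y hy
    rcases lt_or_ge (rho p y) 1 with h2 | h2
    · rw [rad, min_eq_right h2.le, rho_smul _ _ (by rw [sub_self, zero_add]; positivity)]
      rw [sub_self, zero_add, one_div, inv_mul_cancel₀ h0.ne']
    · rw [rad_fix h2]; exact h2
end DH

set_option linter.unusedSectionVars false
set_option linter.unusedVariables false
set_option linter.unusedSimpArgs false
namespace DH
open CubeFace

/-- change one coordinate -/
def setc {n : ℕ} (F : CubeFace n) (i : Fin n) (o : Option Bool) : CubeFace n :=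
  fun j => if j = i then o else F j

lemma setc_same {n : ℕ} (F : CubeFace n) (i : Fin n) (o : Option Bool) : setc F i o i = o := by simp [setc]
lemma setc_ne {n : ℕ} (F : CubeFace n) {i j : Fin n} (o : Option Bool) (h : j ≠ i) : setc F i o j = F j := by
  simp [setc, h]

open Classical in
/-- free coordinates -/
noncomputable def fr {n : ℕ} (F : CubeFace n) : Finset (Fin n) := Finset.univ.filter (fun i => F i = none)

lemma mem_fr {n : ℕ} {F : CubeFace n} {i : Fin n} : i ∈ fr F ↔ F i = none := by simp [fr]

lemma dim_eq {n : ℕ} (F : CubeFace n) : dim F = (fr F).card := by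
  unfold dim fr
  congr

lemma dim_setc {n : ℕ} (F : CubeFace n) {i : Fin n} (b : Bool) (h : F i = none) :
    dim F = dim (setc F i (some b)) + 1 := by
  rw [dim_eq, dim_eq]
  have : fr F = insert i (fr (setc F i (some b))) := by
    ext j
    by_cases hj : j = i
    · subst hj; simp [h, mem_fr]
    · simp [setc_ne F _ hj, hj, mem_fr]
  rw [this, Finset.card_insert_of_notMem]
  simp [setc_same, mem_fr]

lemma setc_le {n : ℕ} (F : CubeFace n) {i : Fin n} (o : Option Bool) (h : F i = none) : setc F i o ≤ F := by
  intro j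
  by_cases hj : j = i
  · subst hj; exact Or.inl h
  · right; rw [setc_ne F _ hj]

/-- centre of a cell -/
noncomputable def ctr {n : ℕ} (F : CubeFace n) : Fin n → ℝ :=
  fun i => match F i with
    | none => 1/2
    | some false => 0
    | some true => 1

lemma ctr_cube {n : ℕ} (F : CubeFace n) : ctr F ∈ cube n := by
  intro i
  unfold ctr
  rcases F i with _ | _ | _ <;> norm_num

lemma car_ctr {n : ℕ} (F : CubeFace n) : car (ctr F) = F := by
  funext i
  unfold car ctr
  rcases h : F i with _ | _ | _ <;> norm_num

lemma ctr_mem {n : ℕ} (F : CubeFace n) : ctr F ∈ cell F := mem_cell.2 ⟨ctr_cube F, (car_ctr F).le⟩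

lemma Dn_Iic {n : ℕ} (F : CubeFace n) : Dn (Set.Iic F) := fun G hG J hJ => le_trans hJ hG
lemma Dn_bdry {n : ℕ} (F : CubeFace n) : Dn (bdryHat F) := fun G hG J hJ =>
  ⟨le_trans hJ hG.1, fun h => hG.2 (le_antisymm hG.1 (h ▸ hJ))⟩
lemma Dn_diff {n : ℕ} {K : Set (CubeFace n)} (hK : Dn K) (G : CubeFace n) : Dn (K \ {F | G ≤ F}) :=
  fun F hF J hJ => ⟨hK F hF.1 J hJ, fun h => hF.2 (le_trans h hJ)⟩

lemma real_Iic {n : ℕ} (F : CubeFace n) : real (Set.Iic F) = cell F := by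
  ext x
  rw [mem_real (Dn_Iic F), mem_cell]; rfl

/-- a set star shaped about `c` is acyclic rel `c` -/
lemma van_star {n : ℕ} {P : Set (Fin n → ℝ)} {c : Fin n → ℝ} (hc : c ∈ P)
    (h : ∀ x ∈ P, ∀ t ∈ Set.Icc (0:ℝ) 1, (1-t) • x + t • c ∈ P) (m : ℕ) :
    (Sg (Fin n → ℝ)).Van (Sm {P}) (Sm {{c}}) m := by
  refine van_amb P (fun x t => (1-t) • x + t • c) (by fun_prop) h (by simp) _ ?_ ?_ ?_ m
  · rintro Z rfl x rfl; exact hc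
  · rintro Z rfl
    refine ⟨_, rfl, ?_⟩
    rintro x rfl t ht
    rw [← add_smul]; simp
  · intro x hx
    exact ⟨Set.univ, isOpen_univ, trivial, _, rfl, by simp⟩

lemma van_horn {n : ℕ} (F : CubeFace n) {i : Fin n} (hi : F i = none) (m : ℕ) :
    (Sg (Fin n → ℝ)).Van (A (Set.Iic F)) (A (Set.Iic F \ {G | setc F i (some true) ≤ G})) m := by
  set F1 := setc F i (some true) with hF1
  have hF1F : F1 ≤ F := setc_le F _ hi
  have hdn := Dn_diff (Dn_Iic F) F1
  refine van_congr (iso_real (Dn_Iic F) hdn Set.sdiff_subset m) ?_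
  have hsub : real (Set.Iic F \ {G | F1 ≤ G}) ⊆ real (Set.Iic F) \ {ctr F1} := by
    intro x hx
    refine ⟨real_mono Set.sdiff_subset hx, ?_⟩
    rintro rfl
    have := ((mem_real hdn).1 hx).2.2
    rw [car_ctr] at this
    exact this (le_refl F1)
  have hcF : ctr F ∈ real (Set.Iic F) := by rw [real_Iic]; exact ctr_mem F
  have hci : ctr F i = 1/2 := by simp [ctr, hi]
  have hpi : ctr F1 i = 1 := by simp [ctr, hF1, setc_same]
  have h1 : ∀ m, (Sg (Fin n → ℝ)).Van (Sm {real (Set.Iic F)}) (Sm {{ctr F}}) m := by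
    refine van_star hcF ?_
    intro x hx t ht
    rw [real_Iic] at *
    exact cell_convex F hx (ctr_mem F) (by linarith [ht.2]) ht.1 (by ring)
  have h2 : ∀ m, (Sg (Fin n → ℝ)).Van (Sm {real (Set.Iic F) \ {ctr F1}}) (Sm {{ctr F}}) m := by
    refine van_star ⟨hcF, ?_⟩ ?_
    · intro h
      rw [Set.mem_singleton_iff] at h
      rw [h] at hci
      linarith
    · rintro x ⟨hx, hx'⟩ t ht
      rw [real_Iic] at *
      refine ⟨cell_convex F hx (ctr_mem F) (by linarith [ht.2]) ht.1 (by ring), ?_⟩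
      intro h
      rw [Set.mem_singleton_iff] at h
      have h3 := congrFun h i
      simp only [Pi.add_apply, Pi.smul_apply, smul_eq_mul, hci, hpi] at h3
      have h4 := hx.1 i
      have ht0 : t = 0 := by nlinarith [ht.1, ht.2]
      rw [ht0] at h
      apply hx'
      simpa using h
  have hle : Sm {{ctr F}} ≤ Sm {real (Set.Iic F) \ {ctr F1}} := by
    apply Sm_mono_set
    rintro x rfl
    refine ⟨hcF, fun h => ?_⟩
    rw [Set.mem_singleton_iff] at h
    rw [h] at hci
    linarith
  have h3 := fun m => van_PR (m := m) (C := Sg (Fin n → ℝ)) (Sm_mono_set Set.sdiff_subset) hle (Sm_sub _) h1 h2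
  have h4 := van_rad (Dn_Iic F) (ctr_cube F1) m
  rw [car_ctr] at h4
  exact van_PQ (C := Sg (Fin n → ℝ)) (Sm_mono_set Set.sdiff_subset) (h3 m) h4 (Sm_mono_set hsub)

lemma HD_cube {n : ℕ} : ∀ (k : ℕ) (F : CubeFace n), dim F = k → HD (Sg (Fin n → ℝ)) (A (Set.Iic F)) (A (bdryHat F)) k := by
  intro k
  induction k with
  | zero =>
    intro F hF
    have hn : ∀ i, F i ≠ none := by
      intro i hi
      have := dim_setc F true hi
      omega
    have h1 : Set.Iic F = {F} := by
      ext G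
      simp only [Set.mem_Iic, Set.mem_singleton_iff]
      constructor
      · intro h
        funext i
        exact (h i).resolve_left (hn i)
      · rintro rfl; exact le_rfl
    have h2 : bdryHat F = ∅ := by
      ext G
      simp only [bdryHat, Set.mem_ofPred_eq, Set.mem_empty_iff_false, iff_false]
      rintro ⟨h, h'⟩
      have : G ∈ Set.Iic F := h
      rw [h1] at this
      exact h' this
    have h3 : cell F = {ctr F} := by
      ext x
      simp only [Set.mem_singleton_iff]
      constructor
      · intro hx
        funext i
        unfold ctr
        rcases h : F i with _ | _ | _
        · exact absurd h (hn i)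
        · exact (hx.2 i).1 h
        · exact (hx.2 i).2 h
      · rintro rfl
        exact ctr_mem F
    rw [h1, h2, A_empty, A, Set.image_singleton, h3]
    exact HD_point _
  | succ k ih =>
    intro F hF
    obtain ⟨i, hi⟩ : ∃ i, F i = none := by
      by_contra h
      push Not at h
      rw [dim_eq] at hF
      have : fr F = ∅ := by
        ext i; simp [mem_fr, h]
      rw [this] at hF
      simp at hF
    have hd := dim_setc F true hi
    have hv := van_horn F hi
    set F1 := setc F i (some true) with hF1
    have hF1F : F1 ≤ F := setc_le F _ hi
    have hne : F1 ≠ F := by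
      intro h
      have := congrFun h i
      rw [hF1, setc_same, hi] at this
      exact absurd this (by simp)
    have hbt : ∀ G, F1 ≤ G → G ≤ F → G = F1 ∨ G = F := by
      intro G h1 h2
      have hj : ∀ j, j ≠ i → G j = F j := by
        intro j hj
        have e := h1 j
        rw [hF1, setc_ne F _ hj] at e
        rcases e with e | e
        · rcases h2 j with e' | e'
          · rw [e, e']
          · exact e'
        · exact e.symm
      rcases h1 i with h | h
      · right
        funext j
        by_cases hji : j = i
        · rw [hji, h, hi]
        · exact hj j hji
      · left
        funext j
        by_cases hji : j = i
        · rw [hji, h]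
        · rw [hj j hji, hF1, setc_ne F _ hji]
    have e1 : Set.Iic F1 ∩ (Set.Iic F \ {G | F1 ≤ G}) = bdryHat F1 := by
      ext G
      simp only [Set.mem_inter_iff, Set.mem_Iic, Set.mem_sdiff, Set.mem_ofPred_eq, bdryHat]
      constructor
      · rintro ⟨h1, h2, h3⟩
        exact ⟨h1, fun h => h3 h.ge⟩
      · rintro ⟨h1, h2⟩
        exact ⟨h1, h1.trans hF1F, fun h => h2 (le_antisymm h1 h)⟩
    have e2 : Set.Iic F1 ∪ (Set.Iic F \ {G | F1 ≤ G}) = bdryHat F := by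
      ext G
      simp only [Set.mem_union, Set.mem_Iic, Set.mem_sdiff, Set.mem_ofPred_eq, bdryHat]
      constructor
      · rintro (h | ⟨h1, h2⟩)
        · exact ⟨h.trans hF1F, fun h' => hne (le_antisymm hF1F (h' ▸ h))⟩
        · exact ⟨h1, fun h => h2 (h ▸ hF1F)⟩
      · rintro ⟨h1, h2⟩
        by_cases h3 : F1 ≤ G
        · rcases hbt G h3 h1 with h | h
          · exact Or.inl h.le
          · exact absurd h h2
        · exact Or.inr ⟨h1, h3⟩
    have hsub : (Set.Iic F \ {G | F1 ≤ G}) ⊆ bdryHat F := by rw [← e2]; exact Set.subset_union_right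
    have hbs : bdryHat F ⊆ Set.Iic F := fun G hG => hG.1
    refine HD_succ (C' := Sg (Fin n → ℝ)) (fun m => ?_) ?_ (ih F1 (by omega))
    · obtain ⟨a⟩ := iso_PR_RQ (m := m) (C := Sg (Fin n → ℝ)) (A_mono hsub) (A_mono hbs) (A_sub _) hv
      obtain ⟨b⟩ := A_exc (Dn_Iic F1) (Dn_diff (Dn_Iic F) F1) m
      rw [e1, e2] at b
      exact ⟨a.trans b.symm⟩
    · exact van_zero_PR (C := Sg (Fin n → ℝ)) (A_mono hbs) (A_mono hsub) (hv 0)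

/-- finite dimensionality -/
lemma finite_A {n : ℕ} {K : Set (CubeFace n)} (hK : Dn K) (m : ℕ) : Module.Finite F2 ((Sg (Fin n → ℝ)).H (A K) ⊥ m) := by
  have hfin : Finite (CubeFace n) := inferInstanceAs (Finite (Fin n → Option Bool))
  induction hc : K.ncard using Nat.strong_induction_on generalizing K with
  | _ N ih =>
  rcases K.eq_empty_or_nonempty with rfl | hne
  · rw [A_empty]
    apply finite_of_van
    intro z hz
    have := (GD.mem_Z.1 hz).1
    rw [Submodule.mem_bot] at this
    rw [this]; exact Submodule.zero_mem _
  · obtain ⟨F, hF⟩ := (Set.toFinite K).exists_maximal hne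
    have hK' : Dn (K \ {F}) := fun G hG J hJ => ⟨hK G hG.1 J hJ, fun h => hG.2
      (le_antisymm (hF.2 hG.1 ((Set.mem_singleton_iff.1 h) ▸ hJ)) ((Set.mem_singleton_iff.1 h) ▸ hJ))⟩
    have h1 := ih (K \ {F}).ncard (by rw [← hc]; exact Set.ncard_sdiff_singleton_lt_of_mem hF.1) hK' rfl
    have e1 : Set.Iic F ∩ (K \ {F}) = bdryHat F := by
      ext G
      simp only [Set.mem_inter_iff, Set.mem_Iic, Set.mem_sdiff, Set.mem_singleton_iff, bdryHat, Set.mem_ofPred_eq]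
      constructor
      · rintro ⟨h1, h2, h3⟩; exact ⟨h1, h3⟩
      · rintro ⟨h1, h2⟩; exact ⟨h1, hK F hF.1 G h1, h2⟩
    have e2 : Set.Iic F ∪ (K \ {F}) = K := by
      ext G
      simp only [Set.mem_union, Set.mem_Iic, Set.mem_sdiff, Set.mem_singleton_iff]
      constructor
      · rintro (h | h)
        · exact hK F hF.1 G h
        · exact h.1
      · intro h
        by_cases h' : G = F
        · exact Or.inl h'.le
        · exact Or.inr ⟨h, h'⟩
    obtain ⟨b⟩ := A_exc (Dn_Iic F) hK' m
    rw [e1, e2] at b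
    have := (HD_cube _ F rfl m).2
    exact finite_PQ (C := Sg (Fin n → ℝ)) (A_mono Set.sdiff_subset) bot_le h1 (Module.Finite.equiv b)

end DH

set_option linter.unusedSectionVars false
set_option linter.unusedVariables false
set_option linter.unusedSimpArgs false
namespace DH
open CubeFace

lemma cube_compact {n : ℕ} : IsCompact (cube n) := by
  have : cube n = Set.Icc 0 1 := by
    ext x
    simp only [cube, Set.mem_ofPred_eq, Set.mem_Icc, Pi.le_def, Pi.zero_apply, Pi.one_apply]
    exact forall_and
  rw [this]
  exact isCompact_Icc

lemma ocube_open {n : ℕ} : IsOpen (ocube n) := by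
  have : ocube n = ⋂ i, {x | 0 < x i ∧ x i < 1} := by ext x; simp [ocube]
  rw [this]
  refine isOpen_iInter_of_finite fun i => ?_
  have h1 : IsOpen {x : Fin n → ℝ | 0 < x i} := isOpen_lt (by fun_prop) (by fun_prop)
  have h2 : IsOpen {x : Fin n → ℝ | x i < 1} := isOpen_lt (by fun_prop) (by fun_prop)
  exact h1.inter h2

/-- centre -/
noncomputable def cc (d : ℕ) : Fin d → ℝ := fun _ => 1/2

lemma cc_mem (d : ℕ) : cc d ∈ ocube d := fun i => by unfold cc; norm_num

lemma chart_data {n d : ℕ} {X : Set (Fin n → ℝ)} (hX : ChartedSpace (EuclideanSpace ℝ (Fin d)) ↥X)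
    {p : Fin n → ℝ} (hp : p ∈ X) {V : Set (Fin n → ℝ)} (hV : IsOpen V) (hpV : p ∈ V) :
    ∃ (Ω : Set (Fin d → ℝ)) (ψ : C(Ω, Fin n → ℝ)), cube d ⊆ Ω ∧ Topology.IsEmbedding ψ ∧
      (∃ O, IsOpen O ∧ Set.range ψ = X ∩ O) ∧ Set.range ψ ⊆ V ∧ ∃ h : cc d ∈ Ω, ψ ⟨cc d, h⟩ = p := by
  let e0 := chartAt (EuclideanSpace ℝ (Fin d)) (⟨p, hp⟩ : X)
  have hV' : IsOpen (Subtype.val ⁻¹' V : Set X) := hV.preimage continuous_subtype_val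
  let e := e0.restrOpen (Subtype.val ⁻¹' V) hV'
  have hsrc : e.source = e0.source ∩ (Subtype.val ⁻¹' V) := e0.restrOpen_source _ hV'
  have hps : (⟨p, hp⟩ : X) ∈ e.source := by
    rw [hsrc]
    exact ⟨mem_chart_source _ _, hpV⟩
  set y0 := e ⟨p, hp⟩ with hy0
  have hy0t : y0 ∈ e.target := e.map_source hps
  obtain ⟨δ, hδ, hball⟩ := Metric.isOpen_iff.1 e.open_target y0 hy0t
  let ι : (Fin d → ℝ) ≃ₜ EuclideanSpace ℝ (Fin d) :=
    (Homeomorph.subRight (cc d)).trans (EuclideanSpace.equiv (Fin d) ℝ).symm.toHomeomorph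
  have hιc : ι (cc d) = 0 := by
    show (EuclideanSpace.equiv (Fin d) ℝ).symm (cc d - cc d) = 0
    rw [sub_self, map_zero]
  obtain ⟨B, hB⟩ := (cube_compact (n := d)).exists_bound_of_continuousOn ι.continuous.continuousOn
  have hB0 : 0 ≤ B := (norm_nonneg _).trans (hB _ (ocube_sub (cc_mem d)))
  let r : ℝ := δ / (B + 1)
  have hr : 0 < r := by positivity
  let a : (Fin d → ℝ) ≃ₜ EuclideanSpace ℝ (Fin d) :=
    (ι.trans (Homeomorph.smulOfNeZero r hr.ne')).trans (Homeomorph.addLeft y0)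
  have ha : ∀ z, a z = y0 + r • ι z := fun z => rfl
  let g : a ⁻¹' e.target → e.target := e.target.restrictPreimage a
  have hg : Topology.IsEmbedding g := a.isEmbedding.restrictPreimage _
  let ψ0 : a ⁻¹' e.target → (Fin n → ℝ) := fun z => (e.toHomeomorphSourceTarget.symm (g z)).1.1
  have hψ : Topology.IsEmbedding ψ0 :=
    Topology.IsEmbedding.subtypeVal.comp (Topology.IsEmbedding.subtypeVal.comp
      (e.toHomeomorphSourceTarget.symm.isEmbedding.comp hg))
  have hgs : Function.Surjective g := Set.restrictPreimage_surjective _ a.surjective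
  have hran : Set.range ψ0 = Subtype.val '' e.source := by
    ext x
    constructor
    · rintro ⟨z, rfl⟩
      exact ⟨_, (e.toHomeomorphSourceTarget.symm (g z)).2, rfl⟩
    · rintro ⟨x, hx, rfl⟩
      obtain ⟨z, hz⟩ := hgs (e.toHomeomorphSourceTarget ⟨x, hx⟩)
      refine ⟨z, ?_⟩
      show (e.toHomeomorphSourceTarget.symm (g z)).1.1 = _
      rw [hz, Homeomorph.symm_apply_apply]
  have hc : cc d ∈ a ⁻¹' e.target := by
    show a (cc d) ∈ e.target
    rw [ha, hιc, smul_zero, add_zero]; exact hy0t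
  refine ⟨a ⁻¹' e.target, ⟨ψ0, hψ.continuous⟩, ?_, hψ, ?_, ?_, hc, ?_⟩
  · intro z hz
    apply hball
    rw [Metric.mem_ball, ha, dist_eq_norm, add_sub_cancel_left, norm_smul, Real.norm_of_nonneg hr.le]
    calc r * ‖ι z‖ ≤ r * B := by gcongr; exact hB z hz
      _ < r * (B + 1) := by gcongr; linarith
      _ = δ := div_mul_cancel₀ _ (by positivity)
  · obtain ⟨O, hO, hO'⟩ := isOpen_induced_iff.1 e.open_source
    refine ⟨O, hO, ?_⟩
    show Set.range ψ0 = _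
    rw [hran, ← hO', Subtype.image_preimage_coe]
  · show Set.range ψ0 ⊆ _
    rw [hran]
    rintro _ ⟨x, hx, rfl⟩
    rw [hsrc] at hx
    exact hx.2
  · show (e.toHomeomorphSourceTarget.symm (g ⟨cc d, hc⟩)).1.1 = p
    have : g ⟨cc d, hc⟩ = e.toHomeomorphSourceTarget ⟨⟨p, hp⟩, hps⟩ := by
      apply Subtype.ext
      show a (cc d) = e ⟨p, hp⟩
      rw [ha, hιc, smul_zero, add_zero]
    rw [this, Homeomorph.symm_apply_apply]

section
variable {n d : ℕ} {X : Set (Fin n → ℝ)} {Ω : Set (Fin d → ℝ)} (ψ : C(Ω, Fin n → ℝ)) (hc : cube d ⊆ Ω)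
  (hψ : Topology.IsEmbedding ψ) {O : Set (Fin n → ℝ)} (hO : IsOpen O) (hr : Set.range ψ = X ∩ O)

include hψ in
/-- transport from the chart -/
lemma chart_iso (P Q : Set (Fin d → ℝ)) (hP : P ⊆ Ω) (hQ : Q ⊆ Ω) (m : ℕ) :
    Nonempty ((Sg (Fin n → ℝ)).H (Sm {ψ '' (Subtype.val ⁻¹' P)}) (Sm {ψ '' (Subtype.val ⁻¹' Q)}) m ≃ₗ[F2]
      (Sg (Fin d → ℝ)).H (Sm {P}) (Sm {Q}) m) := by
  obtain ⟨a⟩ := emb_iso_set ψ hψ (Subtype.val ⁻¹' P) (Subtype.val ⁻¹' Q) m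
  obtain ⟨b⟩ := emb_iso_set ⟨Subtype.val, continuous_subtype_val⟩ (Topology.IsEmbedding.subtypeVal (p := (· ∈ Ω)))
    (Subtype.val ⁻¹' P) (Subtype.val ⁻¹' Q) m
  have e1 : (⟨Subtype.val, continuous_subtype_val⟩ : C(Ω, Fin d → ℝ)) '' (Subtype.val ⁻¹' P) = P := by
    simp only [ContinuousMap.coe_mk, Subtype.image_preimage_coe]; exact Set.inter_eq_right.2 hP
  have e2 : (⟨Subtype.val, continuous_subtype_val⟩ : C(Ω, Fin d → ℝ)) '' (Subtype.val ⁻¹' Q) = Q := by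
    simp only [ContinuousMap.coe_mk, Subtype.image_preimage_coe]; exact Set.inter_eq_right.2 hQ
  rw [e1, e2] at b
  exact ⟨a.symm.trans b⟩

include hψ in
lemma img_diff (S : Set Ω) (P : Set (Fin d → ℝ)) (hS : S = Subtype.val ⁻¹' P) :
    ψ '' (Subtype.val ⁻¹' (Ω \ P)) = Set.range ψ \ ψ '' S := by
  have : (Subtype.val ⁻¹' (Ω \ P) : Set Ω) = Sᶜ := by
    rw [hS]; ext z; simp
  rw [this, Set.image_compl_eq_range_sdiff_image hψ.injective]

include hc hψ hO hr in
lemma van_W {z : Ω} (hz : z.1 ∈ ocube d) (m : ℕ) :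
    (Sg (Fin n → ℝ)).Van (Sm {X \ {ψ z}}) (Sm {X \ ψ '' (Subtype.val ⁻¹' (ocube d))}) m := by
  set W := ψ '' (Subtype.val ⁻¹' (ocube d)) with hW
  have hzW : ψ z ∈ W := ⟨z, hz, rfl⟩
  have hWr : W ⊆ Set.range ψ := Set.image_subset_range _ _
  have hrX : Set.range ψ ⊆ X := by rw [hr]; exact Set.inter_subset_left
  obtain ⟨e⟩ := exc_set (P := X \ {ψ z}) (A := Set.range ψ \ {ψ z}) (B := X \ W)
    (Set.sdiff_subset_sdiff_left hrX) (Set.sdiff_subset_sdiff_right (by simpa using hzW)) (by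
      intro x hx
      by_cases hxr : x ∈ Set.range ψ
      · refine ⟨O, hO, ?_, Or.inl ?_⟩
        · rw [hr] at hxr; exact hxr.2
        · rintro y ⟨hy, hy'⟩
          refine ⟨?_, hy'.2⟩
          rw [hr]; exact ⟨hy'.1, hy⟩
      · have hcl : IsCompact (ψ '' (Subtype.val ⁻¹' (cube d))) := by
          refine IsCompact.image ?_ ψ.continuous
          rw [Topology.IsEmbedding.subtypeVal.isCompact_iff, Subtype.image_preimage_coe, Set.inter_eq_right.2 hc]
          exact cube_compact
        refine ⟨(ψ '' (Subtype.val ⁻¹' (cube d)))ᶜ, hcl.isClosed.isOpen_compl, ?_, Or.inr ?_⟩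
        · intro h
          exact hxr (Set.image_subset_range _ _ h)
        · rintro y ⟨hy, hy'⟩
          refine ⟨hy'.1, fun h => hy ?_⟩
          exact Set.image_mono (Set.preimage_mono ocube_sub) h) m
  have e1 : (Set.range ψ \ {ψ z}) ∩ (X \ W) = Set.range ψ \ W := by
    ext x
    simp only [Set.mem_inter_iff, Set.mem_sdiff, Set.mem_singleton_iff]
    constructor
    · rintro ⟨⟨h1, h2⟩, h3, h4⟩; exact ⟨h1, h4⟩
    · rintro ⟨h1, h2⟩
      refine ⟨⟨h1, ?_⟩, hrX h1, h2⟩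
      rintro rfl; exact h2 hzW
  rw [e1] at e
  refine van_congr ⟨e.symm⟩ ?_
  have h1 := img_diff ψ hψ {z} {z.1} (by ext w; simp [Subtype.ext_iff])
  have h2 := img_diff ψ hψ _ (ocube d) rfl
  rw [Set.image_singleton] at h1
  rw [← h1, hW, ← h2]
  exact van_congr (chart_iso ψ hψ _ _ Set.sdiff_subset Set.sdiff_subset m) (van_chart hc hz m)

lemma HD_I (d : ℕ) : HD (Sg (Fin d → ℝ)) (Sm {cube d}) (Sm {cube d \ {cc d}}) d := by
  let F : CubeFace d := fun _ => none
  have hd : dim F = d := by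
    rw [dim_eq]
    have : fr F = Finset.univ := by ext i; simp only [mem_fr, Finset.mem_univ, iff_true]; rfl
    rw [this]; simp
  have hall : ∀ G : CubeFace d, G ≤ F := fun G i => Or.inl rfl
  have hctr : ctr F = cc d := rfl
  have e1 : real (Set.Iic F) = cube d := by
    rw [real_Iic]; ext x; rw [mem_cell]; exact ⟨fun h => h.1, fun h => ⟨h, hall _⟩⟩
  have e2 : Set.Iic F \ {G | F ≤ G} = bdryHat F := by
    ext G
    exact ⟨fun h => ⟨h.1, fun h' => h.2 h'.ge⟩, fun h => ⟨h.1, fun h' => h.2 (le_antisymm h.1 h')⟩⟩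
  have hv := van_rad (Dn_Iic F) (ctr_cube F)
  rw [car_ctr, e2, e1, hctr] at hv
  have hsub : real (bdryHat F) ⊆ cube d \ {cc d} := by
    intro x hx
    have h := (mem_real (Dn_bdry F)).1 hx
    refine ⟨h.1, ?_⟩
    intro hh
    rw [Set.mem_singleton_iff] at hh
    rw [hh, ← hctr, car_ctr] at h
    exact h.2.2 rfl
  refine HD_congr (fun m => ?_) (HD_cube d F hd)
  obtain ⟨a⟩ := iso_real (Dn_Iic F) (Dn_bdry F) (fun G hG => hG.1) m
  rw [e1] at a
  obtain ⟨b⟩ := iso_PQ_PR (m := m) (C := Sg (Fin d → ℝ)) (Sm_mono_set hsub) (Sm_mono_set (P := cube d \ {cc d}) (Q := cube d) Set.sdiff_subset) (Sm_sub _) hv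
  exact ⟨(a.trans b).symm⟩

include hc hψ hO hr in
lemma HD_chart (h : cc d ∈ Ω) : HD (Sg (Fin n → ℝ)) (Sm {X}) (Sm {X \ {ψ ⟨cc d, h⟩}}) d := by
  have hrX : Set.range ψ ⊆ X := by rw [hr]; exact Set.inter_subset_left
  refine HD_congr (fun m => ?_) (HD_I d)
  obtain ⟨e⟩ := exc_set (P := X) (A := Set.range ψ) (B := X \ {ψ ⟨cc d, h⟩}) hrX Set.sdiff_subset (by
      intro x hx
      by_cases hxr : x = ψ ⟨cc d, h⟩
      · refine ⟨O, hO, ?_, Or.inl ?_⟩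
        · have : x ∈ Set.range ψ := hxr ▸ ⟨_, rfl⟩
          rw [hr] at this; exact this.2
        · rintro y ⟨hy, hy'⟩
          rw [hr]; exact ⟨hy', hy⟩
      · exact ⟨_, isOpen_compl_singleton, hxr, Or.inr fun y hy => ⟨hy.2, hy.1⟩⟩) m
  have e1 : Set.range ψ ∩ (X \ {ψ ⟨cc d, h⟩}) = ψ '' (Subtype.val ⁻¹' (Ω \ {cc d})) := by
    rw [img_diff ψ hψ {⟨cc d, h⟩} {cc d} (by ext w; simp [Subtype.ext_iff]), Set.image_singleton]
    ext x
    simp only [Set.mem_inter_iff, Set.mem_sdiff]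
    exact ⟨fun h => ⟨h.1, h.2.2⟩, fun h => ⟨h.1, hrX h.1, h.2⟩⟩
  have e2 : Set.range ψ = ψ '' (Subtype.val ⁻¹' Ω) := by simp
  rw [e1] at e
  rw [e2] at e
  obtain ⟨f⟩ := chart_iso ψ hψ Ω (Ω \ {cc d}) le_rfl Set.sdiff_subset m
  obtain ⟨g⟩ := exc_set (P := Ω) (A := cube d) (B := Ω \ {cc d}) hc Set.sdiff_subset (by
      intro x hx
      by_cases hxr : x = cc d
      · exact ⟨ocube d, ocube_open, hxr ▸ cc_mem d, Or.inl fun y hy => ocube_sub hy.1⟩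
      · exact ⟨_, isOpen_compl_singleton, hxr, Or.inr fun y hy => ⟨hy.2, hy.1⟩⟩) m
  have e3 : cube d ∩ (Ω \ {cc d}) = cube d \ {cc d} := by
    ext x
    simp only [Set.mem_inter_iff, Set.mem_sdiff]
    exact ⟨fun h => ⟨h.1, h.2.2⟩, fun h => ⟨h.1, hc h.1, h.2⟩⟩
  rw [e3] at g
  exact ⟨(e.symm.trans f).trans g.symm⟩
end
end DH

set_option linter.unusedSectionVars false
set_option linter.unusedVariables false
set_option linter.unusedSimpArgs false
namespace DH
open CubeFace

lemma Dn_st {n : ℕ} {M : Set (CubeFace n)} (hM : Dn M) (G : CubeFace n) : Dn (M \ {F | G ≤ F}) := Dn_diff hM G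

lemma ctr_real {n : ℕ} {M : Set (CubeFace n)} (hM : Dn M) {G : CubeFace n} (hG : G ∈ M) : ctr G ∈ real M :=
  (mem_real hM).2 ⟨ctr_cube G, by rw [car_ctr]; exact hG⟩

lemma real_st_sub {n : ℕ} {M : Set (CubeFace n)} (hM : Dn M) {p : Fin n → ℝ} :
    real (M \ {F | car p ≤ F}) ⊆ real M \ {p} := by
  intro x hx
  have h := (mem_real (Dn_st hM _)).1 hx
  refine ⟨real_mono Set.sdiff_subset hx, ?_⟩
  intro hh
  rw [Set.mem_singleton_iff] at hh
  rw [hh] at h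
  exact h.2.2 (le_refl (car p))

lemma loc {n d : ℕ} {M : Set (CubeFace n)} (hM : Dn M)
    (hX : ChartedSpace (EuclideanSpace ℝ (Fin d)) ↥(real M)) {G : CubeFace n} (hG : G ∈ M) :
    HD (Sg (Fin n → ℝ)) (A M) (A (M \ {F | G ≤ F})) d := by
  obtain ⟨Ω, ψ, hc, hψ, ⟨O, hO, hr⟩, -, h, hp⟩ := chart_data hX (ctr_real hM hG) isOpen_univ (Set.mem_univ _)
  have H := HD_chart ψ hc hψ hO hr h
  rw [hp] at H
  refine HD_congr (fun m => ?_) H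
  obtain ⟨a⟩ := iso_real hM (Dn_st hM G) Set.sdiff_subset m
  have hv := van_rad hM (ctr_cube G)
  have hs := real_st_sub hM (p := ctr G)
  rw [car_ctr] at hv hs
  obtain ⟨b⟩ := iso_PQ_PR (m := m) (C := Sg (Fin n → ℝ)) (Sm_mono_set hs)
    (Sm_mono_set (P := real M \ {ctr G}) (Q := real M) Set.sdiff_subset) (Sm_sub _) hv
  exact ⟨a.trans b⟩

/-- an ambient neighbourhood of the open star -/
def ost {n : ℕ} (G : CubeFace n) : Set (Fin n → ℝ) :=
  {x | ∀ i, (G i ≠ some true → x i < 1) ∧ (G i ≠ some false → 0 < x i)}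

lemma ost_open {n : ℕ} (G : CubeFace n) : IsOpen (ost G) := by
  have : ost G = ⋂ i, ({x | G i ≠ some true → x i < 1} ∩ {x | G i ≠ some false → 0 < x i}) := by
    ext x; simp [ost]
  rw [this]
  refine isOpen_iInter_of_finite fun i => ?_
  have h1 : IsOpen {x : Fin n → ℝ | 0 < x i} := isOpen_lt (by fun_prop) (by fun_prop)
  have h2 : IsOpen {x : Fin n → ℝ | x i < 1} := isOpen_lt (by fun_prop) (by fun_prop)
  refine IsOpen.inter ?_ ?_
  · by_cases h : G i = some true
    · simp [h]
    · simpa [h] using h2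
  · by_cases h : G i = some false
    · simp [h]
    · simpa [h] using h1

lemma ctr_ost {n : ℕ} (G : CubeFace n) : ctr G ∈ ost G := by
  intro i
  unfold ctr
  rcases h : G i with _ | _ | _ <;> simp [h] <;> norm_num

lemma le_car {n : ℕ} {G : CubeFace n} {x : Fin n → ℝ} (hx : x ∈ ost G) : G ≤ car x := by
  intro i
  have := hx i
  unfold car
  split_ifs with h1 h2
  · right
    by_contra h
    have := this.2 h
    linarith
  · right
    by_contra h
    have := this.1 h
    linarith
  · left; rfl

lemma ctr_none {n : ℕ} {G : CubeFace n} {i} (h : G i = none) : ctr G i = 1/2 := by simp [ctr, h]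
lemma ctr_false {n : ℕ} {G : CubeFace n} {i} (h : G i = some false) : ctr G i = 0 := by simp [ctr, h]
lemma ctr_true {n : ℕ} {G : CubeFace n} {i} (h : G i = some true) : ctr G i = 1 := by simp [ctr, h]

lemma car_val {n : ℕ} {x : Fin n → ℝ} {i} {y : ℝ} (h : x i = y) :
    car x i = if y = 0 then some false else if y = 1 then some true else none := by subst h; rfl

lemma car_seg {n : ℕ} {G G' : CubeFace n} (h : G ≤ G') {t : ℝ} (h0 : 0 < t) (h1 : t < 1) :
    car (ctr G + t • (ctr G' - ctr G)) = G' := by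
  funext i
  have e : (ctr G + t • (ctr G' - ctr G)) i = ctr G i + t * (ctr G' i - ctr G i) := rfl
  rcases h i with h | h
  · rw [ctr_none h] at e
    have : 0 < ctr G i + t * (1/2 - ctr G i) ∧ ctr G i + t * (1/2 - ctr G i) < 1 := by
      rcases h2 : G i with _ | _ | _
      · rw [ctr_none h2]; norm_num
      · rw [ctr_false h2]; constructor <;> linarith
      · rw [ctr_true h2]; constructor <;> linarith
    rw [h, car_val e, if_neg this.1.ne', if_neg this.2.ne]
  · rcases h2 : G' i with _ | _ | _
    · rw [ctr_none h2, ctr_none (h.trans h2)] at e; rw [car_val e]; norm_num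
    · rw [ctr_false h2, ctr_false (h.trans h2)] at e; rw [car_val e]; norm_num
    · rw [ctr_true h2, ctr_true (h.trans h2)] at e; rw [car_val e]; norm_num

lemma con {n d : ℕ} {M : Set (CubeFace n)} (hM : Dn M)
    (hX : ChartedSpace (EuclideanSpace ℝ (Fin d)) ↥(real M)) {G G' : CubeFace n} (hG' : G' ∈ M) (hle : G ≤ G') (m : ℕ) :
    (Sg (Fin n → ℝ)).Van (A (M \ {F | G' ≤ F})) (A (M \ {F | G ≤ F})) m := by
  have hG : G ∈ M := hM _ hG' _ hle
  have hsub : M \ {F | G ≤ F} ⊆ M \ {F | G' ≤ F} := fun F hF => ⟨hF.1, fun h => hF.2 (hle.trans h)⟩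
  obtain ⟨Ω, ψ, hc, hψ, ⟨O, hO, hr⟩, hV, h, hp⟩ := chart_data hX (ctr_real hM hG) (ost_open G) (ctr_ost G)
  set W := ψ '' (Subtype.val ⁻¹' (ocube d)) with hW
  have hUo : IsOpen (Subtype.val ⁻¹' (ocube d) : Set Ω) := ocube_open.preimage continuous_subtype_val
  obtain ⟨O', hO', hU⟩ := hψ.isInducing.isOpen_iff.1 hUo
  have hWO : ∀ x ∈ real M, x ∈ O → x ∈ O' → x ∈ W := by
    intro x hx h1 h2
    have : x ∈ Set.range ψ := by rw [hr]; exact ⟨hx, h1⟩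
    obtain ⟨z, rfl⟩ := this
    exact ⟨z, by rw [← hU]; exact h2, rfl⟩
  have hpO : ctr G ∈ O := by
    have : ctr G ∈ Set.range ψ := ⟨_, hp⟩
    rw [hr] at this; exact this.2
  have hpO' : ctr G ∈ O' := by
    have : (⟨cc d, h⟩ : Ω) ∈ ψ ⁻¹' O' := by rw [hU]; exact cc_mem d
    rw [← hp]; exact this
  have hcont : Continuous (fun t : ℝ => ctr G + t • (ctr G' - ctr G)) := by fun_prop
  have hop : IsOpen ((fun t : ℝ => ctr G + t • (ctr G' - ctr G)) ⁻¹' (O ∩ O')) := (hO.inter hO').preimage hcont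
  obtain ⟨ε, hε, hball⟩ := Metric.isOpen_iff.1 hop 0 (by simpa using ⟨hpO, hpO'⟩)
  let t := min (ε / 2) (1 / 2)
  have ht0 : 0 < t := lt_min (by linarith) (by norm_num)
  have ht1 : t < 1 := (min_le_right _ _).trans_lt (by norm_num)
  have htε : t < ε := (min_le_left _ _).trans_lt (by linarith)
  set q := ctr G + t • (ctr G' - ctr G) with hq
  have hqO : q ∈ O ∩ O' := hball (by rw [Metric.mem_ball, dist_zero_right, Real.norm_of_nonneg ht0.le]; exact htε)
  have hcar : car q = G' := car_seg hle ht0 ht1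
  have hqc : q ∈ cube n := by
    have h1 := ctr_cube G; have h2 := ctr_cube G'
    intro i
    have h1 := h1 i; have h2 := h2 i
    simp only [hq, Pi.add_apply, Pi.smul_apply, Pi.sub_apply, smul_eq_mul]
    constructor <;> nlinarith
  have hqX : q ∈ real M := (mem_real hM).2 ⟨hqc, by rw [hcar]; exact hG'⟩
  obtain ⟨z, hz, hzq⟩ := hWO q hqX hqO.1 hqO.2
  have hpW : ctr G ∈ W := ⟨⟨cc d, h⟩, cc_mem d, hp⟩
  have hqW : q ∈ W := ⟨z, hz, hzq⟩
  have v1 := van_W ψ hc hψ hO hr (z := ⟨cc d, h⟩) (cc_mem d)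
  have v2 := van_W ψ hc hψ hO hr hz
  rw [hp] at v1
  rw [hzq] at v2
  have v3 := van_rad hM (ctr_cube G)
  have v4 := van_rad hM hqc
  have s3 := real_st_sub hM (p := ctr G)
  have s4 := real_st_sub hM (p := q)
  rw [car_ctr] at v3 s3
  rw [hcar] at v4 s4
  have sW : real (M \ {F | G ≤ F}) ⊆ real M \ W := by
    intro x hx
    have h := (mem_real (Dn_st hM _)).1 hx
    refine ⟨real_mono Set.sdiff_subset hx, ?_⟩
    rintro ⟨w, hw, rfl⟩
    exact h.2.2 (le_car (hV ⟨w, rfl⟩))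
  have v5 : ∀ m, (Sg (Fin n → ℝ)).Van (Sm {real M \ W}) (Sm {real (M \ {F | G ≤ F})}) m := fun m =>
    van_RQ (C := Sg (Fin n → ℝ)) (P := Sm {real M \ {ctr G}})
      (Sm_mono_set (Set.sdiff_subset_sdiff_right (by simpa using hpW))) (Sm_mono_set sW) v3 v1
  have v6 : ∀ m, (Sg (Fin n → ℝ)).Van (Sm {real M \ {q}}) (Sm {real (M \ {F | G ≤ F})}) m := fun m =>
    van_PQ (C := Sg (Fin n → ℝ)) (R := Sm {real M \ W})
      (Sm_mono_set (Set.sdiff_subset_sdiff_right (by simpa using hqW))) (v2 m) (v5 m) (Sm_mono_set sW)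
  have v7 : ∀ m, (Sg (Fin n → ℝ)).Van (Sm {real (M \ {F | G' ≤ F})}) (Sm {real (M \ {F | G ≤ F})}) m := fun m =>
    van_RQ (C := Sg (Fin n → ℝ)) (P := Sm {real M \ {q}}) (Sm_mono_set s4) (Sm_mono_set (real_mono hsub)) v6 v4
  exact van_congr (iso_real (Dn_st hM _) (Dn_st hM _) hsub m) (v7 m)
end DH

set_option linter.unusedSectionVars false
set_option linter.unusedVariables false
set_option linter.unusedSimpArgs false
namespace DH
open CubeFace

/-- up-closed -/
def Up {n : ℕ} (N : Set (CubeFace n)) : Prop := ∀ F ∈ N, ∀ G : CubeFace n, F ≤ G → G ∈ N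

/-- faces meeting `F` and free along `B` -/
def NN {n : ℕ} (F : CubeFace n) (B : Finset (Fin n)) : Set (CubeFace n) :=
  {H | (∀ i, H i = none ∨ F i = none ∨ H i = F i) ∧ ∀ i ∈ B, H i = none}

lemma NN_up {n : ℕ} (F : CubeFace n) (B : Finset (Fin n)) : Up (NN F B) := by
  intro H hH H' hle
  refine ⟨fun i => ?_, fun i hi => ?_⟩
  · rcases hle i with h | h
    · exact Or.inl h
    · rw [← h]; exact hH.1 i
  · rcases hle i with h | h
    · exact h
    · rw [← h]; exact hH.2 i hi

lemma NN_fr {n : ℕ} (F : CubeFace n) : NN F (fr F) = {H | F ≤ H} := by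
  ext H
  constructor
  · intro h i
    rcases h.1 i with h1 | h1 | h1
    · exact Or.inl h1
    · exact Or.inl (h.2 i (mem_fr.2 h1))
    · exact Or.inr h1.symm
  · intro h
    refine ⟨fun i => ?_, fun i hi => ?_⟩
    · rcases h i with h1 | h1
      · exact Or.inl h1
      · exact Or.inr (Or.inr h1.symm)
    · rcases h i with h1 | h1
      · exact h1
      · rw [← h1]; exact mem_fr.1 hi

lemma NN_anti {n : ℕ} (F : CubeFace n) {B B' : Finset (Fin n)} (h : B ⊆ B') : NN F B' ⊆ NN F B :=
  fun H hH => ⟨hH.1, fun i hi => hH.2 i (h hi)⟩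

lemma NN_setc_sub {n : ℕ} {F : CubeFace n} {i : Fin n} (hi : F i = none) (b : Bool) (B : Finset (Fin n)) :
    NN (setc F i (some b)) B ⊆ NN F B := by
  intro H hH
  refine ⟨fun j => ?_, hH.2⟩
  by_cases hj : j = i
  · subst hj; exact Or.inr (Or.inl hi)
  · have := hH.1 j
    rwa [setc_ne F _ hj] at this

lemma NN_insert_sub {n : ℕ} {F : CubeFace n} {i : Fin n} (b : Bool) (B : Finset (Fin n)) :
    NN F (insert i B) ⊆ NN (setc F i (some b)) B := by
  intro H hH
  refine ⟨fun j => ?_, fun j hj => hH.2 j (Finset.mem_insert_of_mem hj)⟩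
  by_cases hj : j = i
  · subst hj; exact Or.inl (hH.2 j (Finset.mem_insert_self _ _))
  · rw [setc_ne F _ hj]; exact hH.1 j

lemma NN_union {n : ℕ} {F : CubeFace n} {i : Fin n} (hi : F i = none) (B : Finset (Fin n)) :
    NN (setc F i (some true)) B ∪ NN (setc F i (some false)) B = NN F B := by
  apply Set.Subset.antisymm
  · exact Set.union_subset (NN_setc_sub hi _ _) (NN_setc_sub hi _ _)
  · intro H hH
    have key : ∀ b, (H i = none ∨ H i = some b) → H ∈ NN (setc F i (some b)) B := by
      intro b hb
      refine ⟨fun j => ?_, hH.2⟩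
      by_cases hj : j = i
      · subst hj; rw [setc_same]; tauto
      · rw [setc_ne F _ hj]; exact hH.1 j
    rcases h : H i with _ | _ | _
    · exact Or.inl (key _ (Or.inl h))
    · exact Or.inr (key _ (Or.inr h))
    · exact Or.inl (key _ (Or.inr h))

lemma NN_inter {n : ℕ} {F : CubeFace n} {i : Fin n} (hi : F i = none) (B : Finset (Fin n)) :
    NN (setc F i (some true)) B ∩ NN (setc F i (some false)) B = NN F (insert i B) := by
  apply Set.Subset.antisymm
  · rintro H ⟨h1, h2⟩
    have h3 := NN_setc_sub hi _ _ h1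
    refine ⟨h3.1, fun j hj => ?_⟩
    rcases Finset.mem_insert.1 hj with rfl | hj
    · have h1 := h1.1 j
      have h2 := h2.1 j
      rw [setc_same] at h1 h2
      rcases h1 with h1 | h1 | h1
      · exact h1
      · simp at h1
      · rw [h1] at h2; simp at h2
    · exact h3.2 j hj
  · exact Set.subset_inter (NN_insert_sub _ _) (NN_insert_sub _ _)

section
variable {n d : ℕ} (M : Set (CubeFace n)) (hM : Dn M)

include hM in
lemma Dn_up {N : Set (CubeFace n)} (hN : Up N) : Dn (M \ N) :=
  fun F hF G hG => ⟨hM F hF.1 G hG, fun h => hF.2 (hN G h F hG)⟩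

/-- chains off `N` -/
noncomputable def QQ (N : Set (CubeFace n)) := A (M \ N)

lemma QQ_mono {N N' : Set (CubeFace n)} (h : N' ⊆ N) : QQ M N ≤ QQ M N' := A_mono (Set.sdiff_subset_sdiff_right h)

/-- acyclicity of a pair -/
def ac (N N' : Set (CubeFace n)) : Prop := ∀ m, (Sg (Fin n → ℝ)).Van (QQ M N') (QQ M N) m

variable {M}
variable {N1 N2 N3 : Set (CubeFace n)} (h12 : N2 ⊆ N1) (h23 : N3 ⊆ N2)

include h12 h23

lemma ac_13 (h : ac M N1 N2) (h' : ac M N2 N3) : ac M N1 N3 := fun m =>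
  van_PQ (QQ_mono M h23) (h' m) (h m) (QQ_mono M h12)

lemma ac_12 (h : ac M N1 N3) (h' : ac M N2 N3) : ac M N1 N2 := fun m =>
  van_RQ (QQ_mono M h23) (QQ_mono M h12) h h'

lemma ac_23 (h : ac M N1 N3) (h' : ac M N1 N2) : ac M N2 N3 := fun m =>
  van_PR (QQ_mono M h23) (QQ_mono M h12) (A_sub _) h h'

omit h12 h23
include hM

lemma QQ_exc (h1 : Up N1) (h2 : Up N2) (m : ℕ) :
    Nonempty ((Sg (Fin n → ℝ)).H (QQ M N2) (QQ M (N1 ∪ N2)) m ≃ₗ[F2] (Sg (Fin n → ℝ)).H (QQ M (N1 ∩ N2)) (QQ M N1) m) := by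
  have := A_exc (Dn_up M hM h2) (Dn_up M hM h1) m
  rw [← Set.sdiff_inter, Set.inter_comm N2 N1] at this
  have e : (M \ N2) ∩ (M \ N1) = M \ (N1 ∪ N2) := by
    ext x; simp only [Set.mem_inter_iff, Set.mem_sdiff, Set.mem_union]; tauto
  rw [e] at this
  exact this

lemma NN_exc {F : CubeFace n} {i : Fin n} (hi : F i = none) (B : Finset (Fin n)) (m : ℕ) :
    Nonempty ((Sg (Fin n → ℝ)).H (QQ M (NN (setc F i (some false)) B)) (QQ M (NN F B)) m ≃ₗ[F2]
      (Sg (Fin n → ℝ)).H (QQ M (NN F (insert i B))) (QQ M (NN (setc F i (some true)) B)) m) := by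
  have := QQ_exc hM (NN_up (setc F i (some true)) B) (NN_up (setc F i (some false)) B) m
  rwa [NN_union hi, NN_inter hi] at this

variable (hX : ChartedSpace (EuclideanSpace ℝ (Fin d)) ↥(real M))

include hX

lemma ac_star {G G' : CubeFace n} (hG' : G' ∈ M) (hle : G ≤ G') : ac M {F | G ≤ F} {F | G' ≤ F} :=
  fun m => con hM hX hG' hle m

lemma fr_setc {F : CubeFace n} {i : Fin n} (b : Bool) : fr (setc F i (some b)) = (fr F).erase i := by
  ext j
  rw [Finset.mem_erase, mem_fr, mem_fr]
  by_cases hj : j = i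
  · subst hj; simp [setc_same]
  · rw [setc_ne F _ hj]; simp [hj]

lemma star_anti {G G' : CubeFace n} (h : G ≤ G') : {F | G' ≤ F} ⊆ {F | G ≤ F} := fun F hF => le_trans h hF

lemma ac_NN (r : ℕ) : ∀ (F : CubeFace n) (B : Finset (Fin n)), F ∈ M → B ⊆ fr F → (fr F \ B).card = r →
    ac M (NN F B) {H | F ≤ H} := by
  induction r with
  | zero =>
    intro F B hF hB hr
    have : B = fr F := Finset.Subset.antisymm hB (Finset.sdiff_eq_empty_iff_subset.1 (Finset.card_eq_zero.1 hr))
    rw [this, NN_fr]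
    exact ac_star hM hX hF le_rfl
  | succ r ih =>
    intro F B hF hB hr
    obtain ⟨i, hi⟩ : (fr F \ B).Nonempty := Finset.card_pos.1 (by omega)
    rw [Finset.mem_sdiff] at hi
    have hi0 : F i = none := mem_fr.1 hi.1
    have hFb : ∀ b, setc F i (some b) ∈ M := fun b => hM F hF _ (setc_le F _ hi0)
    have hBi : insert i B ⊆ fr F := Finset.insert_subset hi.1 hB
    have hle : ∀ b, setc F i (some b) ≤ F := fun b => setc_le F _ hi0
    have a1 : ac M (NN F (insert i B)) {H | F ≤ H} := by
      refine ih F _ hF hBi ?_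
      have : fr F \ insert i B = (fr F \ B).erase i := by
        ext j; simp only [Finset.mem_sdiff, Finset.mem_insert, Finset.mem_erase]; tauto
      rw [this, Finset.card_erase_of_mem (Finset.mem_sdiff.2 hi), hr]; rfl
    have s0 : ∀ b, {H | setc F i (some b) ≤ H} ⊆ NN (setc F i (some b)) B := by
      intro b
      rw [← NN_fr]
      refine NN_anti _ ?_
      rw [fr_setc hM hX]
      intro j hj
      refine Finset.mem_erase.2 ⟨?_, hB hj⟩
      rintro rfl; exact hi.2 hj
    have a2 : ∀ b, ac M (NN (setc F i (some b)) B) {H | F ≤ H} := by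
      intro b
      refine ac_13 (s0 b) (star_anti hM hX (hle b)) ?_ (ac_star hM hX hF (hle b))
      refine ih _ _ (hFb b) ?_ ?_
      · rw [fr_setc hM hX]
        intro j hj
        refine Finset.mem_erase.2 ⟨?_, hB hj⟩
        rintro rfl; exact hi.2 hj
      · have : fr (setc F i (some b)) \ B = (fr F \ B).erase i := by
          rw [fr_setc hM hX]
          ext j; simp only [Finset.mem_sdiff, Finset.mem_insert, Finset.mem_erase]; tauto
        rw [this, Finset.card_erase_of_mem (Finset.mem_sdiff.2 hi), hr]; rfl
    have s1 : {H | F ≤ H} ⊆ NN F (insert i B) := by rw [← NN_fr]; exact NN_anti _ hBi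
    have a3 : ac M (NN (setc F i (some true)) B) (NN F (insert i B)) :=
      ac_12 (NN_insert_sub _ _) s1 (a2 true) a1
    have a4 : ac M (NN F B) (NN (setc F i (some false)) B) := fun m =>
      van_congr (NN_exc hM hi0 B m) (a3 m)
    exact ac_13 (NN_setc_sub hi0 _ _) (s1.trans (NN_insert_sub _ _)) a4 (a2 false)

lemma ac_NN' {F : CubeFace n} {B : Finset (Fin n)} (hF : F ∈ M) (hB : B ⊆ fr F) : ac M (NN F B) {H | F ≤ H} :=
  ac_NN hM hX _ F B hF hB rfl

lemma HD_E {F : CubeFace n} (hF : F ∉ M) (hbF : bdryHat F ⊆ M) (r : ℕ) : ∀ (B : Finset (Fin n)) (i : Fin n) (e : ℕ),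
    B ⊆ fr F → i ∈ fr F → i ∉ B → (fr F \ B).card = r + 1 → e + r = d →
    HD (Sg (Fin n → ℝ)) (QQ M (NN F (insert i B))) (QQ M (NN (setc F i (some true)) B)) e := by
  have hs : ∀ i ∈ fr F, ∀ b, setc F i (some b) ∈ M := by
    intro i hi b
    refine hbF ⟨setc_le F _ (mem_fr.1 hi), ?_⟩
    intro h
    have h' := congrFun h i
    rw [setc_same, mem_fr.1 hi] at h'
    simp at h'
  induction r with
  | zero =>
    intro B i e hB hi hiB hr he
    obtain rfl : e = d := by omega
    have e1 : insert i B = fr F := by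
      refine Finset.eq_of_subset_of_card_le (Finset.insert_subset hi hB) ?_
      rw [Finset.card_insert_of_notMem hiB]
      rw [Finset.card_sdiff_of_subset hB] at hr
      omega
    have e2 : B = fr (setc F i (some true)) := by
      rw [fr_setc hM hX, ← e1, Finset.erase_insert hiB]
    have e3 : QQ M (NN F (insert i B)) = A M := by
      rw [e1, NN_fr, QQ]
      congr 1
      ext G
      exact ⟨fun h => h.1, fun h => ⟨h, fun h' => hF (hM G h F h')⟩⟩
    have e4 : NN (setc F i (some true)) B = {H | setc F i (some true) ≤ H} := by
      rw [← NN_fr, ← e2]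
    rw [e3, e4]
    exact loc hM hX (hs i hi true)
  | succ r ih =>
    intro B i e hB hi hiB hr he
    have hcard : (fr F \ insert i B).card = r + 1 := by
      have : fr F \ insert i B = (fr F \ B).erase i := by
        ext j; simp only [Finset.mem_sdiff, Finset.mem_insert, Finset.mem_erase]; tauto
      rw [this, Finset.card_erase_of_mem (Finset.mem_sdiff.2 ⟨hi, hiB⟩), hr]; rfl
    obtain ⟨j, hj⟩ : (fr F \ insert i B).Nonempty := Finset.card_pos.1 (by omega)
    rw [Finset.mem_sdiff, Finset.mem_insert, not_or] at hj
    obtain ⟨hj, hji, hjB⟩ := hj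
    have hi0 := mem_fr.1 hi
    have hj0 := mem_fr.1 hj
    have IH := ih (insert i B) j (e+1) (Finset.insert_subset hi hB) hj (by simp [hji, hjB]) hcard (by omega)
    have hV : HD (Sg (Fin n → ℝ)) (QQ M (NN (setc F j (some false)) (insert i B))) (QQ M (NN F (insert i B))) (e+1) :=
      HD_congr (fun m => NN_exc hM hj0 _ m) IH
    set Fi := setc F i (some true) with hFi
    set Fj := setc F j (some false) with hFj
    set F2 := setc Fi j (some false) with hF2
    have hFiM : Fi ∈ M := hs i hi _
    have hFjM : Fj ∈ M := hs j hj _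
    have hij : Fi j = none := by rw [hFi, setc_ne F _ hji]; exact hj0
    have h2i : F2 ≤ Fi := setc_le Fi _ hij
    have h2j : F2 ≤ Fj := by
      intro l
      by_cases hl : l = j
      · subst hl; right; rw [hF2, hFj, setc_same, setc_same]
      · by_cases hl' : l = i
        · subst hl'; left; rw [hFj, setc_ne F _ hl]; exact hi0
        · right; rw [hF2, hFj, hFi, setc_ne _ _ hl, setc_ne _ _ hl, setc_ne _ _ hl']
    have b1 : B ⊆ fr Fi := by
      rw [hFi, fr_setc hM hX]
      intro l hl
      refine Finset.mem_erase.2 ⟨?_, hB hl⟩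
      rintro rfl; exact hiB hl
    have b2 : B ⊆ fr F2 := by
      rw [hF2, fr_setc hM hX]
      intro l hl
      refine Finset.mem_erase.2 ⟨?_, b1 hl⟩
      rintro rfl; exact hjB hl
    have b3 : insert i B ⊆ fr Fj := by
      rw [hFj, fr_setc hM hX]
      intro l hl
      refine Finset.mem_erase.2 ⟨?_, Finset.insert_subset hi hB hl⟩
      rintro rfl
      rcases Finset.mem_insert.1 hl with h | h
      · exact hji h
      · exact hjB h
    have s1 : {H | F2 ≤ H} ⊆ NN Fi B := by
      have : NN F2 B ⊆ NN Fi B := NN_setc_sub hij _ _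
      refine Set.Subset.trans ?_ this
      rw [← NN_fr]; exact NN_anti _ b2
    have s2 : {H | Fj ≤ H} ⊆ NN Fj (insert i B) := by rw [← NN_fr]; exact NN_anti _ b3
    have s3 : NN Fj (insert i B) ⊆ NN F (insert i B) := NN_setc_sub hj0 _ _
    have s4 : NN F (insert i B) ⊆ NN Fi B := NN_insert_sub _ _
    have a1 : ac M (NN Fi B) {H | F2 ≤ H} :=
      ac_12 s1 (star_anti hM hX h2i) (ac_NN' hM hX hFiM b1) (ac_star hM hX hFiM h2i)
    have a2 : ac M (NN Fi B) {H | Fj ≤ H} :=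
      ac_13 s1 (star_anti hM hX h2j) a1 (ac_star hM hX hFjM h2j)
    have a3 : ac M (NN Fi B) (NN Fj (insert i B)) :=
      ac_12 (s3.trans s4) s2 a2 (ac_NN' hM hX hFjM b3)
    exact HD_pred (fun m => iso_PR_RQ (C := Sg (Fin n → ℝ)) (QQ_mono M s4) (QQ_mono M s3) (A_sub _) a3) hV

lemma HD_top {F : CubeFace n} (hF : F ∈ M) : HD (Sg (Fin n → ℝ)) (A M) (QQ M (NN F ∅)) d := by
  refine HD_congr (fun m => ?_) (loc hM hX hF)
  have s : {H | F ≤ H} ⊆ NN F ∅ := by rw [← NN_fr]; exact NN_anti _ (Finset.empty_subset _)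
  exact iso_PQ_PR (C := Sg (Fin n → ℝ)) (QQ_mono M s) (A_mono Set.sdiff_subset) (A_sub _)
    (ac_NN' hM hX hF (Finset.empty_subset _))
end
end DH

set_option linter.unusedSectionVars false
set_option linter.unusedVariables false
set_option linter.unusedSimpArgs false
namespace DH
open CubeFace

lemma main_face {n d k : ℕ} {M : Set (CubeFace n)} (hM : Dn M)
    (hX : ChartedSpace (EuclideanSpace ℝ (Fin d)) ↥(real M)) {F : CubeFace n} (hF : F ∉ M) (hbF : bdryHat F ⊆ M)
    (hdF : dim F = k + 1) (hk : 2 ≤ k) (hkd : k ≤ d) :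
    (∀ j : ℕ, j + 2 ≤ d → j ≠ d - k → j ≠ d - k - 1 →
      Nonempty ((Sg (Fin n → ℝ)).H (A (M \ NN F ∅)) ⊥ j ≃ₗ[F2] (Sg (Fin n → ℝ)).H (A M) ⊥ j)) ∧
    ∃ j : ℕ, (j = d - k ∨ j = d - k - 1) ∧
      ¬ Nonempty ((Sg (Fin n → ℝ)).H (A (M \ NN F ∅)) ⊥ j ≃ₗ[F2] (Sg (Fin n → ℝ)).H (A M) ⊥ j) := by
  have hcard : (fr F).card = k + 1 := by rw [← dim_eq, hdF]
  obtain ⟨i, hi⟩ : (fr F).Nonempty := Finset.card_pos.1 (by omega)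
  have hi0 := mem_fr.1 hi
  have hFi : setc F i (some false) ∈ M := by
    refine hbF ⟨setc_le F _ hi0, ?_⟩
    intro h
    have h' := congrFun h i
    rw [setc_same, hi0] at h'
    simp at h'
  set K1 := M \ NN (setc F i (some false)) ∅ with hK1
  set K0 := M \ NN F ∅ with hK0
  have hD1 : Dn K1 := Dn_up M hM (NN_up _ _)
  have hD0 : Dn K0 := Dn_up M hM (NN_up _ _)
  have hs1 : A K1 ≤ A M := A_mono Set.sdiff_subset
  have hs0 : A K0 ≤ A K1 := A_mono (Set.sdiff_subset_sdiff_right (NN_setc_sub hi0 _ _))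
  have ha : HD (Sg (Fin n → ℝ)) (A M) (A K1) d := HD_top hM hX hFi
  have hb : HD (Sg (Fin n → ℝ)) (A K1) (A K0) (d - k) :=
    HD_congr (fun m => NN_exc hM hi0 ∅ m)
      (HD_E hM hX hF hbF k ∅ i (d-k) (Finset.empty_subset _) hi (Finset.notMem_empty _)
        (by rw [Finset.sdiff_empty]; exact hcard) (by omega))
  have iso1 : ∀ j, j + 2 ≤ d → Nonempty ((Sg (Fin n → ℝ)).H (A K1) ⊥ j ≃ₗ[F2] (Sg (Fin n → ℝ)).H (A M) ⊥ j) :=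
    fun j hj => iso_RQ_PQ (C := Sg (Fin n → ℝ)) bot_le hs1 ((ha j).1.2 (by omega)) ((ha (j+1)).1.2 (by omega))
  refine ⟨fun j hj h1 h2 => ?_, ?_⟩
  · obtain ⟨e⟩ := iso1 j hj
    obtain ⟨f⟩ := iso_RQ_PQ (C := Sg (Fin n → ℝ)) (m := j) (Q := ⊥) bot_le hs0 ((hb j).1.2 h1) ((hb (j+1)).1.2 (by omega))
    exact ⟨f.trans e⟩
  · by_contra hcon
    push Not at hcon
    have key : ∀ j, (j = d - k ∨ j = d - k - 1) →
        Module.finrank F2 ((Sg (Fin n → ℝ)).H (A K0) ⊥ j) = Module.finrank F2 ((Sg (Fin n → ℝ)).H (A K1) ⊥ j) := by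
      intro j hj
      obtain ⟨e⟩ := iso1 j (by omega)
      obtain ⟨f⟩ := hcon j hj
      exact (f.trans e.symm).finrank_eq
    refine (hb (d-k)).1.1 ?_ rfl
    haveI := fun j => finite_A hD0 j
    haveI := fun j => finite_A hD1 j
    refine van_PR_of (Q := ⊥) hs0 bot_le (A_sub _) ?_ ?_
    · rw [← LinearMap.injective_iff_surjective_of_finrank_eq_finrank (key _ (Or.inl rfl))]
      exact incl_inj bot_le hs0 ((hb _).1.2 (by omega))
    · intro l hl
      rw [LinearMap.injective_iff_surjective_of_finrank_eq_finrank (key _ (Or.inr (by omega)))]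
      exact incl_surj bot_le hs0 ((hb _).1.2 (by omega))

lemma link_real {n : ℕ} {K : Set (CubeFace n)} (hK : Dn K) (j : ℕ) :
    Nonempty (sHomology (ZMod 2) (↥(real K)) j ≃ₗ[F2] (Sg (Fin n → ℝ)).H (A K) ⊥ j) := by
  obtain ⟨a⟩ := link (↥(real K)) j
  obtain ⟨b⟩ := emb_iso_set ⟨Subtype.val, continuous_subtype_val⟩
    (Topology.IsEmbedding.subtypeVal (p := (· ∈ real K))) Set.univ ∅ j
  obtain ⟨c⟩ := iso_real hK (K' := ∅) (fun _ h => h.elim) (Set.empty_subset _) j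
  have e1 : (⟨Subtype.val, continuous_subtype_val⟩ : C(real K, Fin n → ℝ)) '' Set.univ = real K := by simp
  have e2 : real (∅ : Set (CubeFace n)) = ∅ := by simp [real_eq]
  rw [e1, Set.image_empty, Sm_univ, Sm_singleton_empty, Sm_singleton_empty] at b
  rw [e2, Sm_singleton_empty, A_empty] at c
  exact ⟨(a.trans b).trans c.symm⟩

lemma nonempty_iso {n : ℕ} {K L : Set (CubeFace n)} (hK : Dn K) (hL : Dn L) (j : ℕ) :
    Nonempty (CategoryTheory.Iso (sHomology (ZMod 2) (↥(real K)) j) (sHomology (ZMod 2) (↥(real L)) j)) ↔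
    Nonempty ((Sg (Fin n → ℝ)).H (A K) ⊥ j ≃ₗ[F2] (Sg (Fin n → ℝ)).H (A L) ⊥ j) := by
  obtain ⟨a⟩ := link_real hK j
  obtain ⟨b⟩ := link_real hL j
  constructor
  · rintro ⟨e⟩
    exact ⟨(a.symm.trans e.toLinearEquiv).trans b⟩
  · rintro ⟨e⟩
    exact ⟨((a.trans e).trans b.symm).toModuleIso⟩
end DH

set_option linter.unusedSectionVars false
set_option linter.unusedVariables false
set_option linter.unusedSimpArgs false
namespace DH
open CubeFace

/-- flip a coordinate -/
def flp {m : ℕ} (v : Fin m → Bool) (i : Fin m) : Fin m → Bool := Function.update v i (!v i)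

lemma flp_same {m : ℕ} (v : Fin m → Bool) (i : Fin m) : flp v i i = !v i := by simp [flp]
lemma flp_ne {m : ℕ} (v : Fin m → Bool) {i j : Fin m} (h : j ≠ i) : flp v i j = v j := by simp [flp, h]
lemma flp_flp {m : ℕ} (v : Fin m → Bool) (i : Fin m) : flp (flp v i) i = v := by
  funext j
  by_cases h : j = i
  · subst h; simp [flp_same]
  · simp [flp_ne _ h]
lemma flp_ne_self {m : ℕ} (v : Fin m → Bool) (i : Fin m) : flp v i ≠ v := by
  intro h
  have := congrFun h i
  rw [flp_same] at this
  simp at this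
lemma flp_inj {m : ℕ} {v : Fin m → Bool} {i j : Fin m} (h : flp v i = flp v j) : i = j := by
  by_contra hne
  have := congrFun h i
  rw [flp_same, flp_ne _ hne] at this
  simp at this

lemma flp_ind {m : ℕ} (v0 : Fin m → Bool) (P : (Fin m → Bool) → Prop) (h0 : P v0)
    (h : ∀ v i, P v → P (flp v i)) (v : Fin m → Bool) : P v := by
  have key : ∀ s : Finset (Fin m), ∀ v, (∀ i, i ∉ s → v i = v0 i) → P v := by
    intro s
    induction s using Finset.induction_on with
    | empty =>
      intro v hv
      have : v = v0 := funext fun i => hv i (Finset.notMem_empty i)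
      rw [this]; exact h0
    | insert a s ha ih =>
      intro v hv
      have hw : P (Function.update v a (v0 a)) := by
        apply ih
        intro i hi
        by_cases hia : i = a
        · subst hia; simp
        · simp only [Function.update_of_ne hia]
          exact hv i (by simp [hia, hi])
      by_cases hva : v a = v0 a
      · rwa [← hva, Function.update_eq_self] at hw
      · have := h _ a hw
        have e : flp (Function.update v a (v0 a)) a = v := by
          funext j
          by_cases hj : j = a
          · subst hj; rw [flp_same]; simp only [Function.update_self]
            revert hva
            cases v j <;> cases v0 j <;> simp
          · rw [flp_ne _ hj, Function.update_of_ne hj]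
        rwa [e] at this
  exact key Finset.univ v fun i hi => absurd (Finset.mem_univ i) hi

lemma mem_verts {n : ℕ} {F : CubeFace n} {v : Fin n → Bool} : v ∈ verts F ↔ ∀ i, F i = none ∨ some (v i) = F i := Iff.rfl

lemma le_of_verts {n : ℕ} {F G : CubeFace n} (h : verts F ⊆ verts G) : F ≤ G := by
  intro i
  rcases hG : G i with _ | b
  · exact Or.inl rfl
  · right
    have hw : (fun j => (F j).getD (!b)) ∈ verts F := by
      intro j
      rcases hj : F j with _ | c
      · exact Or.inl rfl
      · right; simp [toFace, hj]
    have := (mem_verts.1 (h hw)) i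
    rw [hG] at this
    rcases hF : F i with _ | c
    · rw [hF] at this; simp at this
    · rw [hF] at this; simpa using this

lemma verts_mono {n : ℕ} {F G : CubeFace n} (h : F ≤ G) : verts F ⊆ verts G := fun v hv => le_trans (a := toFace v) hv h

lemma verts_inj {n : ℕ} {F G : CubeFace n} (h : verts F = verts G) : F = G :=
  le_antisymm (le_of_verts h.le) (le_of_verts h.ge)

lemma meet_iff {n : ℕ} {H F : CubeFace n} : (verts H ∩ verts F).Nonempty ↔ H ∈ NN F ∅ := by
  constructor
  · rintro ⟨v, h1, h2⟩
    refine ⟨fun i => ?_, fun i hi => absurd hi (Finset.notMem_empty i)⟩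
    rcases mem_verts.1 h1 i with h | h
    · exact Or.inl h
    · rcases mem_verts.1 h2 i with h' | h'
      · exact Or.inr (Or.inl h')
      · exact Or.inr (Or.inr (h.symm.trans h'))
  · intro h
    refine ⟨fun i => (H i).getD ((F i).getD false), fun i => ?_, fun i => ?_⟩
    · rcases hH : H i with _ | b
      · exact Or.inl rfl
      · right; simp [toFace, hH]
    · rcases hF : F i with _ | b
      · exact Or.inl rfl
      · right
        rcases h.1 i with h1 | h1 | h1
        · simp [toFace, h1, hF]
        · rw [hF] at h1; simp at h1
        · simp [toFace, h1, hF]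

lemma free_of_flp {n : ℕ} {F : CubeFace n} {v : Fin n → Bool} {i : Fin n} (h1 : v ∈ verts F) (h2 : flp v i ∈ verts F) : F i = none := by
  rcases mem_verts.1 h1 i with h | h
  · exact h
  · rcases mem_verts.1 h2 i with h' | h'
    · exact h'
    · rw [flp_same, ← h] at h'; simp at h'

lemma flp_mem {n : ℕ} {F : CubeFace n} {v : Fin n → Bool} {i : Fin n} (h1 : v ∈ verts F) (h : F i = none) : flp v i ∈ verts F := by
  rw [mem_verts] at *
  intro j
  by_cases hj : j = i
  · subst hj; exact Or.inl h
  · rw [flp_ne _ hj]; exact h1 j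

/-- the face through `v` with free coordinates `i,j` -/
def sq {m : ℕ} (v : Fin m → Bool) (i j : Fin m) : CubeFace m := fun l => if l = i ∨ l = j then none else some (v l)

lemma mem_sq {m : ℕ} {v w : Fin m → Bool} {i j : Fin m} :
    w ∈ verts (sq v i j) ↔ ∀ l, l ≠ i → l ≠ j → w l = v l := by
  rw [mem_verts]
  refine forall_congr' fun l => ?_
  unfold sq
  by_cases h1 : l = i
  · simp [h1]
  · by_cases h2 : l = j
    · simp [h2]
    · simp [h1, h2]

lemma sq_cases {m : ℕ} {v w : Fin m → Bool} {i j : Fin m} (h : w ∈ verts (sq v i j)) :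
    w = v ∨ w = flp v i ∨ w = flp v j ∨ w = flp (flp v i) j := by
  rw [mem_sq] at h
  have key : ∀ x y : Bool, x ≠ y → x = !y := by decide
  by_cases hij : i = j
  · subst hij
    by_cases hi : w i = v i
    · left; funext l
      by_cases h1 : l = i
      · rw [h1, hi]
      · exact h l h1 h1
    · right; left; funext l
      by_cases h1 : l = i
      · rw [h1, flp_same]; exact key _ _ hi
      · rw [flp_ne _ h1]; exact h l h1 h1
  by_cases hi : w i = v i <;> by_cases hj : w j = v j
  · left; funext l
    by_cases h1 : l = i
    · rw [h1, hi]
    · by_cases h2 : l = j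
      · rw [h2, hj]
      · exact h l h1 h2
  · right; right; left; funext l
    by_cases h2 : l = j
    · rw [h2, flp_same]; exact key _ _ hj
    · rw [flp_ne _ h2]
      by_cases h1 : l = i
      · rw [h1, hi]
      · exact h l h1 h2
  · right; left; funext l
    by_cases h1 : l = i
    · rw [h1, flp_same]; exact key _ _ hi
    · rw [flp_ne _ h1]
      by_cases h2 : l = j
      · rw [h2, hj]
      · exact h l h1 h2
  · right; right; right; funext l
    by_cases h2 : l = j
    · rw [h2, flp_same, flp_ne _ (Ne.symm hij)]; exact key _ _ hj
    · rw [flp_ne _ h2]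
      by_cases h1 : l = i
      · rw [h1, flp_same]; exact key _ _ hi
      · rw [flp_ne _ h1]; exact h l h1 h2

lemma iso_face {n k : ℕ} (hk : 2 ≤ k) {S : Set (CubeFace n)} (hS : Dn S)
    (hiso : CubeFace.Iso S (boundaryCube (k + 1))) :
    ∃ F : CubeFace n, dim F = k + 1 ∧ S = bdryHat F ∧ cvert S = verts F := by
  obtain ⟨f, hf, hfW⟩ := hiso
  have huniv : cvert (boundaryCube (k+1)) = Set.univ := by
    ext v
    simp only [Set.mem_univ, iff_true]
    intro h
    have := congrFun h (0 : Fin (k+1))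
    simp [toFace] at this
  rw [huniv] at hf
  have hsur : ∀ v, ∃ w, w ∈ cvert S ∧ f w = v := fun v => hf.surjOn (Set.mem_univ v)
  choose g hgS hfg using hsur
  have hgf : ∀ w ∈ cvert S, g (f w) = w := fun w hw => hf.injOn (hgS _) hw (hfg _)
  have hginj : Function.Injective g := fun a b h => by rw [← hfg a, h, hfg]
  have hran : cvert S = Set.range g := by
    ext w
    constructor
    · intro hw; exact ⟨f w, hgf w hw⟩
    · rintro ⟨v, rfl⟩; exact hgS v
  have hup : ∀ G : CubeFace (k+1), (∃ i, G i ≠ none) → ∃ F ∈ S, verts F = g '' verts G := by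
    rintro G ⟨i, hi⟩
    refine (hfW (g '' verts G) ?_).2 ⟨G, ?_, ?_⟩
    · rintro _ ⟨v, -, rfl⟩; exact hgS v
    · intro h; rw [h] at hi; exact hi rfl
    · rw [Set.image_image]; simp [hfg]
  have hsubS : ∀ F ∈ S, verts F ⊆ cvert S := fun F hF v hv => hS F hF _ hv
  have hdown : ∀ F ∈ S, ∃ G : CubeFace (k+1), (∃ i, G i ≠ none) ∧ verts F = g '' verts G := by
    intro F hF
    obtain ⟨G, hG, hGv⟩ := (hfW (verts F) (hsubS F hF)).1 ⟨F, hF, rfl⟩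
    refine ⟨G, ?_, ?_⟩
    · by_contra hcon
      push Not at hcon
      exact hG (funext hcon)
    · rw [hGv, Set.image_image]
      ext w
      constructor
      · intro hw; exact ⟨w, hw, hgf w (hsubS F hF hw)⟩
      · rintro ⟨u, hu, rfl⟩
        show g (f u) ∈ verts F
        rw [hgf u (hsubS F hF hu)]; exact hu
  -- squares are proper faces
  have hsq : ∀ (v : Fin (k+1) → Bool) i j, ∃ l, sq v i j l ≠ none := by
    intro v i j
    obtain ⟨l, hl⟩ : ∃ l, l ∉ ({i, j} : Finset (Fin (k+1))) := by
      by_contra hcon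
      push Not at hcon
      have h1 : (Finset.univ : Finset (Fin (k+1))).card ≤ ({i, j} : Finset (Fin (k+1))).card :=
        Finset.card_le_card fun l _ => hcon l
      have h2 : ({i, j} : Finset (Fin (k+1))).card ≤ 2 := Finset.card_le_two
      rw [Finset.card_univ, Fintype.card_fin] at h1
      omega
    simp only [Finset.mem_insert, Finset.mem_singleton] at hl
    exact ⟨l, by simp [sq, hl]⟩
  have hedge : ∀ v i, ∃ c, g (flp v i) = flp (g v) c := by
    intro v i
    obtain ⟨F, hF, hFv⟩ := hup (sq v i i) (hsq v i i)
    have m1 : g v ∈ verts F := by rw [hFv]; exact ⟨v, mem_sq.2 fun _ _ _ => rfl, rfl⟩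
    have m2 : g (flp v i) ∈ verts F := by rw [hFv]; exact ⟨_, mem_sq.2 fun l h _ => flp_ne _ h, rfl⟩
    have hne : g (flp v i) ≠ g v := fun h => flp_ne_self v i (hginj h)
    obtain ⟨c, hc⟩ := Function.ne_iff.1 hne
    have hc0 : F c = none := by
      rcases mem_verts.1 m1 c with h | h
      · exact h
      · rcases mem_verts.1 m2 c with h' | h'
        · exact h'
        · exact absurd (Option.some.inj (h'.trans h.symm)) hc
    have m3 := flp_mem m1 hc0
    rw [hFv] at m3
    obtain ⟨w, hw, hwe⟩ := m3
    refine ⟨c, ?_⟩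
    rcases sq_cases hw with rfl | rfl | rfl | rfl
    · exact absurd hwe.symm (flp_ne_self _ _)
    · exact hwe
    · exact hwe
    · rw [flp_flp] at hwe
      exact absurd hwe.symm (flp_ne_self _ _)
  choose c hc using hedge
  have hcinj : ∀ v i j, c v i = c v j → i = j := by
    intro v i j h
    apply flp_inj (v := v)
    apply hginj
    rw [hc, hc, h]
  have hcflip : ∀ v i j, c (flp v i) j = c v j := by
    intro v i j
    by_cases hij : i = j
    · subst hij
      have h1 := hc (flp v i) i
      rw [flp_flp, hc v i] at h1
      have h2 : flp (flp (g v) (c v i)) (c v i) = flp (flp (g v) (c v i)) (c (flp v i) i) := by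
        rw [flp_flp]; exact h1
      exact (flp_inj h2).symm
    · obtain ⟨F, hF, hFv⟩ := hup (sq v i j) (hsq v i j)
      have m1 : g v ∈ verts F := by rw [hFv]; exact ⟨v, mem_sq.2 fun _ _ _ => rfl, rfl⟩
      have m2 : g (flp v i) ∈ verts F := by rw [hFv]; exact ⟨_, mem_sq.2 fun l h _ => flp_ne _ h, rfl⟩
      have m3 : g (flp v j) ∈ verts F := by rw [hFv]; exact ⟨_, mem_sq.2 fun l _ h => flp_ne _ h, rfl⟩
      have hne : c v i ≠ c v j := fun h => hij (hcinj v i j h)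
      have f3 : F (c v j) = none := free_of_flp m1 (by rw [← hc]; exact m3)
      have m4 := flp_mem m2 f3
      rw [hFv] at m4
      obtain ⟨w, hw, hwe⟩ := m4
      rw [hc] at hwe
      rcases sq_cases hw with rfl | rfl | rfl | rfl
      · exfalso
        have := congrFun hwe (c w i)
        rw [flp_ne _ hne, flp_same] at this
        simp at this
      · exact absurd (by rw [← hwe, hc]) (flp_ne_self (flp (g v) (c v i)) (c v j))
      · exfalso
        rw [hc] at hwe
        have := congrFun hwe (c v i)
        rw [flp_ne _ hne, flp_ne _ hne, flp_same] at this
        simp at this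
      · rw [hc, hc] at hwe
        exact flp_inj hwe
  let v0 : Fin (k+1) → Bool := fun _ => false
  have hconst : ∀ v j, c v j = c v0 j := fun v =>
    flp_ind v0 (fun v => ∀ j, c v j = c v0 j) (fun j => rfl) (fun v i h j => (hcflip v i j).trans (h j)) v
  let e := c v0
  have hemb : Function.Injective e := fun i j h => hcinj v0 i j h
  have hgflp : ∀ v i, g (flp v i) = flp (g v) (e i) := fun v i => by rw [hc, hconst]
  have hform : ∀ v, (∀ l, l ∉ Set.range e → g v l = g v0 l) ∧ ∀ i, g v (e i) = xor (g v0 (e i)) (v i) := by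
    refine flp_ind v0 _ ⟨fun l _ => rfl, fun i => by simp [v0]⟩ ?_
    rintro v i ⟨h1, h2⟩
    rw [hgflp]
    refine ⟨fun l hl => ?_, fun j => ?_⟩
    · rw [flp_ne _ (fun h => hl ⟨i, h.symm⟩)]; exact h1 l hl
    · by_cases hj : j = i
      · subst hj; rw [flp_same, flp_same, h2]; simp
      · rw [flp_ne _ (fun h => hj (hemb h)), flp_ne _ hj, h2]
  classical
  let F0 : CubeFace n := fun l => if l ∈ Set.range e then none else some (g v0 l)
  have hF0e : ∀ i, F0 (e i) = none := fun i => by simp [F0]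
  have hF0n : ∀ l, l ∉ Set.range e → F0 l = some (g v0 l) := fun l hl => by simp only [F0]; rw [if_neg hl]
  have hverts : cvert S = verts F0 := by
    rw [hran]
    ext w
    constructor
    · rintro ⟨v, rfl⟩
      rw [mem_verts]
      intro l
      by_cases hl : l ∈ Set.range e
      · obtain ⟨i, rfl⟩ := hl; exact Or.inl (hF0e i)
      · right; rw [hF0n l hl, (hform v).1 l hl]
    · intro hw
      refine ⟨fun i => xor (g v0 (e i)) (w (e i)), ?_⟩
      funext l
      by_cases hl : l ∈ Set.range e
      · obtain ⟨i, rfl⟩ := hl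
        rw [(hform _).2]; simp
      · rw [(hform _).1 l hl]
        rcases mem_verts.1 hw l with h | h
        · rw [hF0n l hl] at h; simp at h
        · rw [hF0n l hl] at h; exact (Option.some.inj h).symm
  refine ⟨F0, ?_, ?_, hverts⟩
  · rw [dim_eq]
    have : fr F0 = Finset.univ.image e := by
      ext l
      rw [mem_fr]
      simp only [Finset.mem_image, Finset.mem_univ, true_and]
      constructor
      · intro h
        by_contra hl
        rw [hF0n l hl] at h; simp at h
      · rintro ⟨i, rfl⟩; exact hF0e i
    rw [this, Finset.card_image_of_injective _ hemb]; simp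
  · ext F
    constructor
    · intro hF
      refine ⟨le_of_verts (by rw [← hverts]; exact hsubS F hF), ?_⟩
      rintro rfl
      obtain ⟨G, ⟨i, hi⟩, hG⟩ := hdown _ hF
      rw [← hverts, hran] at hG
      have hall : ∀ v, v ∈ verts G := by
        intro v
        have : g v ∈ g '' verts G := by rw [← hG]; exact ⟨v, rfl⟩
        obtain ⟨u, hu, hu'⟩ := this
        rwa [← hginj hu']
      obtain ⟨b, hb⟩ := Option.ne_none_iff_exists'.1 hi
      have := (mem_verts.1 (hall fun _ => !b)) i
      rw [hb] at this
      simp at this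
    · rintro ⟨hle, hne⟩
      obtain ⟨l, hl⟩ := Function.ne_iff.1 hne
      have hl0 : F0 l = none := (hle l).resolve_right hl
      have hlr : l ∈ Set.range e := by
        by_contra h
        rw [hF0n l h] at hl0; simp at hl0
      obtain ⟨i, rfl⟩ := hlr
      rw [hF0e] at hl
      obtain ⟨b, hb⟩ := Option.ne_none_iff_exists'.1 hl
      let T : CubeFace (k+1) := fun _ => none
      obtain ⟨G, hGi, hGj⟩ : ∃ G : CubeFace (k+1), G i = some (xor (g v0 (e i)) b) ∧ ∀ j, j ≠ i → G j = none :=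
        ⟨setc T i (some (xor (g v0 (e i)) b)), setc_same _ _ _, fun j hj => setc_ne T _ hj⟩
      obtain ⟨F', hF', hFv⟩ := hup G ⟨i, by rw [hGi]; simp⟩
      refine hS F' hF' F (le_of_verts ?_)
      intro w hw
      have hw0 := verts_mono hle hw
      rw [← hverts, hran] at hw0
      obtain ⟨v, rfl⟩ := hw0
      rw [hFv]
      refine ⟨v, ?_, rfl⟩
      rw [mem_verts]
      intro j
      by_cases hj : j = i
      · subst hj
        right
        rw [hGi]
        have := mem_verts.1 hw (e j)
        rw [hb, (hform v).2] at this
        have h3 : xor (g v0 (e j)) (v j) = b := by simpa using this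
        rw [← h3]; simp
      · left; exact hGj j hj
end DH

open CubeFace in
/-- if `S ≅ ∂I^{k+1}` (`k ≥ 2`) is not the boundary of any face of a
cubical manifold `M ⊆ I^n` of dimension `d`, then `H_j(|M ∖ S|; ℤ/2) ≅ H_j(|M|; ℤ/2)`
for all `j ≤ d − 2` with `j ∉ {d − k, d − k − 1}`, while the homologies differ in some
degree `j ∈ {d − k, d − k − 1}`. -/
theorem deletion_homology_nonboundary_case
    {n d k : ℕ} (hk : 2 ≤ k)
    (M : Set (CubeFace n)) (hM : IsSubcomplex M) (hdim : HasDim M d)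
    (hman : IsCompactManifold (↥(real M)) d)
    (S : Set (CubeFace n)) (hS : IsSubcomplex S) (hSM : S ⊆ M)
    (hiso : Iso S (boundaryCube (k + 1)))
    (hbd : ¬ ∃ F ∈ M, dim F = k + 1 ∧ S = bdryHat F) :
    (∀ j : ℕ, j + 2 ≤ d → j ≠ d - k → j ≠ d - k - 1 →
      Nonempty (sHomology (ZMod 2) (↥(real (delete M S))) j ≅
        sHomology (ZMod 2) (↥(real M)) j)) ∧
    (∃ j : ℕ, (j = d - k ∨ j = d - k - 1) ∧
      ¬ Nonempty (sHomology (ZMod 2) (↥(real (delete M S))) j ≅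
        sHomology (ZMod 2) (↥(real M)) j)) := by
  have hMd : DH.Dn M := fun F hF G hG => hM.2 F hF G hG
  have hSd : DH.Dn S := fun F hF G hG => hS.2 F hF G hG
  obtain ⟨F, hdF, hSF, hv⟩ := DH.iso_face hk hSd hiso
  have hFM : F ∉ M := fun h => hbd ⟨F, h, hdF, hSF⟩
  have hbF : bdryHat F ⊆ M := hSF ▸ hSM
  obtain ⟨hX⟩ := hman.2
  have hkd : k ≤ d := by
    have hcard : (DH.fr F).card = k + 1 := by rw [← DH.dim_eq, hdF]
    obtain ⟨i, hi⟩ : (DH.fr F).Nonempty := Finset.card_pos.1 (by omega)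
    have hi0 := DH.mem_fr.1 hi
    have h1 := DH.dim_setc F false hi0
    have h2 : DH.setc F i (some false) ∈ M := by
      refine hbF ⟨DH.setc_le F _ hi0, ?_⟩
      intro h
      have h' := congrFun h i
      rw [DH.setc_same, hi0] at h'
      simp at h'
    have h3 := hdim.1 _ h2
    omega
  have hdel : delete M S = M \ DH.NN F ∅ := by
    ext H
    refine and_congr_right fun _ => ?_
    rw [hv, ← Set.not_nonempty_iff_eq_empty, DH.meet_iff]
  have hD : DH.Dn (delete M S) := by rw [hdel]; exact DH.Dn_up M hMd (DH.NN_up _ _)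
  obtain ⟨h1, j, hj, h2⟩ := DH.main_face hMd hX hFM hbF hdF hk hkd
  rw [← hdel] at h1 h2
  exact ⟨fun j ha hb hc => (DH.nonempty_iso hD hMd j).2 (h1 j ha hb hc),
    j, hj, fun h => h2 ((DH.nonempty_iso hD hMd j).1 h)⟩
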